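/- The ordered monomials {X̃_h}_{h∈𝓗} form a basis of Y_ħ^>(g) as a ℚ[ħ]-module; in particular, Y_ħ^>(g) is a free ℚ[ħ]-module. -/

import Mathlib

set_option synthInstance.maxHeartbeats 1000000
set_option maxHeartbeats 1600000

noncomputable section
open scoped BigOperators DirectSum

/-! ### Base field ℚ(v) and quantum numbers -/

/-- the base field `ℚ(v)`. -/
abbrev KK : Type := RatFunc ℚ
/-- the variable `v ∈ ℚ(v)`. -/
def vv : KK := RatFunc.X
/-- integer powers of `v`. -/
def vpow (m : ℤ) : KK := vv ^ m
/-- the quantum integer `[m]_u = (uᵐ - u⁻ᵐ)/(u - u⁻¹)`. -/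
def qInt (u : KK) (m : ℕ) : KK := (u ^ (m : ℤ) - u ^ (-(m : ℤ))) / (u - u⁻¹)
/-- the quantum factorial `[m]_u!`. -/
def qFact (u : KK) (m : ℕ) : KK := ∏ k ∈ Finset.range m, qInt u (k + 1)
/-- the quantum binomial coefficient. -/
def qBinom (u : KK) (m k : ℕ) : KK := qFact u m / (qFact u k * qFact u (m - k))
/-- `⟨m⟩_v = vᵐ - v⁻ᵐ`. -/
def qBrack (m : ℕ) : KK := vpow (m : ℤ) - vpow (-(m : ℤ))
/-- the sign `ε ∈ {+,-}` as `±1`. -/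
def sgn (ε : Bool) : ℤ := if ε then 1 else -1
/-- `l` is an integer power of `v`. -/
def IsVpow (l : KK) : Prop := ∃ m : ℤ, l = vpow m

/-! ### Cartan data of types `C_n` and `D_n` (1-based indices) -/

/-- the Cartan matrix of type `C_n` (1-based indices). -/
def aC (n i j : ℕ) : ℤ :=
  if i = j then 2 else if i + 1 = n ∧ j = n then -2
  else if i + 1 = j ∨ j + 1 = i then -1 else 0
/-- the symmetrizing integers `d_i` of type `C_n`. -/
def dC (n i : ℕ) : ℕ := if i = n then 2 else 1
/-- the Cartan matrix of type `D_n` (1-based indices). -/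
def aD (n i j : ℕ) : ℤ :=
  if i = j then 2
  else if (i + 1 = j ∧ j + 1 ≤ n) ∨ (j + 1 = i ∧ i + 1 ≤ n) then -1
  else if (i + 2 = n ∧ j = n) ∨ (j + 2 = n ∧ i = n) then -1 else 0
/-- the symmetrizing integers `d_i` of type `D_n` (all equal to `1`). -/
def dD (n i : ℕ) : ℕ := 1

/-! ### The positive subalgebra of the quantum loop algebra, for Cartan data `(A, Dd)` -/

section Ualg
variable (n : ℕ) (A : ℕ → ℕ → ℤ) (Dd : ℕ → ℕ)

/-- the free `ℚ(v)`-algebra on generators `e_{i,r}`, `i ∈ I`, `r ∈ ℤ`. -/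
abbrev FA := FreeAlgebra KK (Fin n × ℤ)
/-- the free generator `e_{i,r}`. -/
def fg (i : Fin n) (r : ℤ) : FA n := FreeAlgebra.ι KK (i, r)

/-- the `z^{-r₁}⋯z^{-r_m}w^{-t}`-coefficient of the Serre relation between colors `i ≠ j`. -/
def serreElt (i j : Fin n) (m : ℕ) (r : Fin m → ℤ) (t : ℤ) : FA n :=
  ∑ σ : Equiv.Perm (Fin m), ∑ k ∈ Finset.range (m + 1),
    ((-1 : KK) ^ k * qBinom (vpow (Dd (i.1 + 1))) m k) •
      (((List.ofFn fun l => fg n i (r (σ l))).take k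
        ++ fg n j t :: (List.ofFn fun l => fg n i (r (σ l))).drop k).prod)

/-- the defining relations of `U_v^>(Lg)` in the new Drinfeld realization: the coefficients of
`(z - v_i^{a_ij} w) e_i(z) e_j(w) = (v_i^{a_ij} z - w) e_j(w) e_i(z)` and of the Serre relations. -/
inductive URel : FA n → FA n → Prop
  | loop (i j : Fin n) (r s : ℤ) :
      URel (fg n i (r + 1) * fg n j s
             - vpow ((Dd (i.1 + 1) : ℤ) * A (i.1 + 1) (j.1 + 1)) • (fg n i r * fg n j (s + 1)))
           (vpow ((Dd (i.1 + 1) : ℤ) * A (i.1 + 1) (j.1 + 1)) • (fg n j s * fg n i (r + 1))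
             - fg n j (s + 1) * fg n i r)
  | serre (i j : Fin n) (hij : i ≠ j) (r : Fin (1 - A (i.1 + 1) (j.1 + 1)).toNat → ℤ) (t : ℤ) :
      URel (serreElt n Dd i j _ r t) 0

/-- the positive subalgebra `U_v^>(Lg)` of the quantum loop algebra. -/
abbrev UA := RingQuot (URel n A Dd)
/-- the generator `e_{i,r}` of `U_v^>(Lg)`. -/
def ug (i : Fin n) (r : ℤ) : UA n A Dd := RingQuot.mkAlgHom KK (URel n A Dd) (fg n i r)
/-- the generator `e_{i,r}` with a 1-based index `1 ≤ i ≤ n` (and junk value `0` otherwise). -/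
def g1 (i : ℕ) (r : ℤ) : UA n A Dd := if h : 1 ≤ i ∧ i ≤ n then ug n A Dd ⟨i - 1, by omega⟩ r else 0

end Ualg

/-! ### `q`-brackets, ordered monomials, and ℤ[v,v⁻¹]-forms -/

section Aux
variable {B : Type} [Ring B] [Module KK B]

/-- the `u`-commutator `[x,y]_u = xy - u · yx`. -/
def qcm (u : KK) (x y : B) : B := x * y - u • (y * x)

/-- the iterated `q`-bracket `[⋯[[g i₁ s₁, g i₂ s₂]_{λ₁}, g i₃ s₃]_{λ₂}, ⋯]_{λ_{ℓ-1}}`. -/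
def chainE (g : ℕ → ℤ → B) (w : List ℕ) (ss : List ℤ) (ls : List KK) : B :=
  match w, ss with
  | i :: w', s :: ss' =>
      ((w'.zip ss').zip ls).foldl
        (fun acc p => acc * g p.1.1 p.1.2 - p.2 • (g p.1.1 p.1.2 * acc)) (g i s)
  | _, _ => 0
end Aux

section Mon
variable {B : Type} [Ring B] {ι : Type} [LinearOrder ι]
/-- the ordered monomial `∏→ (E p)^(h p)`, the product taken in increasing order of `p`. -/
def ordMon (E : ι → B) (h : ι →₀ ℕ) : B := ((h.support.sort (· ≤ ·)).map (fun p => E p ^ h p)).prod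
end Mon

/-- the subring `ℤ[v,v⁻¹] ⊆ ℚ(v)`. -/
def Rint : Subring KK := Subring.closure {vv, vv⁻¹}

section Forms
variable {B : Type} [Ring B] [Algebra KK B]
/-- the `ℤ[v,v⁻¹]`-subalgebra of a `ℚ(v)`-algebra generated by a set `X`, realized as the subring
generated by `X` together with the central scalars `v^{±1}`. -/
def zvForm (X : Set B) : Subring B :=
  Subring.closure ({algebraMap KK B vv, algebraMap KK B vv⁻¹} ∪ X)
end Forms

/-! ### Positive roots of type `C_n` with the fixed convex (lexicographic) order -/

section RootsC
variable (n : ℕ)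

/-- Positive roots of type `C_n`, encoded as lexicographically ordered pairs `(i,t)`:
`[i,i+t]` for `i+t<n` or `i=n`; `[i,n,i]` for `i+t=n`, `i<n`; `[i,n]` for `i+t=n+1`;
`[i,n,j]` with `j = 2n+1-i-t` for `i+t ≥ n+2`.  The induced linear order is exactly the
convex order coming from standard Lyndon words. -/
def IsPosRootC (p : Fin (n + 1) ×ₗ Fin (2 * n + 1)) : Prop :=
  1 ≤ ((ofLex p).1 : ℕ) ∧ (((ofLex p).1 : ℕ) = n → ((ofLex p).2 : ℕ) = 0) ∧
    ((ofLex p).2 : ℕ) + 2 * ((ofLex p).1 : ℕ) ≤ 2 * n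

instance : DecidablePred (IsPosRootC n) := fun p => by unfold IsPosRootC; infer_instance

/-- the set `Δ⁺` of positive roots of type `C_n`, with its convex linear order. -/
abbrev PosRootC := {p : Fin (n + 1) ×ₗ Fin (2 * n + 1) // IsPosRootC n p}

variable {n}
/-- the first index `i` of a positive root. -/
def ri (β : PosRootC n) : ℕ := ((ofLex β.1).1 : ℕ)
/-- the offset `t` of a positive root within its block. -/
def rt (β : PosRootC n) : ℕ := ((ofLex β.1).2 : ℕ)

/-- multiplicity of `α_c` (1-based color `c`) in the positive root `β` (type `C_n`). -/
def nuC (β : PosRootC n) (c : ℕ) : ℕ :=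
  let i := ri β; let t := rt β
  if i + t < n ∨ i = n then (if i ≤ c ∧ c ≤ i + t then 1 else 0)
  else if i + t = n then (if i ≤ c ∧ c ≤ n - 1 then 2 else if c = n then 1 else 0)
  else if i + t = n + 1 then (if i ≤ c ∧ c ≤ n then 1 else 0)
  else (if i ≤ c ∧ c < 2 * n + 1 - i - t then 1
        else if 2 * n + 1 - i - t ≤ c ∧ c ≤ n - 1 then 2
        else if c = n then 1 else 0)

/-- standard Lyndon word (list of 1-based simple-root indices) of `β` (type `C_n`). -/
def wordC (β : PosRootC n) : List ℕ :=
  let i := ri β; let t := rt β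
  if i + t < n ∨ i = n then List.range' i (t + 1)
  else if i + t = n then List.range' i (n - i) ++ List.range' i (n - i) ++ [n]
  else if i + t = n + 1 then List.range' i (n - i + 1)
  else List.range' i (n - i + 1) ++ (List.range' (2 * n + 1 - i - t) (n - (2 * n + 1 - i - t))).reverse

/-- the height `|β|` of a positive root (type `C_n`). -/
def heightC (β : PosRootC n) : ℕ := (wordC β).length

/-- `β` is a root of the form `[i,n,i]`. -/
def isINI (β : PosRootC n) : Prop := ri β + rt β = n ∧ ri β < n
instance (β : PosRootC n) : Decidable (isINI β) := by unfold isINI; infer_instance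
end RootsC

/-! ### Positive roots of type `D_n` with the fixed convex (lexicographic) order -/

section RootsD
variable (n : ℕ)

/-- Positive roots of type `D_n`, encoded as lexicographically ordered pairs `(i,t)`:
`[i,i+t]` for `i+t<n` or `i=n`; `[i,n]` for `i+t=n`; `[i,n,n-1]` for `i+t=n+1`;
`[i,n,j]` with `j = 2n-i-t` for `i+t ≥ n+2`.  The induced linear order is exactly the
convex order coming from standard Lyndon words. -/
def IsPosRootD (p : Fin (n + 1) ×ₗ Fin (2 * n + 1)) : Prop :=
  1 ≤ ((ofLex p).1 : ℕ) ∧ (n - 1 ≤ ((ofLex p).1 : ℕ) → ((ofLex p).2 : ℕ) = 0) ∧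
    (((ofLex p).2 : ℕ) = 0 ∨ ((ofLex p).2 : ℕ) + 2 * ((ofLex p).1 : ℕ) + 1 ≤ 2 * n)

instance : DecidablePred (IsPosRootD n) := fun p => by unfold IsPosRootD; infer_instance

/-- the set `Δ⁺` of positive roots of type `D_n`, with its convex linear order. -/
abbrev PosRootD := {p : Fin (n + 1) ×ₗ Fin (2 * n + 1) // IsPosRootD n p}

variable {n}
/-- the first index `i` of a positive root. -/
def riD (β : PosRootD n) : ℕ := ((ofLex β.1).1 : ℕ)
/-- the offset `t` of a positive root within its block. -/
def rtD (β : PosRootD n) : ℕ := ((ofLex β.1).2 : ℕ)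

/-- multiplicity of `α_c` (1-based color `c`) in the positive root `β` (type `D_n`). -/
def nuD (β : PosRootD n) (c : ℕ) : ℕ :=
  let i := riD β; let t := rtD β
  if i + t < n ∨ i = n then (if i ≤ c ∧ c ≤ i + t then 1 else 0)
  else if i + t = n then (if (i ≤ c ∧ c ≤ n - 2) ∨ c = n then 1 else 0)
  else if i + t = n + 1 then (if i ≤ c ∧ c ≤ n then 1 else 0)
  else (if i ≤ c ∧ c < 2 * n - i - t then 1
        else if 2 * n - i - t ≤ c ∧ c ≤ n - 2 then 2
        else if c = n - 1 ∨ c = n then 1 else 0)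

/-- standard Lyndon word (list of 1-based simple-root indices) of `β` (type `D_n`). -/
def wordD (β : PosRootD n) : List ℕ :=
  let i := riD β; let t := rtD β
  if i + t < n ∨ i = n then List.range' i (t + 1)
  else if i + t = n then List.range' i (n - 1 - i) ++ [n]
  else if i + t = n + 1 then List.range' i (n - 1 - i) ++ [n, n - 1]
  else List.range' i (n - 1 - i) ++ [n] ++ (List.range' (2 * n - i - t) (n - (2 * n - i - t))).reverse

/-- the height `|β|` of a positive root (type `D_n`). -/
def heightD (β : PosRootD n) : ℕ := (wordD β).length

/-- `β` is a root of the form `[i,n,j]` with `i < j ≤ n-2`. -/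
def isSpecD (β : PosRootD n) : Prop := n + 2 ≤ riD β + rtD β
instance (β : PosRootD n) : Decidable (isSpecD β) := by unfold isSpecD; infer_instance
end RootsD

/-! ### The positive subalgebra of the Yangian, for Cartan data `(A, Dd)` -/

/-- the base ring `ℚ[ħ]`. -/
abbrev RH : Type := Polynomial ℚ
/-- the formal parameter `ħ`. -/
def hbar : RH := Polynomial.X

section Yang
variable (n : ℕ) (A : ℕ → ℕ → ℤ) (Dd : ℕ → ℕ)

/-- the free `ℚ[ħ]`-algebra on generators `x_{i,r}`, `i ∈ I`, `r ∈ ℕ`. -/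
abbrev FAY := FreeAlgebra RH (Fin n × ℕ)
/-- the free generator `x_{i,r}`. -/
def fy (i : Fin n) (r : ℕ) : FAY n := FreeAlgebra.ι RH (i, r)

/-- the defining relations of the positive subalgebra `Y_ħ^>(g)` of the Yangian. -/
inductive YRel : FAY n → FAY n → Prop
  | loop (i j : Fin n) (r s : ℕ) :
      YRel ((fy n i (r + 1) * fy n j s - fy n j s * fy n i (r + 1))
              - (fy n i r * fy n j (s + 1) - fy n j (s + 1) * fy n i r))
           ((Polynomial.C (((Dd (i.1 + 1) : ℚ) * (A (i.1 + 1) (j.1 + 1) : ℚ)) / 2) * hbar) •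
              (fy n i r * fy n j s + fy n j s * fy n i r))
  | serre (i j : Fin n) (hij : i ≠ j)
      (ss : Fin (1 - A (i.1 + 1) (j.1 + 1)).toNat → ℕ) (r : ℕ) :
      YRel (∑ σ : Equiv.Perm (Fin (1 - A (i.1 + 1) (j.1 + 1)).toNat),
              (List.ofFn fun l => fy n i (ss (σ l))).foldr (fun a b => a * b - b * a) (fy n j r)) 0

/-- the positive subalgebra `Y_ħ^>(g)` of the Yangian. -/
abbrev YA := RingQuot (YRel n A Dd)
/-- the generator `x_{i,r}` of `Y_ħ^>(g)`. -/
def yg (i : Fin n) (r : ℕ) : YA n A Dd := RingQuot.mkAlgHom RH (YRel n A Dd) (fy n i r)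
/-- the generator `x_{i,r}` with a 1-based index `1 ≤ i ≤ n` (and junk value `0` otherwise). -/
def gy1 (i : ℕ) (r : ℕ) : YA n A Dd :=
  if h : 1 ≤ i ∧ i ≤ n then yg n A Dd ⟨i - 1, by omega⟩ r else 0
end Yang

/-- the iterated commutator `[⋯[[g i₁ s₁, g i₂ s₂], g i₃ s₃], ⋯, g i_ℓ s_ℓ]`. -/
def chainY {B : Type} [Ring B] (g : ℕ → ℕ → B) (w : List ℕ) (ss : List ℕ) : B :=
  match w, ss with
  | i :: w', s :: ss' =>
      (w'.zip ss').foldl (fun acc p => acc * g p.1 p.2 - g p.1 p.2 * acc) (g i s)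
  | _, _ => 0

section YangC
variable (n : ℕ)
/-- the positive subalgebra of the Yangian of type `C_n`. -/
abbrev YC := YA n (aC n) (dC n)
/-- generators with 1-based indices (type `C_n`). -/
def genYC : ℕ → ℕ → YC n := gy1 n (aC n) (dC n)

variable {n}
/-- the specific root vector `X̃_{β,s}` of type `C_n`. -/
def xTildeC (β : PosRootC n) (s : ℕ) : YC n :=
  if isINI β then
    (let Ach := chainY (genYC (n := n)) (List.range' (ri β) (n - ri β))
        (List.replicate (n - ri β) 0)
     let Bch := Ach * genYC (n := n) n s - genYC (n := n) n s * Ach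
     Ach * Bch - Bch * Ach)
  else chainY (genYC (n := n)) (wordC β) (s :: List.replicate ((wordC β).length - 1) 0)

/-- `E` is a Yangian root vector `X_{β,s}` for a root of "chain" type, for some decomposition
`s = s₁ + ⋯ + s_ℓ` with `s_k ∈ ℕ`. -/
def IsRVYCchain (β : PosRootC n) (s : ℕ) (E : YC n) : Prop :=
  ∃ ss : List ℕ, ss.length = (wordC β).length ∧ ss.sum = s ∧
    E = chainY (genYC (n := n)) (wordC β) ss

/-- `E` is a Yangian root vector `X_{β,s}` of type `C_n` for some choice of decompositions. -/
def IsRVYC (β : PosRootC n) (s : ℕ) (E : YC n) : Prop :=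
  if isINI β then
    ∃ (β₁ β₂ : PosRootC n) (s₁ s₂ : ℕ) (E₁ E₂ : YC n),
      (ri β₁ = ri β ∧ ri β₁ + rt β₁ + 1 = n) ∧ (ri β₂ = ri β ∧ ri β₂ + rt β₂ = n + 1) ∧
      IsRVYCchain β₁ s₁ E₁ ∧ IsRVYCchain β₂ s₂ E₂ ∧
      s = s₁ + s₂ ∧ E = E₁ * E₂ - E₂ * E₁
  else IsRVYCchain β s E
end YangC

section YangD
variable (n : ℕ)
/-- the positive subalgebra of the Yangian of type `D_n`. -/
abbrev YD := YA n (aD n) (dD n)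
/-- generators with 1-based indices (type `D_n`). -/
def genYD : ℕ → ℕ → YD n := gy1 n (aD n) (dD n)

variable {n}
/-- the specific root vector `X̃_{β,s}` of type `D_n`. -/
def xTildeD (β : PosRootD n) (s : ℕ) : YD n :=
  chainY (genYD (n := n)) (wordD β) (s :: List.replicate ((wordD β).length - 1) 0)

/-- `E` is a Yangian root vector `X_{β,s}` of type `D_n` for some choice of decompositions. -/
def IsRVYD (β : PosRootD n) (s : ℕ) (E : YD n) : Prop :=
  ∃ ss : List ℕ, ss.length = (wordD β).length ∧ ss.sum = s ∧
    E = chainY (genYD (n := n)) (wordD β) ss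
end YangD

/-! ### Operators on functions on finite sets of points -/

section Operators
variable {R P : Type} [CommRing R] [DecidableEq P]

/-- Left shuffle multiplication by the point mass at a finite set `Q`. -/
def shuffleOp (θ : P → P → R) (Q : Finset P) : Module.End R (Finset P → R) where
  toFun f T := if Q ⊆ T then (∏ p ∈ Q, ∏ q ∈ T \ Q, θ p q) * f (T \ Q) else 0
  map_add' f g := by
    ext T; by_cases h : Q ⊆ T <;> simp [h, mul_add]
  map_smul' r f := by
    ext T; by_cases h : Q ⊆ T <;> simp [h, mul_left_comm]

lemma shuffleOp_apply (θ : P → P → R) (Q : Finset P) (f : Finset P → R) (T : Finset P) :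
    shuffleOp θ Q f T = if Q ⊆ T then (∏ p ∈ Q, ∏ q ∈ T \ Q, θ p q) * f (T \ Q) else 0 := rfl

/-- Left shuffle multiplication by a single point. -/
def ptOp (θ : P → P → R) (p : P) : Module.End R (Finset P → R) := shuffleOp θ {p}

lemma ptOp_apply (θ : P → P → R) (p : P) (f : Finset P → R) (T : Finset P) :
    ptOp θ p f T = if p ∈ T then (∏ q ∈ T.erase p, θ p q) * f (T.erase p) else 0 := by
  simp [ptOp, shuffleOp_apply, Finset.sdiff_singleton_eq_erase]

lemma ptOp_mul_shuffleOp (θ : P → P → R) (p : P) (Q : Finset P) :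
    ptOp θ p * shuffleOp θ Q =
      if p ∈ Q then 0 else (∏ q ∈ Q, θ p q) • shuffleOp θ (insert p Q) := by
  ext f T
  rw [Module.End.mul_apply, ptOp_apply, shuffleOp_apply]
  by_cases hp : p ∈ Q
  · have : ¬ Q ⊆ T.erase p := fun h => by simpa using h hp
    simp [hp, this]
  · simp only [hp, if_false, LinearMap.smul_apply, Pi.smul_apply, shuffleOp_apply, smul_eq_mul]
    by_cases hT : insert p Q ⊆ T
    · have h1 := Finset.insert_subset_iff.1 hT
      have h2 : Q ⊆ T.erase p := fun x hx =>
        Finset.mem_erase.2 ⟨fun h => hp (h ▸ hx), h1.2 hx⟩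
      have h3 : T.erase p \ Q = T \ insert p Q := by
        ext x; simp only [Finset.mem_sdiff, Finset.mem_erase, Finset.mem_insert]; tauto
      rw [if_pos h1.1, if_pos h2, if_pos hT, Finset.prod_insert hp, h3,
        ← Finset.prod_sdiff h2, h3]
      ring
    · rw [if_neg hT, mul_zero]
      by_cases h1 : p ∈ T
      · have h2 : ¬ Q ⊆ T.erase p := fun h => hT (Finset.insert_subset h1
          (h.trans (Finset.erase_subset _ _)))
        simp [h2]
      · simp [h1]

lemma ptOp_eq (θ : P → P → R) (p : P) : ptOp θ p = shuffleOp θ {p} := rfl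

lemma ptOp_mul_ptOp (θ : P → P → R) (p q : P) (h : p ≠ q) :
    ptOp θ p * ptOp θ q = θ p q • shuffleOp θ {p, q} := by
  rw [ptOp_eq θ q, ptOp_mul_shuffleOp]; simp [h]

lemma ptOp_mul_self (θ : P → P → R) (p : P) : ptOp θ p * ptOp θ p = 0 := by
  rw [ptOp_eq θ p, ← ptOp_eq, ptOp_eq θ p, ← ptOp_eq]
  nth_rw 2 [ptOp_eq]
  rw [ptOp_mul_shuffleOp]; simp

lemma ptOp_mul₃ (θ : P → P → R) (p q r : P) :
    ptOp θ p * (ptOp θ q * ptOp θ r) = if p ≠ q ∧ p ≠ r ∧ q ≠ r then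
      (θ p q * θ p r * θ q r) • shuffleOp θ {p, q, r} else 0 := by
  by_cases h1 : q = r
  · subst h1; simp [ptOp_mul_self]
  rw [ptOp_mul_ptOp θ q r h1, mul_smul_comm, ptOp_mul_shuffleOp]
  by_cases h2 : p = q
  · simp [h2]
  by_cases h3 : p = r
  · simp [h3]
  simp [h1, h2, h3, smul_smul, mul_comm, Finset.prod_pair]

lemma ptOp_mul₄ (θ : P → P → R) (o p q r : P) :
    ptOp θ o * (ptOp θ p * (ptOp θ q * ptOp θ r)) =
      if o ≠ p ∧ o ≠ q ∧ o ≠ r ∧ p ≠ q ∧ p ≠ r ∧ q ≠ r then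
      (θ o p * θ o q * θ o r * θ p q * θ p r * θ q r) • shuffleOp θ {o, p, q, r} else 0 := by
  rw [ptOp_mul₃]
  by_cases h : p ≠ q ∧ p ≠ r ∧ q ≠ r
  · rw [if_pos h, mul_smul_comm, ptOp_mul_shuffleOp]
    by_cases h2 : o ∈ ({p, q, r} : Finset P)
    · rw [if_pos h2, smul_zero, if_neg]
      simp only [Finset.mem_insert, Finset.mem_singleton] at h2
      tauto
    · rw [if_neg h2]
      simp only [Finset.mem_insert, Finset.mem_singleton, not_or] at h2
      rw [if_pos ⟨h2.1, h2.2.1, h2.2.2, h⟩, smul_smul]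
      congr 1
      rw [Finset.prod_insert (by simp [h.1, h.2.1]), Finset.prod_pair h.2.2]
      ring
  · rw [if_neg h, mul_zero, if_neg]; tauto

end Operators

/-! ### Scalar identities behind the Serre relations -/

lemma serre_scalar_two {R : Type} [CommRing R] [IsDomain R] (w1 w2 w3 t a b α β : R)
    (h12 : (w1 - w2) * t = α) (h13 : (w1 - w3) * a = β) (h23 : (w2 - w3) * b = β)
    (hα : α = -2 * β) (n12 : w1 ≠ w2) (n13 : w1 ≠ w3) (n23 : w2 ≠ w3) :
    t * (a - b) = 2 * a * b := by
  have e12 := sub_ne_zero.2 n12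
  have e13 := sub_ne_zero.2 n13
  have e23 := sub_ne_zero.2 n23
  refine mul_left_cancel₀ (mul_ne_zero (mul_ne_zero e12 e13) e23) ?_
  subst hα
  linear_combination (((w1-w3)*a)*(w2-w3) - ((w2-w3)*b)*(w1-w3)) * h12
    + (-2 * β * (w2 - w3) - 2 * (w1-w2) * ((w2-w3)*b)) * h13
    + (2*β*(w1-w3) - 2*(w1-w2)*β) * h23

lemma serre_scalar_one {R : Type} [CommRing R] [IsDomain R] (w1 w2 w3 t a b α β : R)
    (h12 : (w1 - w2) * t = α) (h13 : (w1 - w3) * a = β) (h23 : (w2 - w3) * b = β)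
    (hα : α = - β) (n12 : w1 ≠ w2) (n13 : w1 ≠ w3) (n23 : w2 ≠ w3) :
    t * (a - b) = a * b := by
  have e12 := sub_ne_zero.2 n12
  have e13 := sub_ne_zero.2 n13
  have e23 := sub_ne_zero.2 n23
  refine mul_left_cancel₀ (mul_ne_zero (mul_ne_zero e12 e13) e23) ?_
  subst hα
  linear_combination (((w1-w3)*a)*(w2-w3) - ((w2-w3)*b)*(w1-w3)) * h12
    + (-β * (w2 - w3) - (w1-w2) * ((w2-w3)*b)) * h13
    + (β*(w1-w3) - (w1-w2)*β) * h23

lemma serre_scalar_three {R : Type} [CommRing R] [IsDomain R] (w1 w2 w3 r s t α : R)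
    (h12 : (w1 - w2) * r = α) (h13 : (w1 - w3) * s = α) (h23 : (w2 - w3) * t = α)
    (n12 : w1 ≠ w2) (n13 : w1 ≠ w3) (n23 : w2 ≠ w3) :
    r * t - t * s - s * r = 0 := by
  have e12 := sub_ne_zero.2 n12
  have e13 := sub_ne_zero.2 n13
  have e23 := sub_ne_zero.2 n23
  refine mul_left_cancel₀ (mul_ne_zero (mul_ne_zero e12 e13) e23) ?_
  linear_combination ((w1-w3)*((w2-w3)*t) - (w2-w3)*((w1-w3)*s)) * h12
    + (-(w1-w2)*((w2-w3)*t) - (w2-w3)*α) * h13 + ((w1-w3)*α - (w1-w2)*α) * h23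

section Serre
variable {R P : Type} [CommRing R] [DecidableEq P]

lemma serre_op_two (θ : P → P → R) (p₁ p₂ q : P)
    (H : p₁ ≠ p₂ → p₁ ≠ q → p₂ ≠ q → ∃ t a b : R,
      θ p₁ p₂ = 1 + t ∧ θ p₂ p₁ = 1 - t ∧ θ p₁ q = 1 + a ∧ θ q p₁ = 1 - a ∧
      θ p₂ q = 1 + b ∧ θ q p₂ = 1 - b ∧ t * (a - b) = 2 * a * b) :
    ⁅ptOp θ p₁, ⁅ptOp θ p₂, ptOp θ q⁆⁆ + ⁅ptOp θ p₂, ⁅ptOp θ p₁, ptOp θ q⁆⁆ = 0 := by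
  simp only [Ring.lie_def, mul_sub, sub_mul, mul_assoc, ptOp_mul₃]
  by_cases h12 : p₁ = p₂
  · subst h12; simp
  by_cases h13 : p₁ = q
  · subst h13; simp [Ne.symm h12]
  by_cases h23 : p₂ = q
  · subst h23; simp [Ne.symm h12]
  obtain ⟨t, a, b, e1, e2, e3, e4, e5, e6, h⟩ := H h12 h13 h23
  have s1 : ({p₁, q, p₂} : Finset P) = {p₁, p₂, q} := by ext; simp only [Finset.mem_insert, Finset.mem_singleton, or_comm, or_left_comm]
  have s2 : ({p₂, q, p₁} : Finset P) = {p₁, p₂, q} := by ext; simp only [Finset.mem_insert, Finset.mem_singleton, or_comm, or_left_comm]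
  have s3 : ({p₂, p₁, q} : Finset P) = {p₁, p₂, q} := by ext; simp only [Finset.mem_insert, Finset.mem_singleton, or_comm, or_left_comm]
  have s4 : ({q, p₁, p₂} : Finset P) = {p₁, p₂, q} := by ext; simp only [Finset.mem_insert, Finset.mem_singleton, or_comm, or_left_comm]
  have s5 : ({q, p₂, p₁} : Finset P) = {p₁, p₂, q} := by ext; simp only [Finset.mem_insert, Finset.mem_singleton, or_comm, or_left_comm]
  simp only [ne_eq, h12, h13, h23, Ne.symm h12, Ne.symm h13, Ne.symm h23, not_false_eq_true,
    and_self, if_true, s1, s2, s3, s4, s5, e1, e2, e3, e4, e5, e6]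
  match_scalars
  linear_combination (-4) * h

lemma serre_op_three (θ : P → P → R) (p₁ p₂ p₃ q : P)
    (H : p₁ ≠ p₂ → p₁ ≠ p₃ → p₂ ≠ p₃ → p₁ ≠ q → p₂ ≠ q → p₃ ≠ q → ∃ r s t a b c : R,
      θ p₁ p₂ = 1 + r ∧ θ p₂ p₁ = 1 - r ∧ θ p₁ p₃ = 1 + s ∧ θ p₃ p₁ = 1 - s ∧
      θ p₂ p₃ = 1 + t ∧ θ p₃ p₂ = 1 - t ∧ θ p₁ q = 1 + a ∧ θ q p₁ = 1 - a ∧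
      θ p₂ q = 1 + b ∧ θ q p₂ = 1 - b ∧ θ p₃ q = 1 + c ∧ θ q p₃ = 1 - c ∧
      r * (a - b) = a * b ∧ s * (a - c) = a * c ∧ t * (b - c) = b * c ∧
      r * t - t * s - s * r = 0) :
    ⁅ptOp θ p₁, ⁅ptOp θ p₂, ⁅ptOp θ p₃, ptOp θ q⁆⁆⁆ +
    ⁅ptOp θ p₁, ⁅ptOp θ p₃, ⁅ptOp θ p₂, ptOp θ q⁆⁆⁆ +
    ⁅ptOp θ p₂, ⁅ptOp θ p₁, ⁅ptOp θ p₃, ptOp θ q⁆⁆⁆ +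
    ⁅ptOp θ p₂, ⁅ptOp θ p₃, ⁅ptOp θ p₁, ptOp θ q⁆⁆⁆ +
    ⁅ptOp θ p₃, ⁅ptOp θ p₁, ⁅ptOp θ p₂, ptOp θ q⁆⁆⁆ +
    ⁅ptOp θ p₃, ⁅ptOp θ p₂, ⁅ptOp θ p₁, ptOp θ q⁆⁆⁆ = 0 := by
  simp only [Ring.lie_def, mul_sub, sub_mul, mul_assoc, ptOp_mul₄]
  by_cases h12 : p₁ = p₂
  · subst h12; simp
  by_cases h13 : p₁ = p₃
  · subst h13; simp
  by_cases h23 : p₂ = p₃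
  · subst h23; simp
  by_cases h1 : p₁ = q
  · subst h1; simp
  by_cases h2 : p₂ = q
  · subst h2; simp
  by_cases h3 : p₃ = q
  · subst h3; simp
  obtain ⟨r, s, t, a, b, c, e1, e2, e3, e4, e5, e6, e7, e8, e9, e10, e11, e12, i1, i2, i3, i4⟩ :=
    H h12 h13 h23 h1 h2 h3
  generalize hS : ({p₁, p₂, p₃, q} : Finset P) = S
  have key : ∀ w x y z : P, ({w, x, y, z} : Finset P) = {p₁, p₂, p₃, q} →
      shuffleOp θ {w, x, y, z} = shuffleOp θ S := fun w x y z h => by rw [h, hS]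
  simp only [ne_eq, h12, h13, h23, h1, h2, h3, Ne.symm h12, Ne.symm h13, Ne.symm h23, Ne.symm h1,
    Ne.symm h2, Ne.symm h3, not_false_eq_true, and_self, if_true]
  have t1 := key p₁ p₂ q p₃ (by ext; simp only [Finset.mem_insert, Finset.mem_singleton, or_comm, or_left_comm])
  have t2 := key p₁ p₃ q p₂ (by ext; simp only [Finset.mem_insert, Finset.mem_singleton, or_comm, or_left_comm])
  have t3 := key p₁ p₃ p₂ q (by ext; simp only [Finset.mem_insert, Finset.mem_singleton, or_comm, or_left_comm])
  have t4 := key p₁ q p₃ p₂ (by ext; simp only [Finset.mem_insert, Finset.mem_singleton, or_comm, or_left_comm])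
  have t5 := key p₁ q p₂ p₃ (by ext; simp only [Finset.mem_insert, Finset.mem_singleton, or_comm, or_left_comm])
  have t6 := key p₂ p₁ q p₃ (by ext; simp only [Finset.mem_insert, Finset.mem_singleton, or_comm, or_left_comm])
  have t7 := key p₂ p₃ q p₁ (by ext; simp only [Finset.mem_insert, Finset.mem_singleton, or_comm, or_left_comm])
  have t8 := key p₂ p₃ p₁ q (by ext; simp only [Finset.mem_insert, Finset.mem_singleton, or_comm, or_left_comm])
  have t9 := key p₂ q p₃ p₁ (by ext; simp only [Finset.mem_insert, Finset.mem_singleton, or_comm, or_left_comm])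
  have t10 := key p₂ q p₁ p₃ (by ext; simp only [Finset.mem_insert, Finset.mem_singleton, or_comm, or_left_comm])
  have t11 := key p₂ p₁ p₃ q (by ext; simp only [Finset.mem_insert, Finset.mem_singleton, or_comm, or_left_comm])
  have t12 := key p₃ p₁ q p₂ (by ext; simp only [Finset.mem_insert, Finset.mem_singleton, or_comm, or_left_comm])
  have t13 := key p₃ p₂ q p₁ (by ext; simp only [Finset.mem_insert, Finset.mem_singleton, or_comm, or_left_comm])
  have t14 := key p₃ p₂ p₁ q (by ext; simp only [Finset.mem_insert, Finset.mem_singleton, or_comm, or_left_comm])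
  have t15 := key p₃ q p₂ p₁ (by ext; simp only [Finset.mem_insert, Finset.mem_singleton, or_comm, or_left_comm])
  have t16 := key p₃ q p₁ p₂ (by ext; simp only [Finset.mem_insert, Finset.mem_singleton, or_comm, or_left_comm])
  have t17 := key p₃ p₁ p₂ q (by ext; simp only [Finset.mem_insert, Finset.mem_singleton, or_comm, or_left_comm])
  have t18 := key q p₁ p₂ p₃ (by ext; simp only [Finset.mem_insert, Finset.mem_singleton, or_comm, or_left_comm])
  have t19 := key q p₁ p₃ p₂ (by ext; simp only [Finset.mem_insert, Finset.mem_singleton, or_comm, or_left_comm])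
  have t20 := key q p₂ p₁ p₃ (by ext; simp only [Finset.mem_insert, Finset.mem_singleton, or_comm, or_left_comm])
  have t21 := key q p₂ p₃ p₁ (by ext; simp only [Finset.mem_insert, Finset.mem_singleton, or_comm, or_left_comm])
  have t22 := key q p₃ p₁ p₂ (by ext; simp only [Finset.mem_insert, Finset.mem_singleton, or_comm, or_left_comm])
  have t23 := key q p₃ p₂ p₁ (by ext; simp only [Finset.mem_insert, Finset.mem_singleton, or_comm, or_left_comm])
  simp only [t1, t2, t3, t4, t5, t6, t7, t8, t9, t10, t11, t12, t13, t14, t15, t16, t17, t18,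
    t19, t20, t21, t22, t23, e1, e2, e3, e4, e5, e6, e7, e8, e9, e10, e11, e12]
  match_scalars
  ring_nf
  grind
end Serre

/-! ### Serre sums as nested brackets -/

lemma sum_perm_fin_two {B : Type} [AddCommMonoid B] (F : Fin 2 → Fin 2 → B) :
    ∑ σ : Equiv.Perm (Fin 2), F (σ 0) (σ 1) = F 0 1 + F 1 0 := by
  have : (Finset.univ : Finset (Equiv.Perm (Fin 2))) = {1, Equiv.swap 0 1} := by decide
  rw [this, Finset.sum_pair (by decide)]
  rfl

lemma sum_perm_fin_three {B : Type} [AddCommMonoid B] (F : Fin 3 → Fin 3 → Fin 3 → B) :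
    ∑ σ : Equiv.Perm (Fin 3), F (σ 0) (σ 1) (σ 2) =
      F 0 1 2 + F 0 2 1 + F 1 0 2 + F 1 2 0 + F 2 0 1 + F 2 1 0 := by
  have : (Finset.univ : Finset (Equiv.Perm (Fin 3))) =
    {1, Equiv.swap 1 2, Equiv.swap 0 1, Equiv.swap 0 1 * Equiv.swap 1 2,
      Equiv.swap 1 2 * Equiv.swap 0 1, Equiv.swap 0 2} := by decide
  rw [this, Finset.sum_insert (by decide), Finset.sum_insert (by decide),
    Finset.sum_insert (by decide), Finset.sum_insert (by decide), Finset.sum_pair (by decide)]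
  simp only [add_assoc]
  rfl

section SerreSum
variable {B : Type} [Ring B] (X : ℕ → B) (y : B)

/-- The Serre sum with `m` outer brackets. -/
def serreSum (m : ℕ) (ss : Fin m → ℕ) : B :=
  ∑ σ : Equiv.Perm (Fin m), (List.ofFn fun l => X (ss (σ l))).foldr (fun a b => a * b - b * a) y

lemma map_serreSum {B' F : Type} [Ring B'] [FunLike F B B'] [RingHomClass F B B'] (φ : F) (m : ℕ)
    (ss : Fin m → ℕ) : φ (serreSum X y m ss) = serreSum (fun r => φ (X r)) (φ y) m ss := by
  have h : ∀ l : List B, φ (l.foldr (fun a b => a * b - b * a) y) =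
      (l.map φ).foldr (fun a b => a * b - b * a) (φ y) := by
    intro l
    induction l with
    | nil => rfl
    | cons a l ih => simp only [List.foldr_cons, List.map_cons, map_sub, map_mul, ih]
  simp only [serreSum, map_sum, h, List.map_ofFn]
  rfl

lemma serreSum_one (ss : Fin 1 → ℕ) : serreSum X y 1 ss = ⁅X (ss 0), y⁆ := by
  simp [serreSum, List.ofFn_succ, Ring.lie_def]

lemma serreSum_two (ss : Fin 2 → ℕ) : serreSum X y 2 ss =
    ⁅X (ss 0), ⁅X (ss 1), y⁆⁆ + ⁅X (ss 1), ⁅X (ss 0), y⁆⁆ := by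
  rw [serreSum, ← sum_perm_fin_two fun a b => ⁅X (ss a), ⁅X (ss b), y⁆⁆]
  simp [List.ofFn_succ, Ring.lie_def]

lemma serreSum_three (ss : Fin 3 → ℕ) : serreSum X y 3 ss =
    ⁅X (ss 0), ⁅X (ss 1), ⁅X (ss 2), y⁆⁆⁆ + ⁅X (ss 0), ⁅X (ss 2), ⁅X (ss 1), y⁆⁆⁆ +
    ⁅X (ss 1), ⁅X (ss 0), ⁅X (ss 2), y⁆⁆⁆ + ⁅X (ss 1), ⁅X (ss 2), ⁅X (ss 0), y⁆⁆⁆ +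
    ⁅X (ss 2), ⁅X (ss 0), ⁅X (ss 1), y⁆⁆⁆ + ⁅X (ss 2), ⁅X (ss 1), ⁅X (ss 0), y⁆⁆⁆ := by
  rw [serreSum, ← sum_perm_fin_three fun a b c => ⁅X (ss a), ⁅X (ss b), ⁅X (ss c), y⁆⁆⁆]
  simp [List.ofFn_succ, Ring.lie_def]

end SerreSum

section WeightedSums
variable {R B Z Y : Type} [CommRing R] [Ring B] [Algebra R B] [Fintype Z] [Fintype Y]

lemma lie_sum_smul (a : Z → R) (b : Y → R) (u : Z → B) (v : Y → B) :
    ⁅∑ z, a z • u z, ∑ y, b y • v y⁆ =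
      ∑ x : Z × Y, (a x.1 * b x.2) • ⁅u x.1, v x.2⁆ := by
  simp only [LieRing.of_associative_ring_bracket, Finset.sum_mul, Finset.mul_sum,
    smul_mul_smul_comm, smul_sub, Finset.sum_sub_distrib, Fintype.sum_prod_type]
  congr 1
  rw [Finset.sum_comm]
  simp only [mul_comm]

/-- The weighted power sum of a family of elements. -/
def wsum (w : Z → R) (u : Z → B) (r : ℕ) : B := ∑ z, w z ^ r • u z

variable (w : Z → R) (w' : Y → R) (u : Z → B) (v : Y → B)

lemma lie_wsum (a b : ℕ) : ⁅wsum w u a, wsum w' v b⁆ =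
    ∑ z, ∑ y, (w z ^ a * w' y ^ b) • ⁅u z, v y⁆ := by
  rw [wsum, wsum, lie_sum_smul, Fintype.sum_prod_type]

lemma lie_wsum₃ (a b c : ℕ) : ⁅wsum w u a, ⁅wsum w u b, wsum w' v c⁆⁆ =
    ∑ z₁, ∑ z₂, ∑ y, (w z₁ ^ a * w z₂ ^ b * w' y ^ c) • ⁅u z₁, ⁅u z₂, v y⁆⁆ := by
  rw [wsum, wsum, wsum, lie_sum_smul, lie_sum_smul, Fintype.sum_prod_type]
  simp only [Fintype.sum_prod_type, mul_assoc]

lemma lie_wsum₄ (a b c d : ℕ) : ⁅wsum w u a, ⁅wsum w u b, ⁅wsum w u c, wsum w' v d⁆⁆⁆ =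
    ∑ z₁, ∑ z₂, ∑ z₃, ∑ y, (w z₁ ^ a * w z₂ ^ b * w z₃ ^ c * w' y ^ d) •
      ⁅u z₁, ⁅u z₂, ⁅u z₃, v y⁆⁆⁆ := by
  rw [wsum, wsum, wsum, wsum, lie_sum_smul, lie_sum_smul, lie_sum_smul, Fintype.sum_prod_type]
  simp only [Fintype.sum_prod_type, mul_assoc]

variable {u v}

lemma wsum_serre_two (H : ∀ z₁ z₂ y, ⁅u z₁, ⁅u z₂, v y⁆⁆ + ⁅u z₂, ⁅u z₁, v y⁆⁆ = 0) (a b c : ℕ) :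
    ⁅wsum w u a, ⁅wsum w u b, wsum w' v c⁆⁆ + ⁅wsum w u b, ⁅wsum w u a, wsum w' v c⁆⁆ = 0 := by
  rw [lie_wsum₃ w w' u v b a c, Finset.sum_comm, lie_wsum₃]
  simp only [← Finset.sum_add_distrib]
  refine Finset.sum_eq_zero fun z _ => Finset.sum_eq_zero fun z' _ =>
    Finset.sum_eq_zero fun y _ => ?_
  rw [mul_comm (w z' ^ b), ← smul_add, H, smul_zero]

lemma wsum_serre_three (H : ∀ z₁ z₂ z₃ y, ⁅u z₁, ⁅u z₂, ⁅u z₃, v y⁆⁆⁆ +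
    ⁅u z₁, ⁅u z₃, ⁅u z₂, v y⁆⁆⁆ + ⁅u z₂, ⁅u z₁, ⁅u z₃, v y⁆⁆⁆ + ⁅u z₂, ⁅u z₃, ⁅u z₁, v y⁆⁆⁆ +
    ⁅u z₃, ⁅u z₁, ⁅u z₂, v y⁆⁆⁆ + ⁅u z₃, ⁅u z₂, ⁅u z₁, v y⁆⁆⁆ = 0) (a b c d : ℕ) :
    ⁅wsum w u a, ⁅wsum w u b, ⁅wsum w u c, wsum w' v d⁆⁆⁆ +
    ⁅wsum w u a, ⁅wsum w u c, ⁅wsum w u b, wsum w' v d⁆⁆⁆ +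
    ⁅wsum w u b, ⁅wsum w u a, ⁅wsum w u c, wsum w' v d⁆⁆⁆ +
    ⁅wsum w u b, ⁅wsum w u c, ⁅wsum w u a, wsum w' v d⁆⁆⁆ +
    ⁅wsum w u c, ⁅wsum w u a, ⁅wsum w u b, wsum w' v d⁆⁆⁆ +
    ⁅wsum w u c, ⁅wsum w u b, ⁅wsum w u a, wsum w' v d⁆⁆⁆ = 0 := by
  have h1 : ∀ F : Z → Z → Z → B, ∑ x, ∑ y, ∑ z, F x y z = ∑ x, ∑ y, ∑ z, F x z y := fun F =>
    Finset.sum_congr rfl fun x _ => Finset.sum_comm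
  have h2 : ∀ F : Z → Z → Z → B, ∑ x, ∑ y, ∑ z, F x y z = ∑ x, ∑ y, ∑ z, F y x z :=
    fun F => Finset.sum_comm
  have e2 := (lie_wsum₄ w w' u v a c b d).trans (h1 _)
  have e3 := (lie_wsum₄ w w' u v b a c d).trans (h2 _)
  have e4 := ((lie_wsum₄ w w' u v b c a d).trans (h1 _)).trans (h2 _)
  have e5 := ((lie_wsum₄ w w' u v c a b d).trans (h2 _)).trans (h1 _)
  have e6 := ((lie_wsum₄ w w' u v c b a d).trans (h1 _)).trans (h2 _) |>.trans (h1 _)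
  rw [e2, e3, e4, e5, e6, lie_wsum₄]
  simp only [← Finset.sum_add_distrib]
  refine Finset.sum_eq_zero fun x _ => Finset.sum_eq_zero fun y _ =>
    Finset.sum_eq_zero fun z _ => Finset.sum_eq_zero fun o _ => ?_
  rw [← smul_zero (w x ^ a * w y ^ b * w z ^ c * w' o ^ d), ← H x y z o]
  simp only [smul_add, mul_comm, mul_left_comm, mul_assoc]

end WeightedSums

/-! ### Shuffle representations of the Yangian -/

/-- The basic numerical properties of the Cartan data which are used below. -/
structure CartanLike (n : ℕ) (A : ℕ → ℕ → ℤ) (Dd : ℕ → ℕ) : Prop where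
  diag : ∀ i, A i i = 2
  offdiag : ∀ i j, i ≠ j → A i j = 0 ∨ A i j = -1 ∨ A i j = -2
  symm : ∀ i j, i ∈ Finset.Icc 1 n → j ∈ Finset.Icc 1 n →
    (Dd i : ℚ) * A i j = (Dd j : ℚ) * A j i
  pos : ∀ i, Dd i ≠ 0

/-- The structure constant `d_i a_{ij} / 2`. -/
def halfForm (A : ℕ → ℕ → ℤ) (Dd : ℕ → ℕ) (i j : ℕ) : ℚ := (Dd i : ℚ) * (A i j : ℚ) / 2

lemma halfForm_ii {n : ℕ} {A : ℕ → ℕ → ℤ} {Dd : ℕ → ℕ} (hA : CartanLike n A Dd) (i : ℕ) :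
    halfForm A Dd i i = Dd i := by
  simp [halfForm, hA.diag]

/-- Evaluation data: spectral values and interaction factors at colored points. -/
structure EvalData (n : ℕ) (A : ℕ → ℕ → ℤ) (Dd : ℕ → ℕ) (R Z : Type) [CommRing R]
    [Algebra RH R] where
  /-- spectral values -/
  w : Z × ℕ → R
  /-- interaction factors -/
  th : Z × ℕ → Z × ℕ → R
  th_add : ∀ p q, p.2 ∈ Finset.Icc 1 n → q.2 ∈ Finset.Icc 1 n → p ≠ q → th p q + th q p = 2
  th_sub : ∀ p q, p.2 ∈ Finset.Icc 1 n → q.2 ∈ Finset.Icc 1 n → p ≠ q →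
    (w p - w q) * (th p q - 1) =
      algebraMap RH R (Polynomial.C (halfForm A Dd p.2 q.2) * hbar)
  w_ne : ∀ p q, p.2 ∈ Finset.Icc 1 n → q.2 ∈ Finset.Icc 1 n → p ≠ q →
    halfForm A Dd p.2 q.2 ≠ 0 → w p ≠ w q
  th_eq_one : ∀ p q, p.2 ∈ Finset.Icc 1 n → q.2 ∈ Finset.Icc 1 n → p ≠ q →
    halfForm A Dd p.2 q.2 = 0 → th p q = 1

namespace EvalData
variable {n : ℕ} {A : ℕ → ℕ → ℤ} {Dd : ℕ → ℕ} {R Z : Type} [CommRing R]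
  [Algebra RH R] [Fintype Z] [DecidableEq Z] (E : EvalData n A Dd R Z)

/-- The operator by which `x_{i,r}` acts. -/
def gen (i r : ℕ) : Module.End R (Finset (Z × ℕ) → R) :=
  wsum (fun z => E.w (z, i)) (fun z => ptOp E.th (z, i)) r
omit [Fintype Z] [DecidableEq Z] in
lemma exists_factor {p q : Z × ℕ} (hp : p.2 ∈ Finset.Icc 1 n) (hq : q.2 ∈ Finset.Icc 1 n)
    (h : p ≠ q) : ∃ t, E.th p q = 1 + t ∧ E.th q p = 1 - t ∧
      (E.w p - E.w q) * t = algebraMap RH R (Polynomial.C (halfForm A Dd p.2 q.2) * hbar) := by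
  refine ⟨E.th p q - 1, by ring, ?_, E.th_sub p q hp hq h⟩
  linear_combination E.th_add p q hp hq h

variable (hA : CartanLike n A Dd)
include hA

omit hA in
lemma loop_rel {i j : ℕ} (hi : i ∈ Finset.Icc 1 n) (hj : j ∈ Finset.Icc 1 n) (r s : ℕ) :
    ⁅E.gen i (r + 1), E.gen j s⁆ - ⁅E.gen i r, E.gen j (s + 1)⁆ =
      algebraMap RH R (Polynomial.C (halfForm A Dd i j) * hbar) •
        (E.gen i r * E.gen j s + E.gen j s * E.gen i r) := by
  have e : E.gen i r * E.gen j s + E.gen j s * E.gen i r =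
      ∑ z : Z, ∑ z' : Z, (E.w (z, i) ^ r * E.w (z', j) ^ s) •
      (ptOp E.th (z, i) * ptOp E.th (z', j) + ptOp E.th (z', j) * ptOp E.th (z, i)) := by
    simp only [gen, wsum, Finset.sum_mul, Finset.mul_sum, smul_mul_smul_comm, smul_add,
      Finset.sum_add_distrib]
    congr 1
    rw [Finset.sum_comm]
    simp only [mul_comm]
  rw [gen, gen, lie_wsum, gen, gen, lie_wsum, ← gen, ← gen, e, Finset.smul_sum, ← Finset.sum_sub_distrib]
  refine Finset.sum_congr rfl fun z _ => ?_
  rw [Finset.smul_sum, ← Finset.sum_sub_distrib]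
  refine Finset.sum_congr rfl fun z' _ => ?_
  by_cases h : (z, i) = (z', j)
  · simp [Prod.ext_iff] at h
    obtain ⟨rfl, rfl⟩ := h
    simp [Ring.lie_def, ptOp_mul_self]
  · obtain ⟨t, h1, h2, h3⟩ := E.exists_factor (p := (z, i)) (q := (z', j)) hi hj h
    rw [LieRing.of_associative_ring_bracket, ptOp_mul_ptOp _ _ _ h,
      ptOp_mul_ptOp _ _ _ (Ne.symm h), Finset.pair_comm (z', j), h1, h2, ← h3]
    match_scalars
    ring

variable [IsDomain R]

omit [IsDomain R] in
lemma serre_one {i j : ℕ} (hi : i ∈ Finset.Icc 1 n) (hj : j ∈ Finset.Icc 1 n) (hij : i ≠ j)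
    (h0 : A i j = 0) (r s : ℕ) : ⁅E.gen i r, E.gen j s⁆ = 0 := by
  rw [gen, gen, lie_wsum]
  refine Finset.sum_eq_zero fun z _ => Finset.sum_eq_zero fun z' _ => ?_
  have h : (z, i) ≠ (z', j) := fun h => hij (congrArg Prod.snd h)
  have h1 : halfForm A Dd i j = 0 := by simp [halfForm, h0]
  have h2 : halfForm A Dd j i = 0 := by
    have := hA.symm j i hj hi
    simp [halfForm, this, h0]
  rw [LieRing.of_associative_ring_bracket, ptOp_mul_ptOp _ _ _ h,
      ptOp_mul_ptOp _ _ _ (Ne.symm h), Finset.pair_comm (z', j),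
      E.th_eq_one (z, i) (z', j) hi hj h h1, E.th_eq_one (z', j) (z, i) hj hi h.symm h2]
  simp

lemma serre_two {i j : ℕ} (hi : i ∈ Finset.Icc 1 n) (hj : j ∈ Finset.Icc 1 n) 
    (h0 : A i j = -1) (a b c : ℕ) :
    ⁅E.gen i a, ⁅E.gen i b, E.gen j c⁆⁆ + ⁅E.gen i b, ⁅E.gen i a, E.gen j c⁆⁆ = 0 := by
  refine wsum_serre_two _ _ (fun z z' y => serre_op_two _ _ _ _ ?_) a b c
  intro h12 h13 h23
  obtain ⟨t, h1, h2, h3⟩ := E.exists_factor hi hi h12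
  obtain ⟨u, h4, h5, h6⟩ := E.exists_factor hi hj h13
  obtain ⟨v, h7, h8, h9⟩ := E.exists_factor hi hj h23
  refine ⟨t, u, v, h1, h2, h4, h5, h7, h8, ?_⟩
  have hd : (Dd i : ℚ) ≠ 0 := by exact_mod_cast hA.pos i
  have hc1 : halfForm A Dd i i ≠ 0 := by rw [halfForm_ii hA]; exact hd
  have hc2 : halfForm A Dd i j ≠ 0 := by simp [halfForm, h0, hd]
  refine serre_scalar_two _ _ _ t u v _ _ h3 h6 h9 ?_ (E.w_ne _ _ hi hi h12 hc1)
    (E.w_ne _ _ hi hj h13 hc2) (E.w_ne _ _ hi hj h23 hc2)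
  have : halfForm A Dd i i = -2 * halfForm A Dd i j := by
    rw [halfForm_ii hA, halfForm, h0]; push_cast; ring
  rw [show (-2 : R) = algebraMap RH R (Polynomial.C (-2)) by rw [map_neg, map_neg, map_ofNat, map_ofNat], ← map_mul]
  simp only [this, map_mul, mul_assoc]

lemma serre_three {i j : ℕ} (hi : i ∈ Finset.Icc 1 n) (hj : j ∈ Finset.Icc 1 n) 
    (h0 : A i j = -2) (a b c d : ℕ) :
    ⁅E.gen i a, ⁅E.gen i b, ⁅E.gen i c, E.gen j d⁆⁆⁆ +
    ⁅E.gen i a, ⁅E.gen i c, ⁅E.gen i b, E.gen j d⁆⁆⁆ +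
    ⁅E.gen i b, ⁅E.gen i a, ⁅E.gen i c, E.gen j d⁆⁆⁆ +
    ⁅E.gen i b, ⁅E.gen i c, ⁅E.gen i a, E.gen j d⁆⁆⁆ +
    ⁅E.gen i c, ⁅E.gen i a, ⁅E.gen i b, E.gen j d⁆⁆⁆ +
    ⁅E.gen i c, ⁅E.gen i b, ⁅E.gen i a, E.gen j d⁆⁆⁆ = 0 := by
  refine wsum_serre_three _ _ (fun z₁ z₂ z₃ y => serre_op_three _ _ _ _ _ ?_) a b c d
  intro h12 h13 h23 h1 h2 h3
  obtain ⟨r, r1, r2, r3⟩ := E.exists_factor hi hi h12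
  obtain ⟨s, s1, s2, s3⟩ := E.exists_factor hi hi h13
  obtain ⟨t, t1, t2, t3⟩ := E.exists_factor hi hi h23
  obtain ⟨u, u1, u2, u3⟩ := E.exists_factor hi hj h1
  obtain ⟨v, v1, v2, v3⟩ := E.exists_factor hi hj h2
  obtain ⟨o, o1, o2, o3⟩ := E.exists_factor hi hj h3
  have hd : (Dd i : ℚ) ≠ 0 := by exact_mod_cast hA.pos i
  have hc1 : halfForm A Dd i i ≠ 0 := by rw [halfForm_ii hA]; exact hd
  have hc2 : halfForm A Dd i j ≠ 0 := by simp [halfForm, h0, hd]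
  have e : algebraMap RH R (Polynomial.C (halfForm A Dd i i) * hbar) =
      - algebraMap RH R (Polynomial.C (halfForm A Dd i j) * hbar) := by
    rw [show halfForm A Dd i i = - halfForm A Dd i j by
      rw [halfForm_ii hA, halfForm, h0]; push_cast; ring]
    simp
  exact ⟨r, s, t, u, v, o, r1, r2, s1, s2, t1, t2, u1, u2, v1, v2, o1, o2,
    serre_scalar_one _ _ _ _ _ _ _ _ r3 u3 v3 e (E.w_ne _ _ hi hi h12 hc1)
      (E.w_ne _ _ hi hj h1 hc2) (E.w_ne _ _ hi hj h2 hc2),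
    serre_scalar_one _ _ _ _ _ _ _ _ s3 u3 o3 e (E.w_ne _ _ hi hi h13 hc1)
      (E.w_ne _ _ hi hj h1 hc2) (E.w_ne _ _ hi hj h3 hc2),
    serre_scalar_one _ _ _ _ _ _ _ _ t3 v3 o3 e (E.w_ne _ _ hi hi h23 hc1)
      (E.w_ne _ _ hi hj h2 hc2) (E.w_ne _ _ hi hj h3 hc2),
    serre_scalar_three _ _ _ _ _ _ _ r3 s3 t3 (E.w_ne _ _ hi hi h12 hc1)
      (E.w_ne _ _ hi hi h13 hc1) (E.w_ne _ _ hi hi h23 hc1)⟩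

lemma serre_sum {i j : ℕ} (hi : i ∈ Finset.Icc 1 n) (hj : j ∈ Finset.Icc 1 n) (hij : i ≠ j)
    (m : ℕ) (hm : (1 - A i j).toNat = m) (ss : Fin m → ℕ) (r : ℕ) :
    serreSum (E.gen i) (E.gen j r) m ss = 0 := by
  rcases hA.offdiag i j hij with h | h | h
  · obtain rfl : m = 1 := by rw [← hm, h]; rfl
    rw [serreSum_one]
    exact E.serre_one hA hi hj hij h _ _
  · obtain rfl : m = 2 := by rw [← hm, h]; rfl
    rw [serreSum_two]
    exact E.serre_two hA hi hj h _ _ _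
  · obtain rfl : m = 3 := by rw [← hm, h]; rfl
    rw [serreSum_three]
    exact E.serre_three hA hi hj h _ _ _ _

/-- The shuffle representation attached to evaluation data. -/
def rep : YA n A Dd →ₐ[RH] Module.End R (Finset (Z × ℕ) → R) :=
  RingQuot.liftAlgHom RH ⟨FreeAlgebra.lift RH fun x => E.gen (x.1.1 + 1) x.2, by
    rintro _ _ (⟨i, j, r, s⟩ | ⟨i, j, hij, ss, r⟩)
    · have := E.loop_rel (i := i.1 + 1) (j := j.1 + 1) (by simp) (by simp) r s
      simp only [Ring.lie_def] at this
      simp only [fy, map_sub, map_mul, map_add, map_smul, FreeAlgebra.lift_ι_apply, this]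
      rw [← map_mul, algebraMap_smul]; rfl
    · rw [map_zero, ← E.serre_sum hA (i := i.1 + 1) (j := j.1 + 1) (by simp) (by simp)
        (by simpa [Fin.ext_iff] using hij) _ rfl ss r]
      change FreeAlgebra.lift RH _ (serreSum (fy n i) (fy n j r) _ ss) = _
      rw [map_serreSum]
      simp [fy]⟩

lemma rep_yg (i : Fin n) (r : ℕ) : E.rep hA (yg n A Dd i r) = E.gen (i.1 + 1) r := by
  simp [rep, yg, fy]

end EvalData

/-! ### Bracket trees -/

/-- Bracketings of generators; a flagged leaf carries the spectral index. -/
inductive BrTree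
  | leaf (i : ℕ) (flag : Bool)
  | node (a b : BrTree)

namespace BrTree

/-- The iterated commutator described by a tree. -/
def eval {B : Type} [Ring B] (g : ℕ → ℕ → B) (s : ℕ) : BrTree → B
  | leaf i f => g i (if f then s else 0)
  | node a b => eval g s a * eval g s b - eval g s b * eval g s a

/-- The number of flagged leaves. -/
def flags : BrTree → ℕ
  | leaf _ f => if f then 1 else 0
  | node a b => flags a + flags b

/-- The multiset of colors of the leaves. -/
def leaves : BrTree → Multiset ℕ
  | leaf i _ => {i}
  | node a b => leaves a + leaves b

/-- The left-nested tree obtained by bracketing `t` successively with unflagged leaves. -/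
def chain (t : BrTree) (w : List ℕ) : BrTree := w.foldl (fun a i => node a (leaf i false)) t

section
variable {B : Type} [Ring B]

lemma map_eval {B' F : Type} [Ring B'] [FunLike F B B'] [RingHomClass F B B'] (φ : F)
    (g : ℕ → ℕ → B) (s : ℕ) (t : BrTree) :
    φ (t.eval g s) = t.eval (fun i r => φ (g i r)) s := by
  induction t with
  | leaf i f => rfl
  | node a b iha ihb => simp only [eval, map_sub, map_mul, iha, ihb]

lemma eval_congr {g g' : ℕ → ℕ → B} (s : ℕ) (t : BrTree)
    (h : ∀ i ∈ t.leaves, ∀ r, g i r = g' i r) : t.eval g s = t.eval g' s := by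
  induction t with
  | leaf i f => exact h i (by simp [leaves]) _
  | node a b iha ihb =>
    simp only [eval, iha fun i hi => h i (Multiset.mem_add.2 (Or.inl hi)),
      ihb fun i hi => h i (Multiset.mem_add.2 (Or.inr hi))]

/-- A family of subsets which is stable under multiplication and subtraction contains every
iterated commutator of its elements. -/
lemma eval_rel {B' : Type} [Ring B'] (Rel : Multiset ℕ → B → B' → Prop)
    (hsub : ∀ μ a a' b b', Rel μ a a' → Rel μ b b' → Rel μ (a - b) (a' - b'))
    (hmul : ∀ μ ν a a' b b', Rel μ a a' → Rel ν b b' → Rel (μ + ν) (a * b) (a' * b'))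
    (g : ℕ → ℕ → B) (g' : ℕ → ℕ → B') (s : ℕ) (t : BrTree)
    (h : ∀ i ∈ t.leaves, ∀ r, Rel {i} (g i r) (g' i r)) :
    Rel t.leaves (t.eval g s) (t.eval g' s) := by
  induction t with
  | leaf i f => exact h i (by simp [leaves]) _
  | node a b iha ihb =>
    have ha := iha fun i hi => h i (Multiset.mem_add.2 (Or.inl hi))
    have hb := ihb fun i hi => h i (Multiset.mem_add.2 (Or.inr hi))
    refine hsub _ _ _ _ _ (hmul _ _ _ _ _ _ ha hb) ?_
    rw [leaves, add_comm]
    exact hmul _ _ _ _ _ _ hb ha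

lemma commute_eval {g g' : ℕ → ℕ → B} (h : ∀ i r j s, Commute (g i r) (g' j s)) (s s' : ℕ)
    (t t' : BrTree) : Commute (t.eval g s) (t'.eval g' s') := by
  have h1 : ∀ j r, Commute (t.eval g s) (g' j r) := by
    intro j r
    induction t with
    | leaf i f => exact h _ _ _ _
    | node a b iha ihb => exact (iha.mul_left ihb).sub_left (ihb.mul_left iha)
  induction t' with
  | leaf i f => exact h1 _ _
  | node a b iha ihb => exact (iha.mul_right ihb).sub_right (ihb.mul_right iha)

lemma eval_clusters {K : Type} [Fintype K] [Algebra ℚ B] (U : K → ℕ → B)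
    (hU : ∀ k l, k ≠ l → ∀ i j, Commute (U k i) (U l j)) (y : K → ℚ) (s : ℕ) (t : BrTree) :
    t.eval (fun i r => ∑ k, y k ^ r • U k i) s =
      ∑ k, (y k ^ s) ^ t.flags • t.eval (fun i _ => U k i) 0 := by
  classical
  induction t with
  | leaf i f => cases f <;> simp [eval, flags]
  | node a b iha ihb =>
    have key : ∀ k l : K, ((y k ^ s) ^ a.flags * (y l ^ s) ^ b.flags) •
        (a.eval (fun i _ => U k i) 0 * b.eval (fun i _ => U l i) 0 -
          b.eval (fun i _ => U l i) 0 * a.eval (fun i _ => U k i) 0) =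
        if k = l then (y k ^ s) ^ (a.flags + b.flags) •
          (node a b).eval (fun i _ => U k i) 0 else 0 := by
      intro k l
      split_ifs with h
      · subst h; rw [pow_add]; rfl
      · have := commute_eval (g := fun i _ => U k i) (g' := fun i _ => U l i)
          (fun i _ j _ => hU k l h i j) 0 0 a b
        rw [this.eq, sub_self, smul_zero]
    have e := lie_sum_smul (fun k => (y k ^ s) ^ a.flags) (fun k => (y k ^ s) ^ b.flags)
      (fun k => a.eval (fun i _ => U k i) 0) (fun k => b.eval (fun i _ => U k i) 0)
    rw [Ring.lie_def, Fintype.sum_prod_type] at e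
    simp only [Ring.lie_def] at e
    rw [eval, iha, ihb, e]
    simp only [key, Finset.sum_ite_eq, Finset.mem_univ, if_true, flags]

end

section
variable {B : Type} [Ring B] (g : ℕ → ℕ → B)

lemma eval_chain (s : ℕ) (w : List ℕ) (t : BrTree) :
    (t.chain w).eval g s = (w.zip (List.replicate w.length 0)).foldl
      (fun acc p => acc * g p.1 p.2 - g p.1 p.2 * acc) (t.eval g s) := by
  induction w generalizing t with
  | nil => rfl
  | cons i w ih =>
    rw [chain, List.foldl_cons, ← chain, ih]
    simp [List.replicate_succ, eval]

lemma chainY_cons (i s : ℕ) (w : List ℕ) :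
    chainY g (i :: w) (s :: List.replicate w.length 0) = ((leaf i true).chain w).eval g s := by
  rw [eval_chain]; rfl

lemma flags_chain (t : BrTree) (w : List ℕ) : (t.chain w).flags = t.flags := by
  induction w generalizing t with
  | nil => rfl
  | cons i w ih => rw [chain, List.foldl_cons, ← chain, ih]; simp [flags]

lemma leaves_chain (t : BrTree) (w : List ℕ) : (t.chain w).leaves = t.leaves + w := by
  induction w generalizing t with
  | nil => simp [chain]
  | cons i w ih => rw [chain, List.foldl_cons, ← chain, ih, leaves, leaves, add_assoc]; rfl

lemma chain_append (t : BrTree) (w w' : List ℕ) : t.chain (w ++ w') = (t.chain w).chain w' :=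
  List.foldl_append

end
end BrTree

/-! ### Clustered evaluation points -/

section Clusters
variable (A : ℕ → ℕ → ℤ) (Dd : ℕ → ℕ)

/-- Interaction factors of points with rational spectral values `v`. -/
def ratTh (v : Bool × ℕ → ℚ) (p q : Bool × ℕ) : ℚ :=
  1 + halfForm A Dd p.2 q.2 / (v p - v q)

/-- Interaction factors of clustered points in the limit `ħ → 0`: points in different clusters do
not interact. -/
def clusterTh {m : ℕ} (v : Fin m → Bool × ℕ → ℚ) (p q : (Fin m × Bool) × ℕ) : ℚ :=
  if p.1.1 = q.1.1 then ratTh A Dd (v p.1.1) (p.1.2, p.2) (q.1.2, q.2) else 1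

/-- Spectral values are in general position. -/
def GenericVal (n : ℕ) (v : Bool × ℕ → ℚ) : Prop :=
  ∀ p q, p.2 ∈ Finset.Icc 1 n → q.2 ∈ Finset.Icc 1 n → p ≠ q →
    halfForm A Dd p.2 q.2 ≠ 0 → v p ≠ v q

open PowerSeries in
/-- Clustered spectral values. -/
def clusterW {m : ℕ} (y : Fin m → ℚ) (v : Fin m → Bool × ℕ → ℚ) (p : (Fin m × Bool) × ℕ) :
    PowerSeries ℚ := C (y p.1.1) + X * C (v p.1.1 (p.1.2, p.2))

open PowerSeries in
/-- Interaction factors of clustered points. -/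
def clusterThX {m : ℕ} (y : Fin m → ℚ) (v : Fin m → Bool × ℕ → ℚ) (p q : (Fin m × Bool) × ℕ) :
    PowerSeries ℚ :=
  if p.1.1 = q.1.1 then C (ratTh A Dd (v p.1.1) (p.1.2, p.2) (q.1.2, q.2))
  else 1 + C (halfForm A Dd p.2 q.2) * X * (clusterW y v p - clusterW y v q)⁻¹

lemma constantCoeff_clusterThX {m : ℕ} (y : Fin m → ℚ) (v : Fin m → Bool × ℕ → ℚ)
    (p q : (Fin m × Bool) × ℕ) :
    PowerSeries.constantCoeff (clusterThX A Dd y v p q) = clusterTh A Dd v p q := by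
  rw [clusterThX, clusterTh]
  split_ifs <;> simp

variable {A Dd} {n : ℕ} (hA : CartanLike n A Dd)
include hA

lemma halfForm_symm {i j : ℕ} (hi : i ∈ Finset.Icc 1 n) (hj : j ∈ Finset.Icc 1 n) :
    halfForm A Dd i j = halfForm A Dd j i := by
  rw [halfForm, halfForm, hA.symm i j hi hj]

open PowerSeries in
/-- Evaluation data over `ℚ⟦ħ⟧` with clusters of points at pairwise distinct `y k`. -/
def clusterData {m : ℕ} (y : Fin m → ℚ) (hy : Function.Injective y) (v : Fin m → Bool × ℕ → ℚ)
    (hv : ∀ k, GenericVal A Dd n (v k)) : EvalData n A Dd (PowerSeries ℚ) (Fin m × Bool) :=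
  have hne : ∀ p q : (Fin m × Bool) × ℕ, p.1.1 ≠ q.1.1 →
      constantCoeff (clusterW y v p - clusterW y v q) ≠ 0 := fun p q h => by
    simpa [clusterW, sub_eq_zero] using fun e => h (hy e)
  have hne' : ∀ p q : (Fin m × Bool) × ℕ, p ≠ q → p.1.1 = q.1.1 → (p.1.2, p.2) ≠ (q.1.2, q.2) :=
    fun p q h e e' => h (by
      rw [Prod.mk.injEq] at e'
      exact Prod.ext (Prod.ext e e'.1) e'.2)
  { w := clusterW y v
    th := clusterThX A Dd y v
    th_add := fun p q hp hq h => by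
      rw [clusterThX, clusterThX]
      by_cases e : p.1.1 = q.1.1
      · rw [if_pos e, if_pos e.symm, ← map_add, ratTh, ratTh, halfForm_symm hA hp hq, e]
        have : ∀ c x y : ℚ, 1 + c / (x - y) + (1 + c / (y - x)) = 2 := fun c x y => by
          rw [← neg_sub x y, div_neg]; ring
        rw [this, map_ofNat]
      · have e2 := hne p q e
        have e3 := hne q p (Ne.symm e)
        rw [if_neg e, if_neg (Ne.symm e), halfForm_symm hA hp hq]
        have h1 := PowerSeries.mul_inv_cancel _ e2
        have h2 := PowerSeries.mul_inv_cancel _ e3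
        have h3 : (clusterW y v p - clusterW y v q)⁻¹ + (clusterW y v q - clusterW y v p)⁻¹ = 0 := by
          have h0 : clusterW y v p - clusterW y v q ≠ 0 := fun h => e2 (by rw [h, map_zero])
          refine (mul_eq_zero.1 ?_).resolve_left h0
          linear_combination h1 - h2
        linear_combination C (halfForm A Dd q.2 p.2) * X * h3
    th_sub := fun p q hp hq h => by
      have hR : algebraMap RH (PowerSeries ℚ) (Polynomial.C (halfForm A Dd p.2 q.2) * hbar) =
          C (halfForm A Dd p.2 q.2) * X := by
        simp [hbar, PowerSeries.algebraMap_apply']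
      rw [hR, clusterThX]
      by_cases e : p.1.1 = q.1.1
      · rw [if_pos e, clusterW, clusterW, e, ratTh, map_add, map_one]
        by_cases h0 : halfForm A Dd p.2 q.2 = 0
        · simp [h0]
        · have := hv q.1.1 _ _ hp hq (hne' p q h e) h0
          have e4 := div_mul_cancel₀ (halfForm A Dd p.2 q.2) (sub_ne_zero.2 this)
          have e5 := congrArg (C (R := ℚ)) e4
          rw [map_mul, map_sub] at e5
          linear_combination X * e5
      · rw [if_neg e]
        linear_combination (C (halfForm A Dd p.2 q.2) * X) * PowerSeries.mul_inv_cancel _ (hne p q e)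
    w_ne := fun p q hp hq h h0 e => by
      by_cases e1 : p.1.1 = q.1.1
      · refine hv q.1.1 _ _ hp hq (hne' p q h e1) h0 ?_
        simp only [clusterW, e1, add_right_inj] at e
        exact C_injective (mul_left_cancel₀ X_ne_zero e)
      · exact hne p q e1 (by rw [e, sub_self, map_zero])
    th_eq_one := fun p q hp hq h h0 => by
      rw [clusterThX]
      split_ifs <;> simp [ratTh, h0] }

end Clusters

/-! ### The classical limit of the clustered representations -/

section ClassicalLimit
variable {P : Type}

/-- `M₀` is the reduction of `M` modulo `ħ`. -/
def ReducesTo (M : Module.End (PowerSeries ℚ) (Finset P → PowerSeries ℚ))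
    (M₀ : Module.End ℚ (Finset P → ℚ)) : Prop :=
  ∀ f, (fun T => PowerSeries.constantCoeff (M f T)) =
    M₀ fun T => PowerSeries.constantCoeff (f T)

lemma ReducesTo.sub {M N : Module.End (PowerSeries ℚ) (Finset P → PowerSeries ℚ)}
    {M₀ N₀ : Module.End ℚ (Finset P → ℚ)} (h : ReducesTo M M₀) (h' : ReducesTo N N₀) :
    ReducesTo (M - N) (M₀ - N₀) := fun f => by
  rw [LinearMap.sub_apply, LinearMap.sub_apply, ← h, ← h']
  ext T
  simp

lemma ReducesTo.mul {M N : Module.End (PowerSeries ℚ) (Finset P → PowerSeries ℚ)}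
    {M₀ N₀ : Module.End ℚ (Finset P → ℚ)} (h : ReducesTo M M₀) (h' : ReducesTo N N₀) :
    ReducesTo (M * N) (M₀ * N₀) := fun f => by
  rw [Module.End.mul_apply, Module.End.mul_apply, ← h', ← h]

lemma ReducesTo.list_prod {ι : Type}
    {M : ι → Module.End (PowerSeries ℚ) (Finset P → PowerSeries ℚ)}
    {M₀ : ι → Module.End ℚ (Finset P → ℚ)} (h : ∀ i, ReducesTo (M i) (M₀ i)) (l : List ι) :
    ReducesTo (l.map M).prod (l.map M₀).prod := by
  induction l with
  | nil => intro f; rfl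
  | cons i l ih => exact (h i).mul ih

lemma ReducesTo.wsum [DecidableEq P] {Z : Type} [Fintype Z] (w : Z → PowerSeries ℚ)
    (pt : Z → P) (θ : P → P → PowerSeries ℚ) (r : ℕ) :
    ReducesTo (wsum w (fun z => ptOp θ (pt z)) r)
      (wsum (fun z => PowerSeries.constantCoeff (w z))
        (fun z => ptOp (fun p q => PowerSeries.constantCoeff (θ p q)) (pt z)) r) := fun f => by
  ext T
  simp only [_root_.wsum, LinearMap.sum_apply, Finset.sum_apply, map_sum, LinearMap.smul_apply,
    Pi.smul_apply, smul_eq_mul, map_mul, map_pow, ptOp_apply]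
  refine Finset.sum_congr rfl fun z _ => ?_
  split_ifs <;> simp

end ClassicalLimit

section Local
variable (A : ℕ → ℕ → ℤ) (Dd : ℕ → ℕ)

/-- The operator of color `i` for a single cluster. -/
def oneOp (v : Bool × ℕ → ℚ) (i : ℕ) : Module.End ℚ (Finset (Bool × ℕ) → ℚ) :=
  ∑ b, ptOp (ratTh A Dd v) (b, i)

/-- The operator of color `i` in the `k`-th cluster. -/
def clusterOp {m : ℕ} (v : Fin m → Bool × ℕ → ℚ) (k : Fin m) (i : ℕ) :
    Module.End ℚ (Finset ((Fin m × Bool) × ℕ) → ℚ) :=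
  ∑ b, ptOp (clusterTh A Dd v) ((k, b), i)

lemma commute_clusterOp {m : ℕ} (v : Fin m → Bool × ℕ → ℚ) {k l : Fin m} (h : k ≠ l) (i j : ℕ) :
    Commute (clusterOp A Dd v k i) (clusterOp A Dd v l j) := by
  refine Commute.sum_left _ _ _ fun b _ => Commute.sum_right _ _ _ fun b' _ => ?_
  have h1 : (((k, b), i) : (Fin m × Bool) × ℕ) ≠ ((l, b'), j) := fun e => h (by
    simpa using congrArg (·.1.1) e)
  rw [commute_iff_eq, ptOp_mul_ptOp _ _ _ h1, ptOp_mul_ptOp _ _ _ h1.symm, Finset.pair_comm]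
  simp [clusterTh, h, h.symm]

/-- The part of a set of points lying in the `k`-th cluster. -/
def slice {m : ℕ} (k : Fin m) (T : Finset ((Fin m × Bool) × ℕ)) : Finset (Bool × ℕ) :=
  T.preimage (fun p => ((k, p.1), p.2)) (fun p _ q _ h => by
    simp only [Prod.mk.injEq, true_and] at h
    exact Prod.ext h.1 h.2)

lemma mem_slice {m : ℕ} {k : Fin m} {T : Finset ((Fin m × Bool) × ℕ)} {p : Bool × ℕ} :
    p ∈ slice k T ↔ ((k, p.1), p.2) ∈ T := 
  Finset.mem_preimage

/-- The tensor product of functions supported on the individual clusters. -/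
def tensorFun {m : ℕ} (f : Fin m → Finset (Bool × ℕ) → ℚ) (T : Finset ((Fin m × Bool) × ℕ)) : ℚ :=
  ∏ k, f k (slice k T)

/-- `M` acts on tensor products through the operator `M₁` on the `k`-th factor. -/
def ActsOn {m : ℕ} (k : Fin m) (M : Module.End ℚ (Finset ((Fin m × Bool) × ℕ) → ℚ))
    (M₁ : Module.End ℚ (Finset (Bool × ℕ) → ℚ)) : Prop :=
  ∀ f, M (tensorFun f) = tensorFun (Function.update f k (M₁ (f k)))

variable {A Dd}

lemma tensorFun_update {m : ℕ} (f : Fin m → Finset (Bool × ℕ) → ℚ) (k : Fin m)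
    (g : Finset (Bool × ℕ) → ℚ) (T : Finset ((Fin m × Bool) × ℕ)) :
    tensorFun (Function.update f k g) T =
      g (slice k T) * ∏ l ∈ Finset.univ.erase k, f l (slice l T) := by
  rw [tensorFun, ← Finset.mul_prod_erase _ _ (Finset.mem_univ k), Function.update_self]
  congr 1
  refine Finset.prod_congr rfl fun l hl => ?_
  rw [Function.update_of_ne (Finset.ne_of_mem_erase hl)]

lemma ActsOn.sub {m : ℕ} {k : Fin m} {M N : Module.End ℚ (Finset ((Fin m × Bool) × ℕ) → ℚ)}
    {M₁ N₁ : Module.End ℚ (Finset (Bool × ℕ) → ℚ)} (h : ActsOn k M M₁) (h' : ActsOn k N N₁) :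
    ActsOn k (M - N) (M₁ - N₁) := fun f => by
  ext T
  rw [LinearMap.sub_apply, h, h', Pi.sub_apply]
  simp only [tensorFun_update, LinearMap.sub_apply, Pi.sub_apply, sub_mul]

lemma ActsOn.add {m : ℕ} {k : Fin m} {M N : Module.End ℚ (Finset ((Fin m × Bool) × ℕ) → ℚ)}
    {M₁ N₁ : Module.End ℚ (Finset (Bool × ℕ) → ℚ)} (h : ActsOn k M M₁) (h' : ActsOn k N N₁) :
    ActsOn k (M + N) (M₁ + N₁) := fun f => by
  ext T
  rw [LinearMap.add_apply, h, h', Pi.add_apply]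
  simp only [tensorFun_update, LinearMap.add_apply, Pi.add_apply, add_mul]

lemma ActsOn.mul {m : ℕ} {k : Fin m} {M N : Module.End ℚ (Finset ((Fin m × Bool) × ℕ) → ℚ)}
    {M₁ N₁ : Module.End ℚ (Finset (Bool × ℕ) → ℚ)} (h : ActsOn k M M₁) (h' : ActsOn k N N₁) :
    ActsOn k (M * N) (M₁ * N₁) := fun f => by
  rw [Module.End.mul_apply, h', h]
  simp

lemma actsOn_ptOp {m : ℕ} (v : Fin m → Bool × ℕ → ℚ) (k : Fin m) (b : Bool) (i : ℕ) :
    ActsOn k (ptOp (clusterTh A Dd v) ((k, b), i)) (ptOp (ratTh A Dd (v k)) (b, i)) := fun f => by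
  ext T
  rw [tensorFun_update, ptOp_apply, ptOp_apply]
  simp only [mem_slice]
  by_cases hT : ((k, b), i) ∈ T
  · rw [if_pos hT, if_pos hT, tensorFun, ← Finset.mul_prod_erase _ _ (Finset.mem_univ k)]
    have h1 : slice k (T.erase ((k, b), i)) = (slice k T).erase (b, i) := by
      ext p
      simp only [mem_slice, Finset.mem_erase, ne_eq, Prod.ext_iff, true_and]
    have h2 : ∀ l ∈ Finset.univ.erase k, f l (slice l (T.erase ((k, b), i))) = f l (slice l T) := by
      intro l hl
      have : slice l (T.erase ((k, b), i)) = slice l T := by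
        ext p
        simp [mem_slice, Finset.ne_of_mem_erase hl]
      rw [this]
    rw [h1, Finset.prod_congr rfl h2, ← mul_assoc]
    congr 2
    symm
    refine Finset.prod_of_injOn (fun p => ((k, p.1), p.2)) ?_ ?_ ?_ ?_
    · intro p _ q _ h
      simp only [Prod.mk.injEq, true_and] at h
      exact Prod.ext h.1 h.2
    · intro p hp
      simpa [mem_slice, Prod.ext_iff] using hp
    · intro q hq hq'
      rw [clusterTh, if_neg]
      rintro h
      simp only at h
      refine hq' ⟨(q.1.2, q.2), ?_, ?_⟩
      · rw [← h1, Finset.mem_coe, mem_slice]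
        simpa [h] using hq
      · simp [h]
    · intro p _
      simp [clusterTh]
  · rw [if_neg hT, if_neg hT, zero_mul]

lemma actsOn_clusterOp {m : ℕ} (v : Fin m → Bool × ℕ → ℚ) (k : Fin m) (i : ℕ) :
    ActsOn k (clusterOp A Dd v k i) (oneOp A Dd (v k) i) := by
  rw [clusterOp, oneOp, Fintype.sum_bool, Fintype.sum_bool]
  exact (actsOn_ptOp _ _ _ _).add (actsOn_ptOp _ _ _ _)

lemma ActsOn.list_prod {m : ℕ} {ι : Type} (κ : ι → Fin m)
    (W : ι → Module.End ℚ (Finset ((Fin m × Bool) × ℕ) → ℚ))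
    (W₁ : ι → Module.End ℚ (Finset (Bool × ℕ) → ℚ)) (h : ∀ a, ActsOn (κ a) (W a) (W₁ a))
    (l : List ι) (f : Fin m → Finset (Bool × ℕ) → ℚ) :
    (l.map W).prod (tensorFun f) =
      tensorFun fun k => ((l.filter fun a => κ a = k).map W₁).prod (f k) := by
  induction l with
  | nil => rfl
  | cons a l ih =>
    rw [List.map_cons, List.prod_cons, Module.End.mul_apply, ih, h]
    congr 1
    ext1 k
    by_cases hk : κ a = k
    · subst hk
      simp
    · rw [Function.update_of_ne (Ne.symm hk)]
      simp [hk]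

end Local

section Support
variable (A : ℕ → ℕ → ℤ) (Dd : ℕ → ℕ)

/-- The multiset of colors of a set of points. -/
def colors (T : Finset (Bool × ℕ)) : Multiset ℕ := T.val.map Prod.snd

/-- `M` raises the multiset of colors by `μ`. -/
def RaisesBy (μ : Multiset ℕ) (M : Module.End ℚ (Finset (Bool × ℕ) → ℚ)) : Prop :=
  ∀ f T, M f T ≠ 0 → ∃ S, f S ≠ 0 ∧ colors T = μ + colors S

lemma RaisesBy.mul {μ ν : Multiset ℕ} {M N : Module.End ℚ (Finset (Bool × ℕ) → ℚ)}
    (h : RaisesBy μ M) (h' : RaisesBy ν N) : RaisesBy (μ + ν) (M * N) := fun f T hT => by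
  obtain ⟨S, hS, e⟩ := h (N f) T hT
  obtain ⟨S', hS', e'⟩ := h' f S hS
  exact ⟨S', hS', by rw [e, e', add_assoc]⟩

lemma RaisesBy.add {μ : Multiset ℕ} {M N : Module.End ℚ (Finset (Bool × ℕ) → ℚ)}
    (h : RaisesBy μ M) (h' : RaisesBy μ N) : RaisesBy μ (M + N) := fun f T hT => by
  by_cases h0 : M f T = 0
  · exact h' f T fun e => hT (by rw [LinearMap.add_apply, Pi.add_apply, h0, e, add_zero])
  · exact h f T h0

lemma RaisesBy.sub {μ : Multiset ℕ} {M N : Module.End ℚ (Finset (Bool × ℕ) → ℚ)}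
    (h : RaisesBy μ M) (h' : RaisesBy μ N) : RaisesBy μ (M - N) := fun f T hT => by
  by_cases h0 : M f T = 0
  · exact h' f T fun e => hT (by rw [LinearMap.sub_apply, Pi.sub_apply, h0, e, sub_zero])
  · exact h f T h0

lemma raisesBy_oneOp (v : Bool × ℕ → ℚ) (i : ℕ) : RaisesBy {i} (oneOp A Dd v i) := by
  have h : ∀ b, RaisesBy {i} (ptOp (ratTh A Dd v) (b, i)) := fun b f T hT => by
    rw [ptOp_apply] at hT
    split_ifs at hT with hb
    · refine ⟨T.erase (b, i), right_ne_zero_of_mul hT, ?_⟩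
      rw [colors, colors, Finset.erase_val, Multiset.singleton_add]
      conv_lhs => rw [← Multiset.cons_erase ((Finset.mem_def (s := T)).1 hb)]
      simp
    · exact absurd rfl hT
  rw [oneOp, Fintype.sum_bool]
  exact (h _).add (h _)

/-- The root vector attached to a tree in the representation on a single cluster. -/
def oneEval (v : Bool × ℕ → ℚ) (t : BrTree) : Module.End ℚ (Finset (Bool × ℕ) → ℚ) :=
  t.eval (fun i _ => oneOp A Dd v i) 0

lemma raisesBy_oneEval (v : Bool × ℕ → ℚ) (t : BrTree) :
    RaisesBy t.leaves (oneEval A Dd v t) :=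
  BrTree.eval_rel (B' := ℤ) (fun μ M _ => RaisesBy μ M) (fun _ _ _ _ _ h h' => h.sub h')
    (fun _ _ _ _ _ _ h h' => h.mul h') _ (fun _ _ => 0) 0 t
    (fun i _ _ => raisesBy_oneOp A Dd v i)

/-- The indicator of the empty set of points. -/
def vac {P : Type} (R : Type) [CommRing R] (T : Finset P) : R :=
  haveI := Classical.dec (T = ∅); if T = ∅ then 1 else 0

lemma vac_empty {P R : Type} [CommRing R] : vac (P := P) R ∅ = 1 := by simp [vac]

lemma vac_ne {P R : Type} [CommRing R] {T : Finset P} (h : T ≠ ∅) : vac R T = 0 := by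
  simp [vac, h]

lemma colors_of_oneEval_ne_zero {v : Bool × ℕ → ℚ} {t : BrTree} {T : Finset (Bool × ℕ)}
    (h : oneEval A Dd v t (vac ℚ) T ≠ 0) : colors T = t.leaves := by
  obtain ⟨S, hS, e⟩ := raisesBy_oneEval A Dd v t _ T h
  have : S = ∅ := by
    by_contra h0
    exact hS (vac_ne h0)
  simpa [this, colors] using e

lemma BrTree.leaves_ne_zero (t : BrTree) : t.leaves ≠ 0 := by
  induction t with
  | leaf i f => simp [BrTree.leaves]
  | node a b iha ihb => simp [BrTree.leaves, iha]

lemma vac_eq_tensorFun {m : ℕ} :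
    vac (P := (Fin m × Bool) × ℕ) ℚ = tensorFun fun _ => vac ℚ := by
  ext T
  rw [tensorFun]
  by_cases hT : T = ∅
  · subst hT
    rw [vac_empty, Finset.prod_eq_one]
    intro k _
    have : slice k (∅ : Finset ((Fin m × Bool) × ℕ)) = ∅ := by simp [slice]
    rw [this, vac_empty]
  · obtain ⟨p, hp⟩ := Finset.nonempty_iff_ne_empty.2 hT
    rw [vac_ne hT, Finset.prod_eq_zero (Finset.mem_univ p.1.1)]
    refine vac_ne (Finset.nonempty_iff_ne_empty.1 ⟨(p.1.2, p.2), ?_⟩)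
    rw [mem_slice]
    exact hp

/-- The disjoint union of sets of points, one for each cluster. -/
def unionSlices {m : ℕ} (T : Fin m → Finset (Bool × ℕ)) : Finset ((Fin m × Bool) × ℕ) :=
  Finset.univ.biUnion fun k => (T k).image fun p => ((k, p.1), p.2)

lemma slice_unionSlices {m : ℕ} (T : Fin m → Finset (Bool × ℕ)) (k : Fin m) :
    slice k (unionSlices T) = T k := by
  ext p
  simp [mem_slice, unionSlices]

end Support

/-! ### Ordered monomials as products over sorted lists -/

section Expand
variable {ι : Type} [LinearOrder ι]

/-- The sorted list in which `p` occurs `h p` times. -/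
def expand (h : ι →₀ ℕ) : List ι :=
  (h.support.sort (· ≤ ·)).flatMap fun p => List.replicate (h p) p

lemma ordMon_eq_prod {B : Type} [Ring B] (E : ι → B) (h : ι →₀ ℕ) :
    ordMon E h = ((expand h).map E).prod := by
  rw [ordMon, expand]
  induction h.support.sort (· ≤ ·) with
  | nil => rfl
  | cons a l ih => simp [ih]

lemma coe_expand (h : ι →₀ ℕ) : (expand h : Multiset ι) = Finsupp.toMultiset h := by
  rw [expand, ← Multiset.coe_bind, Finset.sort_eq, Finsupp.toMultiset_apply, Finsupp.sum,
    Multiset.bind, Multiset.join]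
  exact Finset.sum_congr rfl fun p _ => by rw [Multiset.coe_replicate, Multiset.nsmul_singleton]

lemma sorted_expand (h : ι →₀ ℕ) : (expand h).Pairwise (· ≤ ·) := by
  rw [expand, List.pairwise_flatMap]
  refine ⟨fun p _ => List.pairwise_replicate.2 (Or.inr le_rfl), ?_⟩
  refine (Finset.pairwise_sort h.support (· ≤ ·)).imp fun {a b} hab x hx y hy => ?_
  rwa [List.eq_of_mem_replicate hx, List.eq_of_mem_replicate hy]

lemma expand_toFinsupp {l : List ι} (hl : l.Pairwise (· ≤ ·)) :
    expand (Multiset.toFinsupp (l : Multiset ι)) = l := by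
  have h : (expand (Multiset.toFinsupp (l : Multiset ι)) : Multiset ι) = l := by
    rw [coe_expand, Multiset.toFinsupp_toMultiset]
  exact (Multiset.coe_eq_coe.1 h).eq_of_pairwise' (sorted_expand _) hl

lemma eq_of_expand_perm {h h' : ι →₀ ℕ} (e : (expand h).Perm (expand h')) : h = h' := by
  have := Multiset.coe_eq_coe.2 e
  rw [coe_expand, coe_expand] at this
  exact Multiset.toFinsupp.symm.injective this

end Expand

/-! ### Linear independence of the ordered monomials -/

section Values
variable (A : ℕ → ℕ → ℤ) (Dd : ℕ → ℕ)

lemma prod_ofFn_sum {B K : Type} [Ring B] [Algebra ℚ B] [Fintype K] [DecidableEq K] {N : ℕ}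
    (c : K → Fin N → ℚ) (W : K → Fin N → B) :
    (List.ofFn fun a => ∑ k, c k a • W k a).prod =
      ∑ κ : Fin N → K, (∏ a, c (κ a) a) • (List.ofFn fun a => W (κ a) a).prod := by
  rw [← MultilinearMap.mkPiAlgebraFin_apply (R := ℚ) (A := B), MultilinearMap.map_sum]
  refine Finset.sum_congr rfl fun κ _ => ?_
  rw [MultilinearMap.map_smul_univ, MultilinearMap.mkPiAlgebraFin_apply]

variable {m : ℕ} (v : Fin m → Bool × ℕ → ℚ) (T : Fin m → Finset (Bool × ℕ))

/-- The contribution of an assignment `κ` of factors to clusters. -/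
def assignCoeff {N : ℕ} (t : Fin N → BrTree) (κ : Fin N → Fin m) : ℚ :=
  ∏ k, (((List.finRange N).filter fun a => κ a = k).map fun a =>
    oneEval A Dd (v k) (t a)).prod (vac ℚ) (T k)

/-- The value of a monomial as a polynomial in the positions of the clusters. -/
def valPoly {N : ℕ} (t : Fin N → BrTree) (s : Fin N → ℕ) : MvPolynomial (Fin m) ℚ :=
  ∑ κ : Fin N → Fin m,
    MvPolynomial.monomial (∑ a, Finsupp.single (κ a) (s a)) (assignCoeff A Dd v T t κ)

variable {A Dd}

lemma actsOn_eval {v : Fin m → Bool × ℕ → ℚ} (k : Fin m) (t : BrTree) :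
    ActsOn k (t.eval (fun i _ => clusterOp A Dd v k i) 0) (oneEval A Dd (v k) t) :=
  BrTree.eval_rel (fun _ M M₁ => ActsOn k M M₁) (fun _ _ _ _ _ h h' => h.sub h')
    (fun _ _ _ _ _ _ h h' => h.mul h') _ _ 0 t fun i _ _ => actsOn_clusterOp v k i

lemma constantCoeff_prod_eval {n N : ℕ} (hA : CartanLike n A Dd) (y : Fin m → ℚ)
    (hy : Function.Injective y) (hv : ∀ k, GenericVal A Dd n (v k)) (t : Fin N → BrTree)
    (ht : ∀ a, (t a).flags = 1) (s : Fin N → ℕ) :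
    PowerSeries.constantCoeff ((List.ofFn fun a =>
      (t a).eval (clusterData hA y hy v hv).gen (s a)).prod (vac _) (unionSlices T)) =
      MvPolynomial.eval y (valPoly A Dd v T t s) := by
  have h1 : ∀ a, ReducesTo ((t a).eval (clusterData hA y hy v hv).gen (s a))
      ((t a).eval (fun i r => ∑ k, y k ^ r • clusterOp A Dd v k i) (s a)) := fun a =>
    BrTree.eval_rel (fun _ M M₀ => ReducesTo M M₀) (fun _ _ _ _ _ h h' => h.sub h')
      (fun _ _ _ _ _ _ h h' => h.mul h') _ _ _ _ fun i _ r => by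
        have := ReducesTo.wsum (fun z => clusterW y v (z, i)) (fun z : Fin m × Bool => (z, i))
          (clusterThX A Dd y v) r
        simp only [constantCoeff_clusterThX] at this
        have e : wsum (fun z : Fin m × Bool => PowerSeries.constantCoeff (clusterW y v (z, i)))
            (fun z => ptOp (clusterTh A Dd v) (z, i)) r =
            ∑ k, y k ^ r • clusterOp A Dd v k i := by
          simp only [wsum, Fintype.sum_prod_type, clusterOp, Finset.smul_sum]
          simp [clusterW]
        rw [← e]
        exact this
  have h2 := ReducesTo.list_prod h1 (List.finRange N) (vac _)
  rw [← List.ofFn_eq_map, ← List.ofFn_eq_map] at h2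
  have h3 : (fun S : Finset ((Fin m × Bool) × ℕ) =>
      PowerSeries.constantCoeff (vac (PowerSeries ℚ) S)) = vac ℚ := by
    ext S
    by_cases hS : S = ∅
    · simp [hS, vac_empty]
    · simp [vac_ne hS]
  rw [h3] at h2
  have h4 := congrFun h2 (unionSlices T)
  rw [h4]
  simp only [BrTree.eval_clusters (fun k i => clusterOp A Dd v k i)
    (fun k l h i j => commute_clusterOp A Dd v h i j), ht, pow_one]
  rw [prod_ofFn_sum, LinearMap.sum_apply, Finset.sum_apply, valPoly, map_sum]
  refine Finset.sum_congr rfl fun κ _ => ?_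
  rw [LinearMap.smul_apply, Pi.smul_apply, smul_eq_mul, vac_eq_tensorFun, List.ofFn_eq_map,
    ActsOn.list_prod κ _ (fun a => oneEval A Dd (v (κ a)) (t a)) fun a => actsOn_eval (κ a) (t a),
    tensorFun, MvPolynomial.eval_monomial, mul_comm, assignCoeff]
  congr 1
  · refine Finset.prod_congr rfl fun k _ => ?_
    rw [slice_unionSlices]
    have : ∀ l l' : List (Module.End ℚ (Finset (Bool × ℕ) → ℚ)), l = l' →
        l.prod (vac ℚ) (T k) = l'.prod (vac ℚ) (T k) := fun _ _ h => h ▸ rfl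
    refine this _ _ ?_
    refine List.map_congr_left fun a ha => ?_
    rw [show κ a = k by simpa using (List.mem_filter.1 ha).2]
  · rw [Finsupp.prod_fintype _ _ fun _ => pow_zero _]
    simp only [Finsupp.finsetSum_apply, ← Finset.prod_pow_eq_pow_sum]
    rw [Finset.prod_comm]
    refine Finset.prod_congr rfl fun a _ => ?_
    rw [Finset.prod_eq_single (κ a) (fun k _ hk => by
      rw [Finsupp.single_eq_of_ne hk, pow_zero]) (by simp)]
    simp

variable {v T}

lemma assignCoeff_ne_zero {N : ℕ} {γ : Fin m → BrTree}
    (hγ : ∀ k, oneEval A Dd (v k) (γ k) (vac ℚ) (T k) ≠ 0) (hN : N ≤ m) {t : Fin N → BrTree}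
    {κ : Fin N → Fin m} (h : assignCoeff A Dd v T t κ ≠ 0) :
    Function.Bijective κ ∧ (∀ a, (t a).leaves = (γ (κ a)).leaves) ∧
      ((∀ a, t a = γ (κ a)) → assignCoeff A Dd v T t κ =
        ∏ k, oneEval A Dd (v k) (γ k) (vac ℚ) (T k)) := by
  have hk := Finset.prod_ne_zero_iff.1 h
  have hsurj : Function.Surjective κ := fun k => by
    by_contra hno
    push Not at hno
    refine hk k (Finset.mem_univ k) ?_
    rw [List.filter_eq_nil_iff.2 (by simpa using hno)]
    refine vac_ne fun h0 => BrTree.leaves_ne_zero (γ k) ?_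
    rw [← colors_of_oneEval_ne_zero A Dd (hγ k), h0]
    rfl
  have hcard : N = m := le_antisymm hN (by simpa using Fintype.card_le_of_surjective κ hsurj)
  subst hcard
  have hbij : Function.Bijective κ := ⟨Finite.injective_iff_surjective.2 hsurj, hsurj⟩
  have hf : ∀ a, (List.finRange N).filter (fun b => κ b = κ a) = [a] := fun a => by
    rw [List.filter_congr (q := fun b => b == a) (fun b _ => by
      rw [Bool.eq_iff_iff]; simp [hbij.1.eq_iff])]
    rw [List.filter_beq, List.count_eq_one_of_mem (List.nodup_finRange _) (List.mem_finRange a)]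
    rfl
  refine ⟨hbij, fun a => ?_, fun e => ?_⟩
  · have := hk (κ a) (Finset.mem_univ _)
    rw [hf] at this
    simp only [List.map_cons, List.map_nil, List.prod_singleton] at this
    rw [← colors_of_oneEval_ne_zero A Dd this, colors_of_oneEval_ne_zero A Dd (hγ (κ a))]
  · refine Finset.prod_congr rfl fun k _ => ?_
    obtain ⟨a, rfl⟩ := hsurj k
    rw [hf, ← e]
    simp

end Values

section Independence
variable {n : ℕ} {A : ℕ → ℕ → ℤ} {Dd : ℕ → ℕ}

lemma rep_eval {R Z : Type} [CommRing R] [IsDomain R] [Algebra RH R] [Fintype Z] [DecidableEq Z]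
    (E : EvalData n A Dd R Z) (hA : CartanLike n A Dd) {t : BrTree}
    (ht : ∀ i ∈ t.leaves, i ∈ Finset.Icc 1 n) (s : ℕ) :
    E.rep hA (t.eval (gy1 n A Dd) s) = t.eval E.gen s := by
  rw [BrTree.map_eval]
  refine BrTree.eval_congr s t fun i hi r => ?_
  have h := Finset.mem_Icc.1 (ht i hi)
  rw [gy1, dif_pos h, E.rep_yg hA]
  rw [Nat.sub_add_cancel h.1]

/-- A nonzero polynomial does not vanish at some point with pairwise distinct coordinates. -/
lemma exists_injective_eval_ne_zero {m : ℕ} {p : MvPolynomial (Fin m) ℚ} (hp : p ≠ 0) :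
    ∃ y : Fin m → ℚ, Function.Injective y ∧ MvPolynomial.eval y p ≠ 0 := by
  set q : MvPolynomial (Fin m) ℚ := p * ∏ k, ∏ l ∈ Finset.univ.erase k,
    (MvPolynomial.X k - MvPolynomial.X l) with hq
  have hq0 : q ≠ 0 := by
    refine mul_ne_zero hp (Finset.prod_ne_zero_iff.2 fun k _ =>
      Finset.prod_ne_zero_iff.2 fun l hl => sub_ne_zero.2 fun h => ?_)
    exact Finset.ne_of_mem_erase hl (MvPolynomial.X_injective h).symm
  obtain ⟨y, hy⟩ : ∃ y, MvPolynomial.eval y q ≠ 0 := by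
    by_contra! h
    exact hq0 (MvPolynomial.funext fun y => by rw [h, map_zero])
  rw [hq, map_mul] at hy
  refine ⟨y, fun k l hkl => ?_, left_ne_zero_of_mul hy⟩
  by_contra hne
  refine right_ne_zero_of_mul hy ?_
  rw [map_prod]
  refine Finset.prod_eq_zero (Finset.mem_univ k) ?_
  rw [map_prod]
  exact Finset.prod_eq_zero (Finset.mem_erase.2 ⟨Ne.symm hne, Finset.mem_univ l⟩) (by simp [hkl])

variable {Root : Type} [LinearOrder Root] (tr : Root → BrTree)

/-- The value polynomial of the monomial with exponents `h`. -/
def monPoly (A : ℕ → ℕ → ℤ) (Dd : ℕ → ℕ) {m : ℕ} (v : Fin m → Bool × ℕ → ℚ)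
    (T : Fin m → Finset (Bool × ℕ)) (h : Lex (Root × ℕ) →₀ ℕ) : MvPolynomial (Fin m) ℚ :=
  valPoly A Dd v T (fun a => tr (ofLex ((expand h).get a)).1)
    fun a => (ofLex ((expand h).get a)).2

variable {tr}

lemma coeff_valPoly {m N : ℕ} {v : Fin m → Bool × ℕ → ℚ} {T : Fin m → Finset (Bool × ℕ)}
    (σ : Fin m → ℕ) (t : Fin N → BrTree) (s : Fin N → ℕ) :
    MvPolynomial.coeff (∑ k, Finsupp.single k (σ k)) (valPoly A Dd v T t s) =
      ∑ κ : Fin N → Fin m, if ∑ a, Finsupp.single (κ a) (s a) = ∑ k, Finsupp.single k (σ k)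
        then assignCoeff A Dd v T t κ else 0 := by
  rw [valPoly, MvPolynomial.coeff_sum]
  simp only [MvPolynomial.coeff_monomial]

lemma eq_of_sum_single {m N : ℕ} {κ : Fin N → Fin m} (hκ : Function.Bijective κ) {s : Fin N → ℕ}
    {σ : Fin m → ℕ}
    (h : ∑ a, Finsupp.single (κ a) (s a) = ∑ k, Finsupp.single k (σ k)) (a : Fin N) :
    s a = σ (κ a) := by
  have := DFunLike.congr_fun h (κ a)
  rw [Finsupp.finsetSum_apply, Finsupp.finsetSum_apply,
    Finset.sum_eq_single a (fun b _ hb => Finsupp.single_eq_of_ne (fun e => hb (hκ.1 e.symm)))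
      (by simp),
    Finset.sum_eq_single (κ a) (fun b _ hb => Finsupp.single_eq_of_ne (Ne.symm hb))
      (by simp)] at this
  simpa using this

/-- Nonvanishing of the matrix coefficients attached to the roots. -/
structure Detects (n : ℕ) (A : ℕ → ℕ → ℤ) (Dd : ℕ → ℕ) (tr : Root → BrTree) : Prop where
  flags : ∀ β, (tr β).flags = 1
  injective : Function.Injective fun β => (tr β).leaves
  mem_Icc : ∀ β, ∀ i ∈ (tr β).leaves, i ∈ Finset.Icc 1 n
  exists_ne : ∀ β, ∃ v T, GenericVal A Dd n v ∧ oneEval A Dd v (tr β) (vac ℚ) T ≠ 0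

variable (hA : CartanLike n A Dd) (htr : Detects n A Dd tr)
include hA htr

lemma eq_zero_of_rep_eq_zero (c : (Lex (Root × ℕ) →₀ ℕ) →₀ RH)
    (hc : ∀ (m : ℕ) (E : EvalData n A Dd (PowerSeries ℚ) (Fin m × Bool)),
      Finsupp.linearCombination RH (fun h : Lex (Root × ℕ) →₀ ℕ => E.rep hA
        (ordMon (fun p => (tr (ofLex p).1).eval (gy1 n A Dd) (ofLex p).2) h)) c = 0) : c = 0 := by
  classical
  by_contra hc0
  have hex : ∃ e h, (c h).coeff e ≠ 0 := by
    by_contra! h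
    exact hc0 (Finsupp.ext fun x => Polynomial.ext fun e => by simpa using h e x)
  set e := Nat.find hex with he
  obtain ⟨h₀, hh₀⟩ := Nat.find_spec hex
  have hmin : ∀ e' < e, ∀ h, (c h).coeff e' = 0 := fun e' h' h => by
    by_contra hne
    exact Nat.find_min hex h' ⟨h, hne⟩
  obtain ⟨hs, hs_mem, hs_max⟩ := Finset.exists_max_image
    (c.support.filter fun h => (c h).coeff e ≠ 0) (fun h => (expand h).length)
    ⟨h₀, Finset.mem_filter.2 ⟨Finsupp.mem_support_iff.2 fun h => hh₀ (by rw [h]; simp), hh₀⟩⟩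
  rw [Finset.mem_filter] at hs_mem
  choose v₀ T₀ hv₀ hT₀ using htr.exists_ne
  set m := (expand hs).length with hm
  set γ : Fin m → Root := fun k => (ofLex ((expand hs).get k)).1 with hγ
  set σ : Fin m → ℕ := fun k => (ofLex ((expand hs).get k)).2 with hσ
  set v : Fin m → Bool × ℕ → ℚ := fun k => v₀ (γ k) with hv
  set T : Fin m → Finset (Bool × ℕ) := fun k => T₀ (γ k) with hT
  have hne : ∀ k, oneEval A Dd (v k) (tr (γ k)) (vac ℚ) (T k) ≠ 0 := fun k => hT₀ (γ k)
  set p : MvPolynomial (Fin m) ℚ := ∑ h ∈ c.support, (c h).coeff e • monPoly tr A Dd v T h with hp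
  have hkey : ∀ h, h ∈ c.support → h ≠ hs → (c h).coeff e ≠ 0 →
      MvPolynomial.coeff (∑ k, Finsupp.single k (σ k)) (monPoly tr A Dd v T h) = 0 := by
    intro h hh hne' hd
    have hN := hs_max h (Finset.mem_filter.2 ⟨hh, hd⟩)
    rw [monPoly, coeff_valPoly]
    refine Finset.sum_eq_zero fun κ _ => ?_
    split_ifs with hκ
    · by_contra h0
      obtain ⟨hb, hl, -⟩ := assignCoeff_ne_zero (γ := fun k => tr (γ k)) hne hN h0
      have h1 : ∀ a, (expand h).get a = (expand hs).get (κ a) := fun a => by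
        have h2 := htr.injective (hl a)
        have h3 := eq_of_sum_single hb hκ a
        exact ofLex.injective (Prod.ext h2 h3)
      refine hne' (eq_of_expand_perm ?_)
      rw [← List.ofFn_get (expand h), ← List.ofFn_get (expand hs)]
      have hc : (expand h).length = m := by simpa using Fintype.card_of_bijective hb
      rw [← Multiset.coe_eq_coe]
      have h4 : ∀ {N : ℕ} (f : Fin N → Lex (Root × ℕ)),
          ((List.ofFn f : List _) : Multiset _) = Finset.univ.val.map f := fun {N} f => by
        rw [List.ofFn_eq_map, ← Multiset.map_coe]; rfl
      rw [h4, h4]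
      have h5 : (Finset.univ : Finset (Fin m)).val =
          (Finset.univ : Finset (Fin (expand h).length)).val.map κ := by
        have := congrArg Finset.val (Finset.map_univ_equiv (Equiv.ofBijective κ hb))
        rw [Finset.map_val] at this
        exact this.symm
      rw [show (Finset.univ : Finset (Fin (expand hs).length)) = (Finset.univ : Finset (Fin m)) from
        rfl, h5, Multiset.map_map]
      exact Multiset.map_congr rfl fun a _ => h1 a
    · rfl
  have hself : MvPolynomial.coeff (∑ k, Finsupp.single k (σ k)) (monPoly tr A Dd v T hs) ≠ 0 := by
    rw [monPoly, coeff_valPoly]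
    set F := ∏ k, oneEval A Dd (v k) (tr (γ k)) (vac ℚ) (T k) with hF
    have hF0 : F ≠ 0 := Finset.prod_ne_zero_iff.2 fun k _ => hne k
    have hid : assignCoeff A Dd v T (fun a => tr (γ a)) id = F := by
      refine Finset.prod_congr rfl fun k _ => ?_
      have : (List.finRange m).filter (fun a => id a = k) = [k] := by
        rw [List.filter_congr (q := fun b => b == k) (fun b _ => by
          rw [Bool.eq_iff_iff]; simp)]
        rw [List.filter_beq, List.count_eq_one_of_mem (List.nodup_finRange _) (List.mem_finRange k)]
        rfl
      rw [this]
      simp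
    have hterm : ∀ κ : Fin m → Fin m,
        (if ∑ a, Finsupp.single (κ a) (σ a) = ∑ k, Finsupp.single k (σ k)
          then assignCoeff A Dd v T (fun a => tr (γ a)) κ else 0) / F = 0 ∨
        (if ∑ a, Finsupp.single (κ a) (σ a) = ∑ k, Finsupp.single k (σ k)
          then assignCoeff A Dd v T (fun a => tr (γ a)) κ else 0) / F = 1 := by
      intro κ
      split_ifs with hκ
      · by_cases h0 : assignCoeff A Dd v T (fun a => tr (γ a)) κ = 0
        · left; rw [h0, zero_div]
        · right
          obtain ⟨-, hl, h3⟩ := assignCoeff_ne_zero (γ := fun k => tr (γ k)) hne le_rfl h0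
          rw [h3 fun a => congrArg tr (htr.injective (hl a)), ← hF, div_self hF0]
      · left; rw [zero_div]
    intro h0
    change ∑ κ : Fin m → Fin m, (if ∑ a, Finsupp.single (κ a) (σ a) = ∑ k, Finsupp.single k (σ k)
          then assignCoeff A Dd v T (fun a => tr (γ a)) κ else 0) = 0 at h0
    have h1 := congrArg (· / F) h0
    simp only [Finset.sum_div, zero_div] at h1
    have h2 := (Finset.sum_eq_zero_iff_of_nonneg fun κ _ => by
      rcases hterm κ with h | h <;> rw [h] <;> norm_num).1 h1 id (Finset.mem_univ _)
    rw [show ∑ a, Finsupp.single (id a) (σ a) = ∑ k, Finsupp.single k (σ k) from rfl,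
      if_pos rfl, hid, div_self hF0] at h2
    exact one_ne_zero h2
  have hp0 : p ≠ 0 := by
    intro h0
    have h1 := congrArg (MvPolynomial.coeff (∑ k, Finsupp.single k (σ k))) h0
    rw [hp, MvPolynomial.coeff_sum, Finset.sum_eq_single hs] at h1
    · rw [MvPolynomial.coeff_smul, MvPolynomial.coeff_zero, smul_eq_mul] at h1
      exact mul_ne_zero hs_mem.2 hself h1
    · intro h hh hne'
      rw [MvPolynomial.coeff_smul, smul_eq_mul]
      by_cases hd : (c h).coeff e = 0
      · rw [hd, zero_mul]
      · rw [hkey h hh hne' hd, mul_zero]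
    · exact fun h => absurd hs_mem.1 h
  obtain ⟨y, hy, hpy⟩ := exists_injective_eval_ne_zero hp0
  set E := clusterData hA y hy v (fun k => hv₀ (γ k)) with hE
  have hval : ∀ h : Lex (Root × ℕ) →₀ ℕ, PowerSeries.constantCoeff (E.rep hA
      (ordMon (fun p => (tr (ofLex p).1).eval (gy1 n A Dd) (ofLex p).2) h) (vac _)
      (unionSlices T)) = MvPolynomial.eval y (monPoly tr A Dd v T h) := by
    intro h
    rw [monPoly, ← constantCoeff_prod_eval v T hA y hy (fun k => hv₀ (γ k)) _
      (fun a => htr.flags _), ordMon_eq_prod, map_list_prod, List.map_map]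
    have : (List.map ((E.rep hA) ∘ fun p : Lex (Root × ℕ) =>
        (tr (ofLex p).1).eval (gy1 n A Dd) (ofLex p).2) (expand h)) =
        List.ofFn fun a : Fin (expand h).length =>
          (tr (ofLex ((expand h).get a)).1).eval E.gen (ofLex ((expand h).get a)).2 := by
      refine (congrArg _ (List.ofFn_get (expand h)).symm).trans ?_
      rw [List.map_ofFn]
      exact congrArg List.ofFn (funext fun a => rep_eval E hA (htr.mem_Icc _) _)
    rw [this]
  have hsum : ∑ h ∈ c.support, algebraMap RH (PowerSeries ℚ) (c h) * (E.rep hA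
      (ordMon (fun p => (tr (ofLex p).1).eval (gy1 n A Dd) (ofLex p).2) h) (vac _)
      (unionSlices T)) = 0 := by
    have h1 := congrArg (fun M : Module.End (PowerSeries ℚ) _ => M (vac _) (unionSlices T))
      (hc m E)
    simp only [Finsupp.linearCombination_apply, Finsupp.sum] at h1
    rw [LinearMap.sum_apply, Finset.sum_apply] at h1
    refine Eq.trans (Finset.sum_congr rfl fun h _ => ?_) h1
    rw [LinearMap.smul_apply, Pi.smul_apply, Algebra.smul_def]
  refine hpy ?_
  have h2 := congrArg (PowerSeries.coeff e) hsum
  rw [map_sum, map_zero] at h2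
  rw [hp, map_sum, ← h2]
  refine Finset.sum_congr rfl fun h _ => ?_
  rw [MvPolynomial.smul_eval, ← hval, PowerSeries.coeff_mul, Finset.sum_eq_single (e, 0)]
  · simp [PowerSeries.algebraMap_apply']
  · rintro ⟨a, b⟩ hab hne'
    rw [Finset.HasAntidiagonal.mem_antidiagonal] at hab
    simp only at hab
    have : (c h).coeff a = 0 := hmin a (by
      rcases Nat.eq_zero_or_pos b with hb | hb
      · subst hb; exact absurd (by rw [← hab, add_zero]) hne'
      · omega) h
    simp [PowerSeries.algebraMap_apply', this]
  · simp

theorem linearIndependent_ordMon :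
    LinearIndependent RH fun h : Lex (Root × ℕ) →₀ ℕ =>
      ordMon (fun p => (tr (ofLex p).1).eval (gy1 n A Dd) (ofLex p).2) h := by
  intro c c' h
  rw [← sub_eq_zero]
  refine eq_zero_of_rep_eq_zero hA htr _ fun m E => ?_
  rw [map_sub, sub_eq_zero]
  have h1 := congrArg (E.rep hA).toLinearMap h
  rwa [Finsupp.apply_linearCombination, Finsupp.apply_linearCombination] at h1

end Independence

/-! ### The grading of the Yangian -/

section Grading
variable (Y : Type) [Ring Y] [Algebra RH Y]

/-- Polynomials in a grading variable, with `ħ` acting as `ħ` times that variable. -/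
def GradedTarget : Type := Polynomial Y

instance : Ring (GradedTarget Y) := inferInstanceAs (Ring (Polynomial Y))

/-- The underlying polynomial of an element of `GradedTarget`. -/
def toPoly : GradedTarget Y ≃+* Polynomial Y := RingEquiv.refl _

variable {Y} in
lemma commute_hbar (y : Y) : Commute (algebraMap RH Y hbar) y := Algebra.commutes hbar y

/-- The scalars of `GradedTarget`: `ħ` acts as `ħ` times the grading variable. -/
def gradedScalars : RH →+* Polynomial Y :=
  Polynomial.eval₂RingHom' ((Polynomial.C).comp ((algebraMap RH Y).comp Polynomial.C))
    (Polynomial.C (algebraMap RH Y hbar) * Polynomial.X) fun a => by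
      refine Commute.mul_right ?_ (Polynomial.commute_X _).symm
      exact (commute_hbar _).symm.map (Polynomial.C : Y →+* _)

lemma gradedScalars_C (a : ℚ) : gradedScalars Y (Polynomial.C a) =
    Polynomial.C (algebraMap RH Y (Polynomial.C a)) := by
  simp [gradedScalars]

lemma gradedScalars_hbar :
    gradedScalars Y hbar = Polynomial.C (algebraMap RH Y hbar) * Polynomial.X := by
  simp [gradedScalars, hbar]

instance : Algebra RH (GradedTarget Y) :=
  RingHom.toAlgebra' (gradedScalars Y) fun c x => by
    change gradedScalars Y c * toPoly Y x = toPoly Y x * gradedScalars Y c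
    generalize toPoly Y x = x
    induction c using Polynomial.induction_on' with
    | add p q hp hq => rw [map_add, add_mul, mul_add, hp, hq]
    | monomial k a =>
      rw [← Polynomial.C_mul_X_pow_eq_monomial, map_mul, map_pow, gradedScalars_C]
      have h1 : Commute (Polynomial.C (algebraMap RH Y (Polynomial.C a))) x := by
        rw [commute_iff_eq]
        ext d
        rw [Polynomial.coeff_C_mul, Polynomial.coeff_mul_C]
        exact Algebra.commutes _ _
      have h2 : Commute (gradedScalars Y hbar) x := by
        rw [gradedScalars_hbar]
        refine Commute.mul_left ?_ (Polynomial.commute_X _)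
        rw [commute_iff_eq]
        ext d
        rw [Polynomial.coeff_C_mul, Polynomial.coeff_mul_C]
        exact Algebra.commutes _ _
      exact (h1.mul_left (h2.pow_left k))

lemma toPoly_smul (c : RH) (x : GradedTarget Y) :
    toPoly Y (c • x) = gradedScalars Y c * toPoly Y x := rfl

/-- A homomorphism to graded polynomials which specialises to the identity is a grading. -/
structure IsGrading (δ : Y →ₐ[RH] GradedTarget Y) : Prop where
  eval_one : ∀ y, Polynomial.eval 1 (toPoly Y (δ y)) = y

variable {Y} {δ : Y →ₐ[RH] GradedTarget Y}

/-- The homogeneous component of degree `d`. -/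
def gradedPart (δ : Y →ₐ[RH] GradedTarget Y) (d : ℕ) (y : Y) : Y :=
  Polynomial.coeff (toPoly Y (δ y)) d

lemma gradedPart_add (d : ℕ) (x y : Y) :
    gradedPart δ d (x + y) = gradedPart δ d x + gradedPart δ d y := by
  unfold gradedPart
  rw [map_add, map_add]
  exact Polynomial.coeff_add _ _ _

lemma gradedPart_zero (d : ℕ) : gradedPart δ d (0 : Y) = 0 := by
  unfold gradedPart
  rw [map_zero, map_zero]
  exact Polynomial.coeff_zero _

lemma gradedPart_C_smul (d : ℕ) (a : ℚ) (y : Y) :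
    gradedPart δ d ((Polynomial.C a : RH) • y) = (Polynomial.C a : RH) • gradedPart δ d y := by
  unfold gradedPart
  rw [map_smul, toPoly_smul, gradedScalars_C, Algebra.smul_def]
  exact Polynomial.coeff_C_mul _

lemma gradedPart_hbar_smul_succ (d : ℕ) (y : Y) :
    gradedPart δ (d + 1) (hbar • y) = hbar • gradedPart δ d y := by
  unfold gradedPart
  rw [map_smul, toPoly_smul, gradedScalars_hbar, Algebra.smul_def, mul_assoc,
    Polynomial.coeff_C_mul, Polynomial.X_mul, Polynomial.coeff_mul_X]

lemma gradedPart_hbar_smul_zero (y : Y) : gradedPart δ 0 (hbar • y) = 0 := by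
  unfold gradedPart
  rw [map_smul, toPoly_smul, gradedScalars_hbar, mul_assoc,
    Polynomial.coeff_C_mul, Polynomial.X_mul, Polynomial.mul_coeff_zero, Polynomial.coeff_X_zero,
    mul_zero, mul_zero]

/-- A submodule spanned by homogeneous elements contains the homogeneous components of its
elements. -/
lemma gradedPart_mem_span {S : Set Y}
    (hS : ∀ x ∈ S, ∀ d, gradedPart δ d x = x ∨ gradedPart δ d x = 0)
    {m : Y} (hm : m ∈ Submodule.span RH S) (d : ℕ) :
    gradedPart δ d m ∈ Submodule.span RH S := by
  induction hm using Submodule.span_induction generalizing d with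
  | mem x hx =>
    rcases hS x hx d with h | h
    · rw [h]; exact Submodule.subset_span hx
    · rw [h]; exact zero_mem _
  | zero => rw [gradedPart_zero]; exact zero_mem _
  | add x y _ _ hx hy => rw [gradedPart_add]; exact add_mem (hx d) (hy d)
  | smul c x _ hx =>
    induction c using Polynomial.induction_on' generalizing d with
    | add p q hp hq => rw [add_smul, gradedPart_add]; exact add_mem (hp d) (hq d)
    | monomial k a =>
      rw [← Polynomial.C_mul_X_pow_eq_monomial, mul_smul, gradedPart_C_smul]
      refine Submodule.smul_mem _ _ ?_
      change gradedPart δ d (hbar ^ k • x) ∈ _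
      induction k generalizing d with
      | zero => simpa using hx d
      | succ k ih =>
        rw [pow_succ', mul_smul]
        cases d with
        | zero => rw [gradedPart_hbar_smul_zero]; exact zero_mem _
        | succ d => rw [gradedPart_hbar_smul_succ]; exact Submodule.smul_mem _ _ (ih d)

/-- A graded form of Nakayama's lemma: generators modulo `ħ` which are homogeneous generate. -/
theorem span_eq_top_of_span_sup (hδ : IsGrading Y δ) {S : Set Y}
    (hS : ∀ x ∈ S, ∀ d, gradedPart δ d x = x ∨ gradedPart δ d x = 0)
    (htop : ∀ y, ∃ m ∈ Submodule.span RH S, ∃ y' : Y, y = m + hbar • y') :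
    Submodule.span RH S = ⊤ := by
  have key : ∀ d y, gradedPart δ d y ∈ Submodule.span RH S := by
    intro d
    induction d with
    | zero =>
      intro y
      obtain ⟨m, hm, y', rfl⟩ := htop y
      rw [gradedPart_add, gradedPart_hbar_smul_zero, add_zero]
      exact gradedPart_mem_span hS hm 0
    | succ d ih =>
      intro y
      obtain ⟨m, hm, y', rfl⟩ := htop y
      rw [gradedPart_add, gradedPart_hbar_smul_succ]
      exact add_mem (gradedPart_mem_span hS hm _) (Submodule.smul_mem _ _ (ih _))
  rw [eq_top_iff]
  intro y _
  rw [← hδ.eval_one y, Polynomial.eval_eq_sum_range]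
  refine Submodule.sum_mem _ fun d _ => ?_
  rw [one_pow, mul_one]
  exact key d y

/-- Homogeneity of degree `d`. -/
def IsHomog (δ : Y →ₐ[RH] GradedTarget Y) (d : ℕ) (y : Y) : Prop :=
  toPoly Y (δ y) = Polynomial.C y * Polynomial.X ^ d

lemma IsHomog.gradedPart {d : ℕ} {y : Y} (h : IsHomog δ d y) (e : ℕ) :
    gradedPart δ e y = y ∨ gradedPart δ e y = 0 := by
  unfold _root_.gradedPart
  rw [h, Polynomial.coeff_C_mul_X_pow]
  split_ifs <;> simp

lemma IsHomog.mul {d e : ℕ} {x y : Y} (hx : IsHomog δ d x) (hy : IsHomog δ e y) :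
    IsHomog δ (d + e) (x * y) := by
  unfold IsHomog at *
  rw [map_mul, map_mul, hx, hy, ← mul_assoc, mul_assoc (Polynomial.C x), Polynomial.X_pow_mul,
    map_mul, pow_add]
  simp only [mul_assoc]

lemma IsHomog.sub {d : ℕ} {x y : Y} (hx : IsHomog δ d x) (hy : IsHomog δ d y) :
    IsHomog δ d (x - y) := by
  unfold IsHomog at *
  rw [map_sub, map_sub, hx, hy, map_sub, sub_mul]

lemma IsHomog.zero (d : ℕ) : IsHomog δ d (0 : Y) := by
  unfold IsHomog
  simp

lemma IsHomog.one : IsHomog δ 0 (1 : Y) := by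
  unfold IsHomog
  simp

lemma isHomog_list_prod {l : List Y} (hl : ∀ y ∈ l, ∃ d, IsHomog δ d y) :
    ∃ d, IsHomog δ d l.prod := by
  induction l with
  | nil => exact ⟨0, IsHomog.one⟩
  | cons a l ih =>
    obtain ⟨d, hd⟩ := hl a (by simp)
    obtain ⟨e, he⟩ := ih fun y hy => hl y (by simp [hy])
    exact ⟨d + e, by rw [List.prod_cons]; exact hd.mul he⟩

lemma isHomog_eval {g : ℕ → ℕ → Y} (hg : ∀ i r, IsHomog δ r (g i r)) (t : BrTree) (s : ℕ) :
    IsHomog δ (t.flags * s) (t.eval g s) := by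
  induction t with
  | leaf i f =>
    cases f
    · simpa [BrTree.eval, BrTree.flags] using hg i 0
    · simpa [BrTree.eval, BrTree.flags] using hg i s
  | node a b iha ihb =>
    simp only [BrTree.eval, BrTree.flags, add_mul]
    refine (iha.mul ihb).sub ?_
    rw [add_comm]
    exact ihb.mul iha

end Grading

section Relations
variable {n : ℕ} {A : ℕ → ℕ → ℤ} {Dd : ℕ → ℕ}

lemma yg_loop (i j : Fin n) (r s : ℕ) :
    yg n A Dd i (r + 1) * yg n A Dd j s - yg n A Dd j s * yg n A Dd i (r + 1) -
      (yg n A Dd i r * yg n A Dd j (s + 1) - yg n A Dd j (s + 1) * yg n A Dd i r) =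
    (Polynomial.C (halfForm A Dd (i.1 + 1) (j.1 + 1)) * hbar) •
      (yg n A Dd i r * yg n A Dd j s + yg n A Dd j s * yg n A Dd i r) := by
  have h := RingQuot.mkAlgHom_rel RH (YRel.loop (n := n) (A := A) (Dd := Dd) i j r s)
  simp only [map_sub, map_mul, map_smul, map_add] at h
  exact h

lemma yg_serre (i j : Fin n) (hij : i ≠ j)
    (ss : Fin (1 - A (i.1 + 1) (j.1 + 1)).toNat → ℕ) (r : ℕ) :
    serreSum (yg n A Dd i) (yg n A Dd j r) _ ss = 0 := by
  have h := RingQuot.mkAlgHom_rel RH (YRel.serre (n := n) (A := A) (Dd := Dd) i j hij ss r)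
  rw [map_zero] at h
  rw [← h]
  exact (map_serreSum _ _ _ _ _).symm

end Relations

section Grading
variable {B : Type} [Ring B]

lemma mul_graded (x y : B) (d e : ℕ) :
    (Polynomial.C x * Polynomial.X ^ d * (Polynomial.C y * Polynomial.X ^ e) : Polynomial B) =
      Polynomial.C (x * y) * Polynomial.X ^ (d + e) := by
  rw [← mul_assoc, mul_assoc (Polynomial.C x), Polynomial.X_pow_mul, map_mul, pow_add]
  simp only [mul_assoc]

lemma foldr_bracket_graded (X : ℕ → B) (y : B) (r : ℕ) (l : List ℕ) :
    (l.map fun s => (Polynomial.C (X s) * Polynomial.X ^ s : Polynomial B)).foldr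
      (fun a b => a * b - b * a) (Polynomial.C y * Polynomial.X ^ r) =
    Polynomial.C ((l.map X).foldr (fun a b => a * b - b * a) y) *
      Polynomial.X ^ (l.sum + r) := by
  induction l with
  | nil => simp
  | cons s l ih =>
    rw [List.map_cons, List.foldr_cons, ih, mul_graded, mul_graded, List.map_cons,
      List.foldr_cons, List.sum_cons, map_sub, sub_mul, add_comm (l.sum + r) s, ← add_assoc]

lemma serreSum_graded (X : ℕ → B) (y : B) (r m : ℕ) (ss : Fin m → ℕ) :
    serreSum (fun s => (Polynomial.C (X s) * Polynomial.X ^ s : Polynomial B))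
      (Polynomial.C y * Polynomial.X ^ r) m ss =
    Polynomial.C (serreSum X y m ss) * Polynomial.X ^ ((∑ k, ss k) + r) := by
  simp only [serreSum, map_sum, Finset.sum_mul]
  refine Finset.sum_congr rfl fun σ _ => ?_
  have h := foldr_bracket_graded X y r (List.ofFn fun l => ss (σ l))
  rw [List.map_ofFn, List.map_ofFn, List.sum_ofFn, Equiv.sum_comp σ ss] at h
  exact h

variable (n : ℕ) (A : ℕ → ℕ → ℤ) (Dd : ℕ → ℕ) (Y : Type) [Ring Y] [Algebra RH Y]

/-- The graded image of a family of elements. -/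
def gradedGen (x : Fin n → ℕ → Y) (i : Fin n) (r : ℕ) : GradedTarget Y :=
  (toPoly Y).symm (Polynomial.C (x i r) * Polynomial.X ^ r)

variable {n Y} in
lemma toPoly_gradedGen (x : Fin n → ℕ → Y) (i : Fin n) (r : ℕ) :
    toPoly Y (gradedGen n Y x i r) = Polynomial.C (x i r) * Polynomial.X ^ r := rfl

/-- The graded version of a homomorphism from the Yangian. -/
def gradedLift (x : Fin n → ℕ → Y)
    (hloop : ∀ i j r s, x i (r + 1) * x j s - x j s * x i (r + 1) -
      (x i r * x j (s + 1) - x j (s + 1) * x i r) =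
      (Polynomial.C (halfForm A Dd (i.1 + 1) (j.1 + 1)) * hbar) • (x i r * x j s + x j s * x i r))
    (hserre : ∀ i j, i ≠ j → ∀ (ss : Fin (1 - A (i.1 + 1) (j.1 + 1)).toNat → ℕ) (r : ℕ),
      serreSum (x i) (x j r) _ ss = 0) : YA n A Dd →ₐ[RH] GradedTarget Y :=
  RingQuot.liftAlgHom RH ⟨FreeAlgebra.lift RH fun p => gradedGen n Y x p.1 p.2, by
    rintro _ _ (⟨i, j, r, s⟩ | ⟨i, j, hij, ss, r⟩)
    · simp only [fy, map_sub, map_mul, map_add, map_smul, FreeAlgebra.lift_ι_apply]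
      apply (toPoly Y).injective
      have h := hloop i j r s
      rw [Algebra.smul_def, map_mul] at h
      simp only [halfForm] at h
      have h2 : (Polynomial.C (algebraMap RH Y (Polynomial.C ((Dd (i.1 + 1) : ℚ) *
          (A (i.1 + 1) (j.1 + 1) : ℚ) / 2))) * (Polynomial.C (algebraMap RH Y hbar) *
          Polynomial.X) : Polynomial Y) = Polynomial.C (algebraMap RH Y (Polynomial.C
          ((Dd (i.1 + 1) : ℚ) * (A (i.1 + 1) (j.1 + 1) : ℚ) / 2)) * algebraMap RH Y hbar) *
          Polynomial.X ^ 1 := by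
        rw [pow_one, map_mul, mul_assoc]
      rw [toPoly_smul, map_mul, gradedScalars_C, gradedScalars_hbar, h2]
      simp only [map_sub, map_mul (toPoly Y), map_add, toPoly_gradedGen, mul_graded]
      rw [add_comm s (r + 1), add_comm (s + 1) r, add_comm s r,
        show r + 1 + s = 1 + (r + s) by ring, show r + (s + 1) = 1 + (r + s) by ring,
        ← add_mul, ← map_add, mul_graded, ← h]
      simp only [map_sub, sub_mul]
    · rw [map_zero]
      change FreeAlgebra.lift RH _ (serreSum (fy n i) (fy n j r) _ ss) = _
      rw [map_serreSum]
      apply (toPoly Y).injective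
      rw [map_serreSum, map_zero]
      simp only [fy, FreeAlgebra.lift_ι_apply, toPoly_gradedGen]
      rw [serreSum_graded, hserre i j hij, map_zero, zero_mul]⟩

lemma gradedLift_yg (x : Fin n → ℕ → Y) (hloop hserre) (i : Fin n) (r : ℕ) :
    toPoly Y (gradedLift n A Dd Y x hloop hserre (yg n A Dd i r)) =
      Polynomial.C (x i r) * Polynomial.X ^ r := by
  rw [← toPoly_gradedGen]
  simp [gradedLift, yg, fy]

/-- The grading of the Yangian by `deg x_{i,r} = r` and `deg ħ = 1`. -/
def yangianGrading : YA n A Dd →ₐ[RH] GradedTarget (YA n A Dd) :=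
  gradedLift n A Dd (YA n A Dd) (yg n A Dd) yg_loop yg_serre

lemma isHomog_yg (i : Fin n) (r : ℕ) : IsHomog (yangianGrading n A Dd) r (yg n A Dd i r) :=
  gradedLift_yg n A Dd (YA n A Dd) (yg n A Dd) yg_loop yg_serre i r

lemma isHomog_gy1 (i : ℕ) (r : ℕ) : IsHomog (yangianGrading n A Dd) r (gy1 n A Dd i r) := by
  unfold gy1
  split_ifs
  · exact isHomog_yg _ _ _ _ _
  · exact IsHomog.zero _

variable {n Y} in
lemma eval_one_comp (φ : YA n A Dd →ₐ[RH] GradedTarget Y) (ψ : YA n A Dd →ₐ[RH] Y)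
    (h : ∀ i r, toPoly Y (φ (yg n A Dd i r)) =
      Polynomial.C (ψ (yg n A Dd i r)) * Polynomial.X ^ r) (y : YA n A Dd) :
    Polynomial.eval 1 (toPoly Y (φ y)) = ψ y := by
  have hmul : ∀ p q : Polynomial Y, Polynomial.eval 1 (p * q) =
      Polynomial.eval 1 p * Polynomial.eval 1 q := fun p q =>
    Polynomial.eval₂_mul_noncomm _ _ fun _ => Commute.one_right _
  obtain ⟨f, rfl⟩ := RingQuot.mkAlgHom_surjective RH (YRel n A Dd) y
  induction f using FreeAlgebra.induction with
  | grade0 c =>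
    rw [AlgHom.commutes, AlgHom.commutes, AlgHom.commutes, Algebra.algebraMap_eq_smul_one,
      toPoly_smul, map_one, mul_one]
    induction c using Polynomial.induction_on' with
    | add p q hp hq => rw [map_add, map_add, Polynomial.eval_add, hp, hq]
    | monomial k a =>
      have hX : Polynomial.eval 1 (gradedScalars Y hbar ^ k) = algebraMap RH Y hbar ^ k := by
        induction k with
        | zero => simp
        | succ k ih => rw [pow_succ, pow_succ, hmul, ih, gradedScalars_hbar, hmul]; simp
      rw [← Polynomial.C_mul_X_pow_eq_monomial, map_mul, map_mul, map_pow, map_pow,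
        gradedScalars_C, hmul, Polynomial.eval_C]
      change _ * Polynomial.eval 1 (gradedScalars Y hbar ^ k) = _
      rw [hX]; rfl
  | grade1 p =>
    have := h p.1 p.2
    change Polynomial.eval 1 (toPoly Y (φ (yg n A Dd p.1 p.2))) = ψ (yg n A Dd p.1 p.2)
    rw [this]
    simp
  | mul a b ha hb => rw [map_mul, map_mul, map_mul, hmul, ha, hb, map_mul]
  | add a b ha hb => rw [map_add, map_add, map_add, Polynomial.eval_add, ha, hb, map_add]

lemma isGrading_yangianGrading : IsGrading (YA n A Dd) (yangianGrading n A Dd) :=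
  ⟨eval_one_comp A Dd (yangianGrading n A Dd) (AlgHom.id RH _) (isHomog_yg n A Dd)⟩

end Grading

/-! ### Straightening modulo a central scalar -/

section Straightening
variable {R Y ι : Type} [CommRing R] [Ring Y] [Algebra R Y] (c : R) (E : ι → Y)

/-- The multiples of a scalar. -/
def scalarMultiples : Submodule R Y := LinearMap.range (c • LinearMap.id : Y →ₗ[R] Y)

lemma mem_scalarMultiples {y : Y} : y ∈ scalarMultiples c ↔ ∃ z : Y, c • z = y := by
  simp [scalarMultiples]

lemma mul_mem_scalarMultiples (a : Y) {y : Y} (h : y ∈ scalarMultiples c) :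
    a * y ∈ scalarMultiples c := by
  obtain ⟨z, rfl⟩ := (mem_scalarMultiples c).1 h
  exact (mem_scalarMultiples c).2 ⟨a * z, (mul_smul_comm c a z).symm⟩

lemma scalarMultiples_mul (a : Y) {y : Y} (h : y ∈ scalarMultiples c) :
    y * a ∈ scalarMultiples c := by
  obtain ⟨z, rfl⟩ := (mem_scalarMultiples c).1 h
  exact (mem_scalarMultiples c).2 ⟨z * a, (smul_mul_assoc c z a).symm⟩

/-- Combinations of words of length less than `m`, modulo the multiples of `c`. -/
def shortWords (m : ℕ) : Submodule R Y :=
  Submodule.span R {y | ∃ l : List ι, l.length < m ∧ (l.map E).prod = y} ⊔ scalarMultiples c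

lemma word_mem_shortWords {m : ℕ} {l : List ι} (h : l.length < m) :
    (l.map E).prod ∈ shortWords c E m :=
  Submodule.mem_sup_left (Submodule.subset_span ⟨l, h, rfl⟩)

lemma mul_mem_shortWords {m : ℕ} (p : ι) {y : Y} (hy : y ∈ shortWords c E m) :
    E p * y ∈ shortWords c E (m + 1) := by
  obtain ⟨a, ha, b, hb, rfl⟩ := Submodule.mem_sup.1 hy
  rw [mul_add]
  refine add_mem ?_ (Submodule.mem_sup_right (mul_mem_scalarMultiples c _ hb))
  clear hy
  induction ha using Submodule.span_induction with
  | mem x hx =>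
    obtain ⟨l, hl, rfl⟩ := hx
    exact word_mem_shortWords c E (l := p :: l) (by simpa using hl)
  | zero => rw [mul_zero]; exact zero_mem _
  | add x y _ _ hx hy =>
    rw [mul_add]
    exact add_mem hx hy
  | smul r x _ hx =>
    rw [mul_smul_comm]
    exact Submodule.smul_mem _ _ hx

lemma mul_word_mem_shortWords (l : List ι) {y : Y}
    (hy : y ∈ Submodule.span R (Set.range E) ⊔ scalarMultiples c) :
    y * (l.map E).prod ∈ shortWords c E (l.length + 2) := by
  obtain ⟨a, ha, b, hb, rfl⟩ := Submodule.mem_sup.1 hy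
  rw [add_mul]
  refine add_mem ?_ (Submodule.mem_sup_right (scalarMultiples_mul c _ hb))
  clear hy
  induction ha using Submodule.span_induction with
  | mem x hx =>
    obtain ⟨p, rfl⟩ := hx
    exact word_mem_shortWords c E (l := p :: l) (by simp)
  | zero => rw [zero_mul]; exact zero_mem _
  | add x y _ _ hx hy =>
    rw [add_mul]
    exact add_mem hx hy
  | smul r x _ hx =>
    rw [smul_mul_assoc]
    exact Submodule.smul_mem _ _ hx

lemma shortWords_mono {m k : ℕ} (h : m ≤ k) : shortWords c E m ≤ shortWords c E k := by
  refine sup_le_sup_right (Submodule.span_mono ?_) _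
  rintro _ ⟨l, hl, rfl⟩
  exact ⟨l, by omega, rfl⟩

variable (hE : ∀ p q, E p * E q - E q * E p ∈ Submodule.span R (Set.range E) ⊔ scalarMultiples c)
include hE

lemma perm_sub_mem_shortWords {l l' : List ι} (h : l.Perm l') :
    (l.map E).prod - (l'.map E).prod ∈ shortWords c E l.length := by
  induction h with
  | nil => rw [sub_self]; exact zero_mem _
  | cons a _ ih =>
    rw [List.map_cons, List.map_cons, List.prod_cons, List.prod_cons, ← mul_sub]
    exact mul_mem_shortWords c E a ih
  | swap a b l =>
    simp only [List.map_cons, List.prod_cons, ← mul_assoc]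
    rw [← sub_mul]
    exact mul_word_mem_shortWords c E l (hE _ _)
  | trans h₁ _ ih₁ ih₂ =>
    rw [← h₁.length_eq] at ih₂
    simpa using add_mem ih₁ ih₂

variable [LinearOrder ι]

lemma shortWords_le_ordMon (m : ℕ) :
    shortWords c E m ≤ Submodule.span R (Set.range (ordMon E)) ⊔ scalarMultiples c := by
  induction m with
  | zero =>
    refine sup_le_sup_right (Submodule.span_le.2 ?_) _
    rintro _ ⟨l, hl, rfl⟩
    simp at hl
  | succ m ih =>
    refine sup_le (Submodule.span_le.2 ?_) le_sup_right
    rintro _ ⟨l, hl, rfl⟩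
    have hp : l.Perm (l.insertionSort (· ≤ ·)) := (List.perm_insertionSort _ l).symm
    have h := ih (shortWords_mono c E (by omega) (perm_sub_mem_shortWords c E hE hp))
    have h2 : ((l.insertionSort (· ≤ ·)).map E).prod ∈ Submodule.span R (Set.range (ordMon E)) := by
      refine Submodule.subset_span
        ⟨Multiset.toFinsupp (l.insertionSort (· ≤ ·) : Multiset ι), ?_⟩
      rw [ordMon_eq_prod, expand_toFinsupp (List.pairwise_insertionSort _ l)]
    have := add_mem h (Submodule.mem_sup_left h2)
    rwa [sub_add_cancel] at this

/-- If commutators of algebra generators are linear combinations of generators modulo `c`, then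
ordered monomials span modulo `c`. -/
theorem exists_ordMon_add_smul (hgen : Algebra.adjoin R (Set.range E) = ⊤) (y : Y) :
    ∃ m ∈ Submodule.span R (Set.range (ordMon E)), ∃ z : Y, y = m + c • z := by
  have hy : y ∈ Submodule.span R (Set.range (ordMon E)) ⊔ scalarMultiples c := by
    have h1 : y ∈ Subalgebra.toSubmodule (Algebra.adjoin R (Set.range E)) := by
      rw [hgen]; exact Submodule.mem_top
    rw [Algebra.adjoin_eq_span] at h1
    refine Submodule.span_le (R := R) |>.2 ?_ h1
    intro x hx
    obtain ⟨l, hl, rfl⟩ := Submonoid.exists_list_of_mem_closure hx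
    have : ∃ w : List ι, l = w.map E := by
      clear hx
      induction l with
      | nil => exact ⟨[], rfl⟩
      | cons a l ih =>
        obtain ⟨w, rfl⟩ := ih fun y hy => hl y (by simp [hy])
        obtain ⟨p, rfl⟩ := hl a (by simp)
        exact ⟨p :: w, rfl⟩
    obtain ⟨w, rfl⟩ := this
    exact shortWords_le_ordMon c E hE _ (word_mem_shortWords c E (Nat.lt_succ_self _))
  obtain ⟨m, hm, b, hb, rfl⟩ := Submodule.mem_sup.1 hy
  obtain ⟨z, rfl⟩ := (mem_scalarMultiples c).1 hb
  exact ⟨m, hm, z, rfl⟩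

end Straightening

attribute [local instance] LieRing.ofAssociativeRing

/-! ### The classical limit -/

/-- The relations of the classical limit of the positive subalgebra, in a Lie ring. -/
structure ClassRel (n : ℕ) (A : ℕ → ℕ → ℤ) {L : Type} [LieRing L] (x : ℕ → ℕ → L) : Prop where
  zero : ∀ i ∉ Finset.Icc 1 n, ∀ r, x i r = 0
  tor : ∀ y : L, y + y = 0 → y = 0
  tor_three : ∀ y : L, y + y + y = 0 → y = 0
  loop : ∀ i ∈ Finset.Icc 1 n, ∀ j ∈ Finset.Icc 1 n, ∀ r s, ⁅x i (r + 1), x j s⁆ = ⁅x i r, x j (s + 1)⁆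
  serre_one : ∀ i ∈ Finset.Icc 1 n, ∀ j ∈ Finset.Icc 1 n, i ≠ j → A i j = 0 →
    ∀ a b, ⁅x i a, x j b⁆ = 0
  serre_two : ∀ i ∈ Finset.Icc 1 n, ∀ j ∈ Finset.Icc 1 n, A i j = -1 →
    ∀ a b c, ⁅x i a, ⁅x i b, x j c⁆⁆ + ⁅x i b, ⁅x i a, x j c⁆⁆ = 0
  serre_three : ∀ i ∈ Finset.Icc 1 n, ∀ j ∈ Finset.Icc 1 n, A i j = -2 → ∀ a b c d,
    ⁅x i a, ⁅x i b, ⁅x i c, x j d⁆⁆⁆ + ⁅x i a, ⁅x i c, ⁅x i b, x j d⁆⁆⁆ +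
    ⁅x i b, ⁅x i a, ⁅x i c, x j d⁆⁆⁆ + ⁅x i b, ⁅x i c, ⁅x i a, x j d⁆⁆⁆ +
    ⁅x i c, ⁅x i a, ⁅x i b, x j d⁆⁆⁆ + ⁅x i c, ⁅x i b, ⁅x i a, x j d⁆⁆⁆ = 0

/-- Evaluation of a bracketing in a Lie ring. -/
def BrTree.leval {L : Type} [LieRing L] (g : ℕ → ℕ → L) (s : ℕ) : BrTree → L
  | .leaf i f => g i (if f then s else 0)
  | .node a b => ⁅a.leval g s, b.leval g s⁆

lemma BrTree.leval_eq_eval {B : Type} [Ring B] (g : ℕ → ℕ → B) (s : ℕ) (t : BrTree) :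
    t.leval g s = t.eval g s := by
  induction t with
  | leaf i f => rfl
  | node a b iha ihb => rw [BrTree.leval, BrTree.eval, iha, ihb, Ring.lie_def]

/-- The root vectors attached to a family of trees are closed under brackets with generators. -/
def BracketClosed (n : ℕ) (A : ℕ → ℕ → ℤ) {Root : Type} (tr : Root → BrTree) : Prop :=
  ∀ (L : Type) [LieRing L] (x : ℕ → ℕ → L), ClassRel n A x → ∀ k ∈ Finset.Icc 1 n, ∀ r β s,
    ⁅x k r, (tr β).leval x s⁆ ∈ AddSubgroup.closure {y | ∃ β s, (tr β).leval x s = y}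

section Closure
variable {L : Type} [LieRing L] {n : ℕ} {A : ℕ → ℕ → ℤ} {Root : Type} {tr : Root → BrTree}

lemma BracketClosed.lie_mem (h : BracketClosed n A tr) {x : ℕ → ℕ → L} (hx : ClassRel n A x)
    (t : BrTree) (s : ℕ) {z : L}
    (hz : z ∈ AddSubgroup.closure {y | ∃ β s, (tr β).leval x s = y}) :
    ⁅t.leval x s, z⁆ ∈ AddSubgroup.closure {y | ∃ β s, (tr β).leval x s = y} := by
  induction t generalizing z with
  | leaf i f =>
    by_cases hi : i ∈ Finset.Icc 1 n
    · induction hz using AddSubgroup.closure_induction with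
      | mem y hy =>
        obtain ⟨β, s', rfl⟩ := hy
        exact h L x hx i hi _ β s'
      | zero => rw [lie_zero]; exact zero_mem _
      | add y z _ _ hy hz => rw [lie_add]; exact add_mem hy hz
      | neg y _ hy => rw [lie_neg]; exact neg_mem hy
    · rw [BrTree.leval, hx.zero i hi, zero_lie]
      exact zero_mem _
  | node a b iha ihb =>
    rw [BrTree.leval, lie_lie]
    exact sub_mem (iha (ihb hz)) (ihb (iha hz))

end Closure

/-- The two-sided ideal generated by a scalar. -/
def scalarIdeal {R Y : Type} [CommRing R] [Ring Y] [Algebra R Y] (c : R) : Ideal Y where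
  carrier := {y | ∃ z : Y, c • z = y}
  add_mem' := by
    rintro _ _ ⟨a, rfl⟩ ⟨b, rfl⟩
    exact ⟨a + b, smul_add _ _ _⟩
  zero_mem' := ⟨0, smul_zero _⟩
  smul_mem' := by
    rintro a _ ⟨b, rfl⟩
    exact ⟨a * b, by rw [smul_eq_mul, mul_smul_comm]⟩

instance {R Y : Type} [CommRing R] [Ring Y] [Algebra R Y] (c : R) :
    (scalarIdeal c : Ideal Y).IsTwoSided where
  mul_mem_of_left := by
    rintro _ b ⟨z, rfl⟩
    exact ⟨z * b, (smul_mul_assoc _ _ _).symm⟩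

section Limit
variable {n : ℕ} {A : ℕ → ℕ → ℤ} {Dd : ℕ → ℕ} {Y : Type} [Ring Y] [Algebra RH Y]

lemma eq_zero_of_nsmul_eq_zero (m : ℕ) (hm : m ≠ 0) (y : Y ⧸ (scalarIdeal hbar : Ideal Y))
    (h : m • y = 0) : y = 0 := by
  obtain ⟨z, rfl⟩ := Ideal.Quotient.mk_surjective y
  rw [← map_nsmul, Ideal.Quotient.eq_zero_iff_mem] at h
  rw [Ideal.Quotient.eq_zero_iff_mem]
  obtain ⟨w, hw⟩ := h
  refine ⟨(Polynomial.C ((m : ℚ)⁻¹) : RH) • w, ?_⟩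
  rw [smul_comm, hw, ← Nat.cast_smul_eq_nsmul RH, smul_smul, ← Polynomial.C_eq_natCast,
    ← Polynomial.C_mul, inv_mul_cancel₀ (by exact_mod_cast hm), Polynomial.C_1, one_smul]

/-- The images modulo `ħ` of a family. -/
def limitGen (g : ℕ → ℕ → Y) (i r : ℕ) : Y ⧸ (scalarIdeal hbar : Ideal Y) :=
  Ideal.Quotient.mk _ (g i r)

lemma classRel_limitGen (hA : CartanLike n A Dd) (g : ℕ → ℕ → Y)
    (hzero : ∀ i ∉ Finset.Icc 1 n, ∀ r, g i r = 0)
    (hloop : ∀ i ∈ Finset.Icc 1 n, ∀ j ∈ Finset.Icc 1 n, ∀ r s, ∃ z,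
      ⁅g i (r + 1), g j s⁆ - ⁅g i r, g j (s + 1)⁆ = hbar • z)
    (hserre : ∀ i ∈ Finset.Icc 1 n, ∀ j ∈ Finset.Icc 1 n, i ≠ j →
      ∀ (ss : Fin (1 - A i j).toNat → ℕ) (r : ℕ), serreSum (g i) (g j r) _ ss = 0) :
    ClassRel n A (limitGen g) := by
  have hs : ∀ i ∈ Finset.Icc 1 n, ∀ j ∈ Finset.Icc 1 n, i ≠ j → ∀ m, (1 - A i j).toNat = m →
      ∀ (ss : Fin m → ℕ) (r : ℕ), serreSum (limitGen g i) (limitGen g j r) m ss = 0 := by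
    rintro i hi j hj hij _ rfl ss r
    have := congrArg (Ideal.Quotient.mk (scalarIdeal hbar : Ideal Y)) (hserre i hi j hj hij ss r)
    rw [map_serreSum, map_zero] at this
    exact this
  have hne : ∀ i j, A i j ≠ 2 → i ≠ j := by
    rintro i _ h rfl
    exact h (hA.diag i)
  refine ⟨?_, ?_, ?_, ?_, ?_, ?_, ?_⟩
  · intro i hi r
    rw [limitGen, hzero i hi, map_zero]
  · intro y hy
    exact eq_zero_of_nsmul_eq_zero 2 two_ne_zero y (by rw [two_nsmul, hy])
  · intro y hy
    exact eq_zero_of_nsmul_eq_zero 3 three_ne_zero y (by rw [← hy]; abel)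
  · intro i hi j hj r s
    obtain ⟨z, hz⟩ := hloop i hi j hj r s
    rw [← sub_eq_zero]
    simp only [limitGen, Ring.lie_def, ← map_mul, ← map_sub]
    rw [Ideal.Quotient.eq_zero_iff_mem]
    exact ⟨z, hz.symm⟩
  · intro i hi j hj hij h a b
    have := hs i hi j hj hij 1 (by rw [h]; rfl) ![a] b
    rwa [serreSum_one] at this
  · intro i hi j hj h a b c
    have := hs i hi j hj (hne i j (by omega)) 2 (by rw [h]; rfl) ![a, b] c
    rwa [serreSum_two] at this
  · intro i hi j hj h a b c d
    have := hs i hi j hj (hne i j (by omega)) 3 (by rw [h]; rfl) ![a, b, c] d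
    rwa [serreSum_three] at this

variable {Root : Type} {tr : Root → BrTree}

lemma BracketClosed.commutator_mem (h : BracketClosed n A tr) (g : ℕ → ℕ → Y)
    (hg : ClassRel n A (limitGen g)) (β γ : Root) (s t : ℕ) :
    (tr β).eval g s * (tr γ).eval g t - (tr γ).eval g t * (tr β).eval g s ∈
      Submodule.span RH (Set.range fun p : Lex (Root × ℕ) =>
        (tr (ofLex p).1).eval g (ofLex p).2) ⊔ scalarMultiples hbar := by
  set φ := Ideal.Quotient.mk (scalarIdeal hbar : Ideal Y)
  have hφ : ∀ (τ : BrTree) u, τ.leval (limitGen g) u = φ (τ.eval g u) := by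
    intro τ u
    rw [BrTree.leval_eq_eval, BrTree.map_eval]
    rfl
  have hmem := h.lie_mem hg (tr β) s (z := (tr γ).leval (limitGen g) t)
    (AddSubgroup.subset_closure ⟨γ, t, rfl⟩)
  have hset : {y | ∃ β s, (tr β).leval (limitGen g) s = y} =
      (φ : Y →+ _) '' Set.range fun p : Lex (Root × ℕ) => (tr (ofLex p).1).eval g (ofLex p).2 := by
    ext y
    constructor
    · rintro ⟨β, s, rfl⟩
      exact ⟨_, ⟨toLex (β, s), rfl⟩, (hφ _ _).symm⟩
    · rintro ⟨_, ⟨p, rfl⟩, rfl⟩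
      exact ⟨_, _, hφ _ _⟩
  rw [hset, ← AddMonoidHom.map_closure, hφ, hφ, Ring.lie_def] at hmem
  obtain ⟨m, hm, hm2⟩ := hmem
  have hm' : m ∈ Submodule.span RH (Set.range fun p : Lex (Root × ℕ) =>
      (tr (ofLex p).1).eval g (ofLex p).2) := by
    clear hm2
    induction hm using AddSubgroup.closure_induction with
    | mem y hy => exact Submodule.subset_span hy
    | zero => exact zero_mem _
    | add y z _ _ hy hz => exact add_mem hy hz
    | neg y _ hy => exact neg_mem hy
  have hd : (tr β).eval g s * (tr γ).eval g t - (tr γ).eval g t * (tr β).eval g s - m ∈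
      (scalarIdeal hbar : Ideal Y) := by
    rw [← Ideal.Quotient.eq_zero_iff_mem]
    rw [map_sub, map_sub, map_mul, map_mul, sub_eq_zero]
    exact hm2.symm
  obtain ⟨z, hz⟩ := hd
  rw [← sub_add_cancel ((tr β).eval g s * (tr γ).eval g t - _) m, ← hz, add_comm]
  exact add_mem (Submodule.mem_sup_left hm')
    (Submodule.mem_sup_right ((mem_scalarMultiples _).2 ⟨z, rfl⟩))

end Limit

section Spanning
variable {n : ℕ} {A : ℕ → ℕ → ℤ} {Dd : ℕ → ℕ}

lemma gy1_eq {i : ℕ} (hi : i ∈ Finset.Icc 1 n) :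
    ∃ k : Fin n, k.1 + 1 = i ∧ gy1 n A Dd i = yg n A Dd k := by
  have h := Finset.mem_Icc.1 hi
  refine ⟨⟨i - 1, by omega⟩, by simp; omega, ?_⟩
  funext r
  rw [gy1, dif_pos h]

lemma gy1_eq_zero {i : ℕ} (hi : i ∉ Finset.Icc 1 n) (r : ℕ) : gy1 n A Dd i r = 0 := by
  rw [Finset.mem_Icc] at hi
  rw [gy1, dif_neg hi]

lemma adjoin_eq_top_of_gy1_mem (S : Subalgebra RH (YA n A Dd))
    (h : ∀ i ∈ Finset.Icc 1 n, ∀ r, gy1 n A Dd i r ∈ S) : S = ⊤ := by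
  rw [eq_top_iff]
  intro y hy
  clear hy
  obtain ⟨f, rfl⟩ := RingQuot.mkAlgHom_surjective RH (YRel n A Dd) y
  induction f using FreeAlgebra.induction with
  | grade0 c => rw [AlgHom.commutes]; exact S.algebraMap_mem c
  | grade1 p =>
    have := h (p.1.1 + 1) (Finset.mem_Icc.2 ⟨by omega, by omega⟩) p.2
    rwa [gy1, dif_pos ⟨by omega, by omega⟩] at this
  | mul a b ha hb => rw [map_mul]; exact S.mul_mem ha hb
  | add a b ha hb => rw [map_add]; exact S.add_mem ha hb

variable {Root : Type} [LinearOrder Root] {tr : Root → BrTree}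

/-- Ordered monomials in root vectors span the Yangian as soon as the root vectors are closed under
brackets in the classical limit. -/
theorem span_ordMon_eq_top (hA : CartanLike n A Dd)
    (hsimple : ∀ k ∈ Finset.Icc 1 n, ∃ β, tr β = .leaf k true) (hcl : BracketClosed n A tr) :
    Submodule.span RH (Set.range fun h : Lex (Root × ℕ) →₀ ℕ =>
      ordMon (fun p => (tr (ofLex p).1).eval (gy1 n A Dd) (ofLex p).2) h) = ⊤ := by
  have hlim : ClassRel n A (limitGen (gy1 n A Dd)) := by
    refine classRel_limitGen hA _ (fun i hi r => gy1_eq_zero hi r) ?_ ?_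
    · intro i hi j hj r s
      obtain ⟨a, -, ha⟩ := gy1_eq (A := A) (Dd := Dd) hi
      obtain ⟨b, -, hb⟩ := gy1_eq (A := A) (Dd := Dd) hj
      rw [ha, hb]
      refine ⟨(Polynomial.C (halfForm A Dd (a.1 + 1) (b.1 + 1)) : RH) •
        (yg n A Dd a r * yg n A Dd b s + yg n A Dd b s * yg n A Dd a r),
        (yg_loop a b r s).trans ?_⟩
      rw [mul_comm, mul_smul]
    · intro i hi j hj hij ss r
      obtain ⟨a, rfl, ha⟩ := gy1_eq (A := A) (Dd := Dd) hi
      obtain ⟨b, rfl, hb⟩ := gy1_eq (A := A) (Dd := Dd) hj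
      rw [ha, hb]
      exact yg_serre a b (by rintro rfl; exact hij rfl) ss r
  refine span_eq_top_of_span_sup (isGrading_yangianGrading n A Dd) ?_ ?_
  · rintro _ ⟨h, rfl⟩ d
    dsimp only
    rw [ordMon_eq_prod]
    obtain ⟨e, he⟩ := isHomog_list_prod (δ := yangianGrading n A Dd)
      (l := (expand h).map fun p => (tr (ofLex p).1).eval (gy1 n A Dd) (ofLex p).2) (by
        intro y hy
        obtain ⟨p, -, rfl⟩ := List.mem_map.1 hy
        exact ⟨_, isHomog_eval (isHomog_gy1 n A Dd) _ _⟩)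
    exact he.gradedPart d
  · refine exists_ordMon_add_smul hbar _ (fun p q => hcl.commutator_mem _ hlim _ _ _ _) ?_
    refine adjoin_eq_top_of_gy1_mem _ fun i hi r => Algebra.subset_adjoin ?_
    obtain ⟨β, hβ⟩ := hsimple i hi
    exact ⟨toLex (β, r), by simp [hβ, BrTree.eval]⟩

end Spanning

/-! ### Root vectors of type `A` in the classical limit -/

section TypeA
variable {L : Type} [LieRing L]

lemma lie_eq_zero_comm {u v : L} (h : ⁅u, v⁆ = 0) : ⁅v, u⁆ = 0 := by
  rw [← lie_skew, h, neg_zero]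

lemma lie_lie_eq_zero {u v w : L} (h₁ : ⁅u, v⁆ = 0) (h₂ : ⁅u, w⁆ = 0) : ⁅u, ⁅v, w⁆⁆ = 0 := by
  rw [leibniz_lie, h₁, h₂, zero_lie, lie_zero, add_zero]

lemma lie_swap {u v : L} (h : ⁅u, v⁆ = 0) (w : L) : ⁅u, ⁅v, w⁆⁆ = ⁅v, ⁅u, w⁆⁆ := by
  rw [leibniz_lie, h, zero_lie, zero_add]

lemma lie_assoc_of_lie_eq_zero {u w : L} (h : ⁅u, w⁆ = 0) (v : L) : ⁅⁅u, v⁆, w⁆ = ⁅u, ⁅v, w⁆⁆ := by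
  rw [lie_lie, h, lie_zero, sub_zero]

/-- Relations of type `A` for the nodes below `m`. -/
structure PathRel (m : ℕ) (y : ℕ → ℕ → L) : Prop where
  tor : ∀ u : L, u + u = 0 → u = 0
  self : ∀ i < m, ∀ a b, ⁅y i a, y i b⁆ = 0
  far : ∀ i j, i + 1 < j → j < m → ∀ a b, ⁅y i a, y j b⁆ = 0
  dep : ∀ i, i + 1 < m → ∀ a b, ⁅y i a, y (i + 1) b⁆ = ⁅y i (a + b), y (i + 1) 0⁆
  up : ∀ i, i + 1 < m → ∀ a b c, ⁅y i a, ⁅y i b, y (i + 1) c⁆⁆ = 0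
  down : ∀ i, i + 1 < m → ∀ a b c, ⁅y (i + 1) a, ⁅y i b, y (i + 1) c⁆⁆ = 0

/-- The root vector of the segment `[i, i + l]`. -/
def segVec (y : ℕ → ℕ → L) (i : ℕ) : ℕ → ℕ → L
  | 0, s => y i s
  | l + 1, s => ⁅segVec y i l s, y (i + l + 1) 0⁆

namespace PathRel
variable {m : ℕ} {y : ℕ → ℕ → L} (h : PathRel m y)
include h

lemma lie_segVec_of_lt {k i l : ℕ} (hk : k + 1 < i) (hl : i + l < m) (r s : ℕ) :
    ⁅y k r, segVec y i l s⁆ = 0 := by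
  induction l with
  | zero => exact h.far k i hk hl r s
  | succ l ih =>
    exact lie_lie_eq_zero (ih (by omega)) (h.far k _ (by omega) hl r 0)

lemma lie_segVec_of_gt {k i l : ℕ} (hl : i + l + 1 < k) (hk : k < m) (r s : ℕ) :
    ⁅y k r, segVec y i l s⁆ = 0 := by
  induction l with
  | zero => exact lie_eq_zero_comm (h.far i k hl hk s r)
  | succ l ih =>
    exact lie_lie_eq_zero (ih (by omega)) (lie_eq_zero_comm (h.far _ k (by omega) hk 0 r))

lemma segVec_lie {i l : ℕ} (hl : i + l + 1 < m) (r s : ℕ) :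
    ⁅segVec y i l r, y (i + l + 1) s⁆ = segVec y i (l + 1) (r + s) := by
  induction l generalizing r s with
  | zero => exact h.dep i hl r s
  | succ l ih =>
    have hz : ∀ t, ⁅segVec y i l t, y (i + l + 1 + 1) s⁆ = 0 := fun t =>
      lie_eq_zero_comm (h.lie_segVec_of_gt (by omega) (by omega) _ _)
    have hz' : ∀ t, ⁅segVec y i l t, y (i + l + 1 + 1) 0⁆ = 0 := fun t =>
      lie_eq_zero_comm (h.lie_segVec_of_gt (by omega) (by omega) _ _)
    change ⁅⁅segVec y i l r, y (i + l + 1) 0⁆, y (i + l + 1 + 1) s⁆ =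
      ⁅segVec y i (l + 1) (r + s), y (i + l + 1 + 1) 0⁆
    rw [lie_assoc_of_lie_eq_zero (hz r), h.dep _ (by omega), zero_add, ← ih (by omega),
      lie_assoc_of_lie_eq_zero (hz' r)]

lemma lie_segVec_succ {k l : ℕ} (hl : k + 1 + l < m) (r s : ℕ) :
    ⁅y k r, segVec y (k + 1) l s⁆ = segVec y k (l + 1) (r + s) := by
  induction l with
  | zero => exact h.dep k hl r s
  | succ l ih =>
    change ⁅y k r, ⁅segVec y (k + 1) l s, y (k + 1 + l + 1) 0⁆⁆ =
      ⁅segVec y k (l + 1) (r + s), y (k + (l + 1) + 1) 0⁆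
    rw [leibniz_lie, ih (by omega), h.far k (k + 1 + l + 1) (by omega) (by omega), lie_zero,
      add_zero, show k + 1 + l + 1 = k + (l + 1) + 1 by omega]

lemma lie_segVec_left {i l : ℕ} (hl : i + l < m) (r s : ℕ) : ⁅y i r, segVec y i l s⁆ = 0 := by
  induction l with
  | zero => exact h.self i hl r s
  | succ l ih =>
    cases l with
    | zero => exact h.up i hl r s 0
    | succ l => exact lie_lie_eq_zero (ih (by omega)) (h.far _ _ (by omega) (by omega) _ _)

lemma lie_segVec_right {i l : ℕ} (hl : i + l + 1 < m) (r s : ℕ) :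
    ⁅y (i + l + 1) r, segVec y i (l + 1) s⁆ = 0 := by
  cases l with
  | zero => exact h.down i hl r s 0
  | succ l =>
    have hz : ∀ t, ⁅y (i + l + 1 + 1) t, segVec y i l s⁆ = 0 := fun t =>
      h.lie_segVec_of_gt (by omega) (by omega) _ _
    change ⁅y (i + l + 1 + 1) r, ⁅⁅segVec y i l s, y (i + l + 1) 0⁆, y (i + l + 1 + 1) 0⁆⁆ = 0
    rw [lie_assoc_of_lie_eq_zero (lie_eq_zero_comm (hz 0))]
    exact lie_lie_eq_zero (hz r) (h.down _ hl _ _ _)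

lemma lie_segVec_penultimate {i l : ℕ} (hl : i + l + 2 < m) (r s : ℕ) :
    ⁅y (i + l + 1) r, segVec y i (l + 2) s⁆ = 0 := by
  have key : ∀ r s, ⁅y (i + l + 1) r, segVec y i (l + 2) s⁆ =
      - ⁅y (i + l + 1) 0, segVec y i (l + 2) (r + s)⁆ := by
    intro r s
    have hz : ⁅segVec y i l s, y (i + l + 1 + 1) 0⁆ = 0 :=
      lie_eq_zero_comm (h.lie_segVec_of_gt (by omega) (by omega) _ _)
    calc ⁅y (i + l + 1) r, segVec y i (l + 2) s⁆
        = ⁅segVec y i (l + 1) s, ⁅y (i + l + 1) r, y (i + l + 1 + 1) 0⁆⁆ := by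
          change ⁅y (i + l + 1) r, ⁅segVec y i (l + 1) s, y (i + l + 1 + 1) 0⁆⁆ = _
          exact lie_swap (h.lie_segVec_right (by omega) r s) _
      _ = -⁅y (i + l + 1) 0, ⁅⁅segVec y i l s, y (i + l + 1) r⁆, y (i + l + 1 + 1) 0⁆⁆ := by
          change ⁅⁅segVec y i l s, y (i + l + 1) 0⁆, ⁅y (i + l + 1) r, y (i + l + 1 + 1) 0⁆⁆ = _
          rw [lie_lie, h.up _ (by omega), lie_zero, zero_sub, lie_assoc_of_lie_eq_zero hz]
      _ = _ := by
          rw [h.segVec_lie (by omega), add_comm s r]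
          rfl
  have h0 : ∀ s, ⁅y (i + l + 1) 0, segVec y i (l + 2) s⁆ = 0 := by
    intro s
    refine h.tor _ ?_
    nth_rw 1 [key 0 s]
    rw [zero_add, neg_add_cancel]
  rw [key, h0, neg_zero]

lemma lie_segVec_mem {i k l : ℕ} (hik : i ≤ k) (hk : k ≤ i + l) (hl : i + l < m) (r s : ℕ) :
    ⁅y k r, segVec y i l s⁆ = 0 := by
  rcases hik.eq_or_lt with rfl | hik
  · exact h.lie_segVec_left hl r s
  obtain ⟨d, rfl⟩ := Nat.exists_eq_add_of_lt hik
  rcases hk.eq_or_lt with hk' | hk'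
  · obtain rfl : l = d + 1 := by omega
    exact h.lie_segVec_right hl r s
  obtain ⟨e, rfl⟩ : ∃ e, l = d + 2 + e := ⟨l - (d + 2), by omega⟩
  clear hk hk'
  induction e with
  | zero => exact h.lie_segVec_penultimate hl r s
  | succ e ih =>
    exact lie_lie_eq_zero (ih (by omega))
      (h.far _ (i + (d + 2 + e) + 1) (by omega) (by omega) _ _)

/-- Generators below `m` map segments to segments. -/
lemma lie_segVec_cases {k i l : ℕ} (hk : k < m) (hl : i + l < m) (r s : ℕ) :
    ⁅y k r, segVec y i l s⁆ = 0 ∨ (k + 1 = i ∧ ⁅y k r, segVec y i l s⁆ = segVec y k (l + 1) (r + s)) ∨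
      (k = i + l + 1 ∧ ⁅y k r, segVec y i l s⁆ = -segVec y i (l + 1) (s + r)) := by
  rcases lt_trichotomy (k + 1) i with h1 | h1 | h1
  · exact Or.inl (h.lie_segVec_of_lt h1 hl r s)
  · subst h1
    exact Or.inr (Or.inl ⟨rfl, h.lie_segVec_succ hl r s⟩)
  rcases lt_trichotomy k (i + l + 1) with h2 | h2 | h2
  · exact Or.inl (h.lie_segVec_mem (by omega) (by omega) hl r s)
  · subst h2
    exact Or.inr (Or.inr ⟨rfl, by rw [← h.segVec_lie hk, lie_skew]⟩)
  · exact Or.inl (h.lie_segVec_of_gt h2 hk r s)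

end PathRel

/-- The root vector of the segment `[i, m - 1]`. -/
def tailVec (m : ℕ) (y : ℕ → ℕ → L) (i s : ℕ) : L := segVec y i (m - 1 - i) s

namespace PathRel
variable {m : ℕ} {y : ℕ → ℕ → L} (h : PathRel m y)
include h

lemma lie_tailVec_succ {k : ℕ} (hk : k + 1 < m) (r s : ℕ) :
    ⁅y k r, tailVec m y (k + 1) s⁆ = tailVec m y k (r + s) := by
  rw [tailVec, tailVec, h.lie_segVec_succ (by omega),
    show m - 1 - (k + 1) + 1 = m - 1 - k by omega]

lemma lie_tailVec {k i : ℕ} (hk : k < m) (hi : i < m) (hki : i ≠ k + 1) (r s : ℕ) :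
    ⁅y k r, tailVec m y i s⁆ = 0 := by
  rcases lt_or_ge k i with h1 | h1
  · exact h.lie_segVec_of_lt (by omega) (by omega) r s
  · exact h.lie_segVec_mem h1 (by omega) (by omega) r s

omit h in
lemma tailVec_last (s : ℕ) : tailVec m y (m - 1) s = y (m - 1) s := by
  rw [tailVec, Nat.sub_self]
  rfl

lemma tailVec_eq {k : ℕ} (hk : k + 1 < m) (s : ℕ) :
    tailVec m y k s = ⁅y k 0, tailVec m y (k + 1) s⁆ := by
  rw [h.lie_tailVec_succ hk, zero_add]

lemma tailVec_comm {i j : ℕ} (hi : i < m) (hj : j < m) (r s : ℕ) :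
    ⁅tailVec m y i r, tailVec m y j s⁆ = 0 := by
  have key : ∀ i j, i ≤ j → j < m → ∀ r s, ⁅tailVec m y i r, tailVec m y j s⁆ = 0 := by
    intro i j hij hj
    obtain ⟨d, rfl⟩ : ∃ d, j = m - 1 - d := ⟨m - 1 - j, by omega⟩
    induction d with
    | zero =>
      intro r s
      rw [Nat.sub_zero, tailVec_last]
      exact lie_eq_zero_comm (h.lie_tailVec (by omega) (by omega) (by omega) _ _)
    | succ d ih =>
      intro r s
      rcases Nat.lt_or_ge d (m - 1) with hd | hd
      · rw [h.tailVec_eq (k := m - 1 - (d + 1)) (by omega),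
          show m - 1 - (d + 1) + 1 = m - 1 - d by omega]
        exact lie_lie_eq_zero
          (lie_eq_zero_comm (h.lie_tailVec (by omega) (by omega) (by omega) _ _))
          (ih (by omega) (by omega) r s)
      · have := ih (by omega) (by omega) r s
        rwa [show m - 1 - (d + 1) = m - 1 - d by omega]
  rcases le_total i j with hij | hij
  · exact key i j hij hj r s
  · exact lie_eq_zero_comm (key j i hij hi s r)

end PathRel
end TypeA

/-! ### Consequences of the classical relations -/

lemma down_induction {m : ℕ} {P : ℕ → Prop} (h0 : P m) (hs : ∀ i < m, P (i + 1) → P i) :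
    ∀ i ≤ m, P i := by
  intro i hi
  induction hi using Nat.decreasingInduction with
  | of_succ k hk ih => exact hs k hk ih
  | self => exact h0

namespace ClassRel
variable {L : Type} [LieRing L] {n : ℕ} {A : ℕ → ℕ → ℤ} {x : ℕ → ℕ → L} (hx : ClassRel n A x)
include hx

lemma dep {i j : ℕ} (hi : i ∈ Finset.Icc 1 n) (hj : j ∈ Finset.Icc 1 n) (a b : ℕ) :
    ⁅x i a, x j b⁆ = ⁅x i (a + b), x j 0⁆ := by
  induction b generalizing a with
  | zero => rfl
  | succ b ih => rw [← hx.loop i hi j hj, ih, show a + 1 + b = a + (b + 1) by omega]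

lemma self {i : ℕ} (hi : i ∈ Finset.Icc 1 n) (a b : ℕ) : ⁅x i a, x i b⁆ = 0 := by
  refine hx.tor _ ?_
  nth_rw 2 [← lie_skew]
  rw [hx.dep hi hi, hx.dep hi hi b a, add_comm b a, add_neg_cancel]

lemma serre_two' {i j : ℕ} (hi : i ∈ Finset.Icc 1 n) (hj : j ∈ Finset.Icc 1 n) (h : A i j = -1)
    (a b c : ℕ) : ⁅x i a, ⁅x i b, x j c⁆⁆ = 0 := by
  refine hx.tor _ ?_
  nth_rw 2 [lie_swap (hx.self hi a b)]
  exact hx.serre_two i hi j hj h a b c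

lemma serre_three' {i j : ℕ} (hi : i ∈ Finset.Icc 1 n) (hj : j ∈ Finset.Icc 1 n) (h : A i j = -2)
    (a b c d : ℕ) : ⁅x i a, ⁅x i b, ⁅x i c, x j d⁆⁆⁆ = 0 := by
  have key := hx.serre_three i hi j hj h a b c d
  have sw := fun p q (w : L) => lie_swap (hx.self hi p q) w
  rw [sw c b, sw b a, sw c a, sw b a, sw c a, sw b a, sw c b, sw c a, sw c b] at key
  refine hx.tor_three _ (hx.tor _ ?_)
  rw [← key]
  abel

lemma pathRel (σ : ℕ → ℕ) {m : ℕ} (h0 : σ 0 = 0)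
    (hmem : ∀ i < m, 0 < i → σ i ∈ Finset.Icc 1 n)
    (hfar : ∀ i j, 0 < i → i + 1 < j → j < m → σ i ≠ σ j ∧ A (σ i) (σ j) = 0)
    (hadj : ∀ i, 0 < i → i + 1 < m → A (σ i) (σ (i + 1)) = -1 ∧ A (σ (i + 1)) (σ i) = -1) :
    PathRel m fun i => x (σ i) := by
  have hz : ∀ r, x (σ 0) r = 0 := fun r => hx.zero _ (by simp [h0]) r
  refine ⟨hx.tor, ?_, ?_, ?_, ?_, ?_⟩
  · intro i hi a b
    rcases Nat.eq_zero_or_pos i with rfl | h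
    · rw [hz, zero_lie]
    · exact hx.self (hmem i hi h) a b
  · intro i j hij hj a b
    rcases Nat.eq_zero_or_pos i with rfl | h
    · rw [hz, zero_lie]
    · exact hx.serre_one _ (hmem i (by omega) h) _ (hmem j hj (by omega)) (hfar i j h hij hj).1
        (hfar i j h hij hj).2 a b
  · intro i hi a b
    rcases Nat.eq_zero_or_pos i with rfl | h
    · rw [hz, hz, zero_lie, zero_lie]
    · exact hx.dep (hmem i (by omega) h) (hmem _ hi (by omega)) a b
  · intro i hi a b c
    rcases Nat.eq_zero_or_pos i with rfl | h
    · rw [hz, zero_lie]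
    · exact hx.serre_two' (hmem i (by omega) h) (hmem _ hi (by omega)) (hadj i h hi).1 a b c
  · intro i hi a b c
    rcases Nat.eq_zero_or_pos i with rfl | h
    · rw [hz, zero_lie, lie_zero]
    · rw [← lie_skew (x (σ i) b), lie_neg,
        hx.serre_two' (hmem _ hi (by omega)) (hmem i (by omega) h) (hadj i h hi).2, neg_zero]

end ClassRel

/-! ### Root vectors of type `C` in the classical limit -/

section TypeC
variable {L : Type} [LieRing L]

/-- Relations of type `C` with short nodes `y i`, `i ≤ m`, and long node `z`. -/
structure TypeCRel (m : ℕ) (y : ℕ → ℕ → L) (z : ℕ → L) : Prop where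
  path : PathRel (m + 1) y
  tor_three : ∀ u : L, u + u + u = 0 → u = 0
  far : ∀ k < m, ∀ a b, ⁅y k a, z b⁆ = 0
  self : ∀ a b, ⁅z a, z b⁆ = 0
  dep : ∀ a b, ⁅y m a, z b⁆ = ⁅y m (a + b), z 0⁆
  up : ∀ a b c d, ⁅y m a, ⁅y m b, ⁅y m c, z d⁆⁆⁆ = 0
  down : ∀ a b c, ⁅z a, ⁅y m b, z c⁆⁆ = 0

/-- The root vector of `[i, n]`. -/
def longVec (m : ℕ) (y : ℕ → ℕ → L) (z : ℕ → L) (i s : ℕ) : L := ⁅tailVec (m + 1) y i s, z 0⁆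

/-- The root vector of `[i, n, j]`. -/
def foldVec (m : ℕ) (y : ℕ → ℕ → L) (z : ℕ → L) (i j s : ℕ) : L :=
  ⁅tailVec (m + 1) y i 0, longVec m y z j s⁆

namespace TypeCRel
variable {m : ℕ} {y : ℕ → ℕ → L} {z : ℕ → L} (h : TypeCRel m y z)
include h

omit h in
lemma tail_self (s : ℕ) : tailVec (m + 1) y m s = y m s := PathRel.tailVec_last s

lemma tail_lie {i : ℕ} (hi : i ≤ m) (r s : ℕ) :
    ⁅tailVec (m + 1) y i r, z s⁆ = longVec m y z i (r + s) := by
  refine down_induction (P := fun i => ∀ r, ⁅tailVec (m + 1) y i r, z s⁆ = longVec m y z i (r + s))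
    ?_ ?_ i hi r
  · intro r
    rw [longVec, tail_self, tail_self, h.dep]
  · intro i hi ih r
    rw [longVec, h.path.tailVec_eq (k := i) (by omega), h.path.tailVec_eq (k := i) (by omega),
      lie_assoc_of_lie_eq_zero (h.far i hi 0 s), ih,
      lie_assoc_of_lie_eq_zero (h.far i hi 0 0), longVec]

lemma lie_long {k i : ℕ} (hk : k < m) (hi : i ≤ m) (r s : ℕ) :
    ⁅y k r, longVec m y z i s⁆ = if i = k + 1 then longVec m y z k (r + s) else 0 := by
  rw [longVec, leibniz_lie, h.far k hk, lie_zero, add_zero]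
  split_ifs with hik
  · subst hik
    rw [h.path.lie_tailVec_succ (by omega), longVec]
  · rw [h.path.lie_tailVec (by omega) (by omega) hik, zero_lie]

lemma tail_long {i j : ℕ} (hi : i ≤ m) (hj : j ≤ m) (r p q : ℕ) :
    ⁅tailVec (m + 1) y i r, longVec m y z j (p + q)⁆ =
      ⁅tailVec (m + 1) y j p, longVec m y z i (r + q)⁆ := by
  rw [← h.tail_lie hj, lie_swap (h.path.tailVec_comm (by omega) (by omega) r p), h.tail_lie hi]

lemma fold_comm {i j : ℕ} (hi : i ≤ m) (hj : j ≤ m) (s : ℕ) :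
    foldVec m y z i j s = foldVec m y z j i s := by
  have := h.tail_long hi hj 0 0 s
  rwa [zero_add] at this

lemma tail_long_eq {i j : ℕ} (hi : i ≤ m) (hj : j ≤ m) (r s : ℕ) :
    ⁅tailVec (m + 1) y i r, longVec m y z j s⁆ = foldVec m y z i j (r + s) := by
  have := h.tail_long hi hj r 0 s
  rw [zero_add] at this
  rw [this, h.fold_comm hi hj, foldVec]

lemma last_long {i : ℕ} (hi : i ≤ m) (r s : ℕ) :
    ⁅y m r, longVec m y z i s⁆ = foldVec m y z m i (r + s) := by
  rw [← tail_self (m := m) (y := y), h.tail_long_eq le_rfl hi]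

lemma lie_fold {k i j : ℕ} (hk : k < m) (hi : i ≤ m) (hj : j ≤ m) (r s : ℕ) :
    ⁅y k r, foldVec m y z i j s⁆ = (if i = k + 1 then foldVec m y z k j (r + s) else 0) +
      if j = k + 1 then foldVec m y z i k (r + s) else 0 := by
  rw [foldVec, leibniz_lie, h.lie_long hk hj]
  congr 1
  · split_ifs with hik
    · subst hik
      rw [h.path.lie_tailVec_succ (by omega), h.tail_long_eq (by omega) hj, add_zero]
    · rw [h.path.lie_tailVec (by omega) (by omega) hik, zero_lie]
  · split_ifs
    · rfl
    · exact lie_zero _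

lemma tail_fold {k i j : ℕ} (hk : k ≤ m) (hi : i ≤ m) (hj : j ≤ m) (p t : ℕ) :
    ⁅tailVec (m + 1) y k p, foldVec m y z i j t⁆ =
      ⁅tailVec (m + 1) y i 0, foldVec m y z k j (p + t)⁆ := by
  rw [foldVec, lie_swap (h.path.tailVec_comm (by omega) (by omega) p 0), h.tail_long_eq hk hj]

lemma lie_triple {q k i j : ℕ} (hq : q < m) (hk : k ≤ m) (hi : i ≤ m) (hj : j ≤ m)
    (h0 : ∀ t, ⁅tailVec (m + 1) y k 0, foldVec m y z i j t⁆ = 0) (t : ℕ) :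
    (if k = q + 1 then ⁅tailVec (m + 1) y q 0, foldVec m y z i j t⁆ else 0) +
    ((if i = q + 1 then ⁅tailVec (m + 1) y k 0, foldVec m y z q j t⁆ else 0) +
      if j = q + 1 then ⁅tailVec (m + 1) y k 0, foldVec m y z i q t⁆ else 0) = 0 := by
  have key : ⁅y q 0, ⁅tailVec (m + 1) y k 0, foldVec m y z i j t⁆⁆ = 0 := by rw [h0, lie_zero]
  rw [leibniz_lie, h.lie_fold hq hi hj, zero_add, lie_add] at key
  refine (congrArg₂ (· + ·) ?_ (congrArg₂ (· + ·) ?_ ?_)).trans key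
  · split_ifs with hkq
    · subst hkq
      rw [h.path.lie_tailVec_succ (by omega)]
    · rw [h.path.lie_tailVec (by omega) (by omega) hkq, zero_lie]
  · split_ifs <;> simp
  · split_ifs <;> simp

lemma tail_fold_zero {k i j : ℕ} (hk : k ≤ m) (hi : i ≤ m) (hj : j ≤ m) (t : ℕ) :
    ⁅tailVec (m + 1) y k 0, foldVec m y z i j t⁆ = 0 := by
  have sw : ∀ {k i j : ℕ}, k ≤ m → i ≤ m → j ≤ m → ∀ t,
      ⁅tailVec (m + 1) y k 0, foldVec m y z i j t⁆ =
        ⁅tailVec (m + 1) y i 0, foldVec m y z k j t⁆ := by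
    intro k i j hk hi hj t
    rw [h.tail_fold hk hi hj, zero_add]
  have step₁ : ∀ j ≤ m, ∀ t, ⁅tailVec (m + 1) y m 0, foldVec m y z m j t⁆ = 0 := by
    refine down_induction ?_ ?_
    · intro t
      rw [foldVec, longVec, tail_self, tail_self]
      exact h.up _ _ _ _
    · intro q hq ih t
      have hq' : q + 1 ≤ m := hq
      have key := h.lie_triple hq le_rfl le_rfl hq' ih t
      rcases eq_or_ne m (q + 1) with hm | hm
      · rw [if_pos hm, if_pos hm, if_pos rfl, sw hq.le le_rfl hq', ← hm,
          h.fold_comm hq.le le_rfl, ← add_assoc] at key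
        exact h.tor_three _ key
      · rwa [if_neg hm, if_neg hm, if_pos rfl, zero_add, zero_add] at key
  have step₂ : ∀ i ≤ m, ∀ j ≤ m, ∀ t, ⁅tailVec (m + 1) y m 0, foldVec m y z i j t⁆ = 0 := by
    refine down_induction step₁ ?_
    intro q hq ih j hj t
    have hq' : q + 1 ≤ m := hq
    have key := h.lie_triple hq le_rfl hq' hj (ih j hj) t
    rw [if_pos rfl] at key
    have hlast : (if j = q + 1 then ⁅tailVec (m + 1) y m 0, foldVec m y z (q + 1) q t⁆ else 0) =
        0 := by
      split_ifs
      · exact ih q hq.le t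
      · rfl
    rw [hlast, add_zero] at key
    split_ifs at key with hm
    · rw [sw hq.le hq' hj, ← hm] at key
      exact h.path.tor _ key
    · rwa [zero_add] at key
  have step₃ : ∀ k ≤ m, ∀ i ≤ m, ∀ j ≤ m, ∀ t,
      ⁅tailVec (m + 1) y k 0, foldVec m y z i j t⁆ = 0 := by
    refine down_induction step₂ ?_
    intro q hq ih i hi j hj t
    have key := h.lie_triple hq (Nat.succ_le_of_lt hq) hi hj (ih i hi j hj) t
    rw [if_pos rfl, ih q hq.le j hj, ih i hi q hq.le, ite_self, ite_self, add_zero,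
      add_zero] at key
    exact key
  exact step₃ k hk i hi j hj t

lemma last_fold {i j : ℕ} (hi : i ≤ m) (hj : j ≤ m) (r s : ℕ) :
    ⁅y m r, foldVec m y z i j s⁆ = 0 := by
  rw [← tail_self (m := m) (y := y), h.tail_fold le_rfl hi hj, h.tail_fold_zero hi le_rfl hj]

lemma long_lie {j : ℕ} (hj : j ≤ m) (r s : ℕ) : ⁅z r, longVec m y z j s⁆ = 0 := by
  refine down_induction (P := fun j => ∀ s, ⁅z r, longVec m y z j s⁆ = 0) ?_ ?_ j hj s
  · intro s
    rw [longVec, tail_self]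
    exact h.down _ _ _
  · intro j hj ih s
    have : longVec m y z j s = ⁅y j 0, longVec m y z (j + 1) s⁆ := by
      rw [h.lie_long hj hj, if_pos rfl, zero_add]
    rw [this]
    exact lie_lie_eq_zero (lie_eq_zero_comm (h.far j hj 0 r)) (ih s)

lemma long_comm {i j : ℕ} (hi : i ≤ m) (hj : j ≤ m) (r s : ℕ) :
    ⁅longVec m y z i r, longVec m y z j s⁆ = 0 := by
  have key : ∀ {i j : ℕ}, i ≤ m → j ≤ m → ∀ r s, ⁅longVec m y z i r, longVec m y z j s⁆ =
      ⁅z 0, foldVec m y z i j (r + s)⁆ := by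
    intro i j hi hj r s
    nth_rw 2 [longVec]
    rw [leibniz_lie, lie_eq_zero_comm (h.long_lie hi 0 r), lie_zero, add_zero,
      ← lie_skew (longVec m y z i r), h.tail_long_eq hj hi, neg_lie, lie_skew, h.fold_comm hj hi,
      add_comm r s]
  refine h.path.tor _ ?_
  nth_rw 2 [← lie_skew]
  rw [key hi hj, key hj hi, h.fold_comm hi hj, add_comm s r, add_neg_cancel]

lemma z_tail {i : ℕ} (hi : i ≤ m) (r s : ℕ) :
    ⁅z r, tailVec (m + 1) y i s⁆ = -longVec m y z i (s + r) := by
  rw [← lie_skew, h.tail_lie hi]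

lemma z_fold {i j : ℕ} (hi : i ≤ m) (hj : j ≤ m) (r s : ℕ) :
    ⁅z r, foldVec m y z i j s⁆ = 0 := by
  rw [foldVec, leibniz_lie, h.long_lie hj, lie_zero, add_zero, h.z_tail hi, neg_lie,
    h.long_comm hi hj, neg_zero]

lemma z_segVec {i l : ℕ} (hl : i + l < m) (r s : ℕ) : ⁅z r, segVec y i l s⁆ = 0 := by
  induction l with
  | zero => exact lie_eq_zero_comm (h.far i hl s r)
  | succ l ih =>
    exact lie_lie_eq_zero (ih (by omega)) (lie_eq_zero_comm (h.far (i + l + 1) hl 0 r))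

end TypeCRel
end TypeC

/-! ### Root vectors of type `D` in the classical limit -/

section TypeD
variable {L : Type} [LieRing L]

lemma segVec_congr {y y' : ℕ → ℕ → L} {i l : ℕ} (h : ∀ k ≤ i + l, y k = y' k) :
    segVec y i l = segVec y' i l := by
  induction l with
  | zero =>
    funext s
    exact congrFun (h i le_rfl) s
  | succ l ih =>
    funext s
    rw [segVec, segVec, ih fun k hk => h k (by omega), h (i + l + 1) (by omega)]

/-- Relations of type `D`: two paths which differ in the last node, `y m` or `z`. -/
structure TypeDRel (m : ℕ) (y : ℕ → ℕ → L) (z : ℕ → L) : Prop where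
  path : PathRel (m + 1) y
  path' : PathRel (m + 1) (Function.update y m z)
  fork : ∀ a b, ⁅y m a, z b⁆ = 0

/-- The root vector of `[i, n]`, and of `[n]` for `i = m`. -/
def forkVec (m : ℕ) (y : ℕ → ℕ → L) (z : ℕ → L) (i s : ℕ) : L :=
  tailVec (m + 1) (Function.update y m z) i s

/-- The root vector of `[i, n, j]`. -/
def wedgeVec (m : ℕ) (y : ℕ → ℕ → L) (z : ℕ → L) (i j s : ℕ) : L :=
  ⁅tailVec (m + 1) y i 0, forkVec m y z j s⁆

namespace TypeDRel
variable {m : ℕ} {y : ℕ → ℕ → L} {z : ℕ → L}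

lemma tail_self (s : ℕ) : tailVec (m + 1) y m s = y m s := PathRel.tailVec_last s

lemma fork_self (s : ℕ) : forkVec m y z m s = z s := by
  rw [forkVec, tail_self, Function.update_self]

variable (h : TypeDRel m y z)
include h

lemma lie_fork {k i : ℕ} (hk : k < m) (hi : i ≤ m) (r s : ℕ) :
    ⁅y k r, forkVec m y z i s⁆ = if i = k + 1 then forkVec m y z k (r + s) else 0 := by
  have hy : y k = Function.update y m z k := (Function.update_of_ne hk.ne _ _).symm
  rw [hy, forkVec]
  split_ifs with hik
  · subst hik
    rw [h.path'.lie_tailVec_succ (by omega), forkVec]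
  · rw [h.path'.lie_tailVec (by omega) (by omega) hik]

lemma z_fork {i : ℕ} (hi : i ≤ m) (r s : ℕ) : ⁅z r, forkVec m y z i s⁆ = 0 := by
  have hz : z = Function.update y m z m := by rw [Function.update_self]
  nth_rw 1 [hz]
  exact h.path'.lie_tailVec (by omega) (by omega) (by omega) _ _

lemma lie_tail_fork {k i j : ℕ} (hk : k < m) (hi : i ≤ m) (hj : j ≤ m) (t r s : ℕ) :
    ⁅y k t, ⁅tailVec (m + 1) y i r, forkVec m y z j s⁆⁆ =
      (if i = k + 1 then ⁅tailVec (m + 1) y k (t + r), forkVec m y z j s⁆ else 0) +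
      if j = k + 1 then ⁅tailVec (m + 1) y i r, forkVec m y z k (t + s)⁆ else 0 := by
  rw [leibniz_lie, h.lie_fork hk hj]
  congr 1
  · split_ifs with hik
    · subst hik
      rw [h.path.lie_tailVec_succ (by omega)]
    · rw [h.path.lie_tailVec (by omega) (by omega) hik, zero_lie]
  · split_ifs
    · rfl
    · exact lie_zero _

lemma tail_fork_aux : ∀ i ≤ m,
    (∀ r s, ⁅tailVec (m + 1) y i r, forkVec m y z i s⁆ = 0) ∧ ∀ j ≤ m, i < j → ∀ r s t,
      ⁅tailVec (m + 1) y i (r + t), forkVec m y z j s⁆ +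
        ⁅tailVec (m + 1) y j r, forkVec m y z i (s + t)⁆ = 0 := by
  refine down_induction ⟨fun r s => ?_, fun j hj hij => by omega⟩ ?_
  · rw [tail_self, fork_self, h.fork]
  rintro i hi ⟨ih₁, ih₂⟩
  have hi' : i + 1 ≤ m := hi
  have adj : ∀ r s t, ⁅tailVec (m + 1) y i (r + t), forkVec m y z (i + 1) s⁆ +
      ⁅tailVec (m + 1) y (i + 1) r, forkVec m y z i (s + t)⁆ = 0 := by
    intro r s t
    have key := h.lie_tail_fork hi hi' hi' t r s
    rw [ih₁, lie_zero, if_pos rfl, if_pos rfl] at key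
    rw [add_comm r, add_comm s, ← key]
  refine ⟨fun r s => ?_, fun j hj hij r s t => ?_⟩
  · have key := congrArg (fun u => ⁅y i 0, u⁆) (adj r s 0)
    simp only [add_zero, lie_add, lie_zero] at key
    rw [h.lie_tail_fork hi hi.le hi', h.lie_tail_fork hi hi' hi.le, if_neg (by omega),
      if_pos rfl, if_pos rfl, if_neg (by omega), zero_add, zero_add, zero_add, add_zero] at key
    exact h.path.tor _ key
  · rcases eq_or_lt_of_le (Nat.succ_le_of_lt hij) with rfl | hij'
    · exact adj r s t
    · have key := congrArg (fun u => ⁅y i 0, u⁆) (ih₂ j hj hij' r s t)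
      simp only [lie_add, lie_zero] at key
      rw [h.lie_tail_fork hi hi' hj, h.lie_tail_fork hi hj hi', if_pos rfl,
        if_neg (by omega), if_neg (by omega), if_pos rfl, add_zero, zero_add, zero_add,
        zero_add] at key
      exact key

lemma tail_fork_anti {i j : ℕ} (hi : i ≤ m) (hj : j ≤ m) (r s : ℕ) :
    ⁅tailVec (m + 1) y i r, forkVec m y z j s⁆ = -⁅tailVec (m + 1) y j r, forkVec m y z i s⁆ := by
  rcases lt_trichotomy i j with hij | rfl | hij
  · exact eq_neg_of_add_eq_zero_left ((h.tail_fork_aux i hi).2 j hj hij r s 0)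
  · rw [(h.tail_fork_aux i hi).1, neg_zero]
  · exact eq_neg_of_add_eq_zero_right ((h.tail_fork_aux j hj).2 i hi hij r s 0)

lemma tail_fork {i j : ℕ} (hi : i ≤ m) (hj : j ≤ m) (r s : ℕ) :
    ⁅tailVec (m + 1) y i r, forkVec m y z j s⁆ = wedgeVec m y z i j (r + s) := by
  have key : ∀ {i j : ℕ}, i ≤ m → j ≤ m → i < j → ⁅tailVec (m + 1) y i r, forkVec m y z j s⁆ =
      -wedgeVec m y z j i (r + s) := by
    intro i j hi hj hij
    have := eq_neg_of_add_eq_zero_left ((h.tail_fork_aux i hi).2 j hj hij 0 s r)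
    rwa [zero_add, add_comm s] at this
  rcases lt_trichotomy i j with hij | rfl | hij
  · rw [key hi hj hij, wedgeVec, wedgeVec, h.tail_fork_anti hi hj]
  · rw [wedgeVec, (h.tail_fork_aux i hi).1, (h.tail_fork_aux i hi).1]
  · rw [h.tail_fork_anti hi hj, key hj hi hij, neg_neg]

lemma wedge_anti {i j : ℕ} (hi : i ≤ m) (hj : j ≤ m) (s : ℕ) :
    wedgeVec m y z i j s = -wedgeVec m y z j i s := h.tail_fork_anti hi hj 0 s

lemma lie_wedge {k i j : ℕ} (hk : k < m) (hi : i ≤ m) (hj : j ≤ m) (r s : ℕ) :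
    ⁅y k r, wedgeVec m y z i j s⁆ = (if i = k + 1 then wedgeVec m y z k j (r + s) else 0) +
      if j = k + 1 then wedgeVec m y z i k (r + s) else 0 := by
  rw [wedgeVec, h.lie_tail_fork hk hi hj, h.tail_fork hk.le hj]
  rfl

lemma tail_wedge {k i j : ℕ} (hk : k ≤ m) (hi : i ≤ m) (hj : j ≤ m) (p s : ℕ) :
    ⁅tailVec (m + 1) y k p, wedgeVec m y z i j s⁆ = 0 := by
  have sw : ∀ {k i j : ℕ}, k ≤ m → i ≤ m → j ≤ m → ∀ p s,
      ⁅tailVec (m + 1) y k p, wedgeVec m y z i j s⁆ =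
        ⁅tailVec (m + 1) y i 0, wedgeVec m y z k j (p + s)⁆ := by
    intro k i j hk hi hj p s
    rw [wedgeVec, lie_swap (h.path.tailVec_comm (by omega) (by omega) p 0), h.tail_fork hk hj]
  have zero : ∀ t, ⁅tailVec (m + 1) y i 0, wedgeVec m y z k j t⁆ = 0 := by
    intro t
    refine h.path.tor _ ?_
    nth_rw 1 [sw hi hk hj 0 t, zero_add, h.wedge_anti hi hj, lie_neg, sw hk hj hi, zero_add,
      h.wedge_anti hk hi, lie_neg, neg_neg, sw hj hi hk, zero_add, h.wedge_anti hj hk, lie_neg]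
    exact neg_add_cancel _
  rw [sw hk hi hj, zero]

lemma fork_wedge {k i j : ℕ} (hk : k ≤ m) (hi : i ≤ m) (hj : j ≤ m) (p s : ℕ) :
    ⁅forkVec m y z k p, wedgeVec m y z i j s⁆ = 0 := by
  have sw : ∀ {k i j : ℕ}, k ≤ m → i ≤ m → j ≤ m → ∀ p s,
      ⁅forkVec m y z k p, wedgeVec m y z i j s⁆ =
        ⁅forkVec m y z j 0, wedgeVec m y z i k (s + p)⁆ := by
    intro k i j hk hi hj p s
    have hs : wedgeVec m y z i j s = ⁅tailVec (m + 1) y i s, forkVec m y z j 0⁆ := by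
      rw [h.tail_fork hi hj, add_zero]
    have hcomm : ⁅forkVec m y z k p, forkVec m y z j 0⁆ = 0 :=
      h.path'.tailVec_comm (by omega) (by omega) p 0
    rw [hs, leibniz_lie, hcomm, lie_zero, add_zero, ← lie_skew (forkVec m y z k p),
      h.tail_fork hi hk, neg_lie, lie_skew]
  have zero : ∀ t, ⁅forkVec m y z j 0, wedgeVec m y z i k t⁆ = 0 := by
    intro t
    refine h.path.tor _ ?_
    nth_rw 1 [h.wedge_anti hi hk, lie_neg, sw hj hk hi, add_zero, h.wedge_anti hk hj, lie_neg,
      neg_neg, sw hi hj hk, add_zero, h.wedge_anti hj hi, lie_neg, sw hk hi hj, add_zero]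
    exact neg_add_cancel _
  rw [sw hk hi hj, zero]

lemma last_fork {i : ℕ} (hi : i ≤ m) (r s : ℕ) :
    ⁅y m r, forkVec m y z i s⁆ = wedgeVec m y z m i (r + s) := by
  rw [← tail_self (m := m) (y := y), h.tail_fork le_rfl hi]

lemma last_wedge {i j : ℕ} (hi : i ≤ m) (hj : j ≤ m) (r s : ℕ) :
    ⁅y m r, wedgeVec m y z i j s⁆ = 0 := by
  rw [← tail_self (m := m) (y := y), h.tail_wedge le_rfl hi hj]

lemma z_wedge {i j : ℕ} (hi : i ≤ m) (hj : j ≤ m) (r s : ℕ) :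
    ⁅z r, wedgeVec m y z i j s⁆ = 0 := by
  rw [← fork_self (m := m) (y := y) (z := z), h.fork_wedge le_rfl hi hj]

lemma z_tail {i : ℕ} (hi : i ≤ m) (r s : ℕ) :
    ⁅z r, tailVec (m + 1) y i s⁆ = -wedgeVec m y z i m (s + r) := by
  rw [← fork_self (m := m) (y := y) (z := z), ← lie_skew, h.tail_fork hi le_rfl]

lemma z_segVec_of_lt {i l : ℕ} (hl : i + l + 1 < m) (r s : ℕ) : ⁅z r, segVec y i l s⁆ = 0 := by
  have := h.path'.lie_segVec_of_gt (k := m) (i := i) (l := l) hl (by omega) r s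
  rwa [Function.update_self, segVec_congr (y' := y)] at this
  intro k hk
  exact Function.update_of_ne (by omega) _ _

lemma z_segVec {i l : ℕ} (hl : i + l + 1 = m) (r s : ℕ) :
    ⁅z r, segVec y i l s⁆ = -forkVec m y z i (s + r) := by
  have := h.path'.segVec_lie (i := i) (l := l) (by omega) s r
  rw [hl, Function.update_self, segVec_congr (y' := y)] at this
  · rw [← lie_skew, this, forkVec, tailVec, show m + 1 - 1 - i = l + 1 by omega]
  · intro k hk
    exact Function.update_of_ne (by omega) _ _

end TypeDRel
end TypeD

/-! ### Bracketings of the specific root vectors -/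

/-- The left-normed bracketing of a nonempty word, with its first letter marked. -/
def wordTree : List ℕ → BrTree
  | [] => .leaf 0 true
  | i :: w => (BrTree.leaf i true).chain w

/-- The bracketing of the specific root vector of a positive root of type `C`. -/
def treeC {n : ℕ} (β : PosRootC n) : BrTree :=
  if isINI β then
    .node ((BrTree.leaf (ri β) false).chain (List.range' (ri β + 1) (n - ri β - 1)))
      (.node ((BrTree.leaf (ri β) false).chain (List.range' (ri β + 1) (n - ri β - 1)))
        (.leaf n true))
  else wordTree (wordC β)

/-- The bracketing of the specific root vector of a positive root of type `D`. -/
def treeD {n : ℕ} (β : PosRootD n) : BrTree := wordTree (wordD β)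

section Leval
variable {L : Type} [LieRing L] (g : ℕ → ℕ → L) (s : ℕ)

lemma BrTree.leval_chain (t : BrTree) (w : List ℕ) :
    (t.chain w).leval g s = w.foldl (fun u i => ⁅u, g i 0⁆) (t.leval g s) := by
  induction w generalizing t with
  | nil => rfl
  | cons i w ih => exact ih _

lemma foldl_range' (i l : ℕ) :
    (List.range' (i + 1) l).foldl (fun u k => ⁅u, g k 0⁆) (g i s) = segVec g i l s := by
  induction l with
  | zero => rfl
  | succ l ih =>
    rw [List.range'_concat, List.foldl_append, ih, segVec]
    simp only [List.foldl_cons, List.foldl_nil, one_mul]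
    rw [show i + 1 + l = i + l + 1 by omega]

lemma wordTree_range' (i l : ℕ) :
    (wordTree (List.range' i (l + 1))).leval g s = segVec g i l s := by
  rw [List.range'_succ, wordTree, BrTree.leval_chain]
  exact foldl_range' g s i l

lemma wordTree_append {w w' : List ℕ} (hw : w ≠ []) :
    wordTree (w ++ w') = (wordTree w).chain w' := by
  cases w with
  | nil => exact absurd rfl hw
  | cons i w => rw [List.cons_append, wordTree, wordTree, BrTree.chain_append]

lemma wordTree_range'_append (i l : ℕ) (w : List ℕ) :
    (wordTree (List.range' i (l + 1) ++ w)).leval g s =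
      w.foldl (fun u k => ⁅u, g k 0⁆) (segVec g i l s) := by
  rw [wordTree_append (by simp), BrTree.leval_chain, wordTree_range']

end Leval

lemma reverse_range'_succ (j d : ℕ) :
    (List.range' j (d + 1)).reverse = (List.range' (j + 1) d).reverse ++ [j] := by
  rw [List.range'_succ, List.reverse_cons]

/-! ### Closure under brackets in type `C` -/

section ClosureC
variable {L : Type} [LieRing L] {m : ℕ} {x : ℕ → ℕ → L}

lemma ClassRel.typeC (hm : 1 ≤ m) (hx : ClassRel (m + 1) (aC (m + 1)) x) :
    TypeCRel m x (x (m + 1)) := by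
  have hlast : m + 1 ∈ Finset.Icc 1 (m + 1) := by simp
  have hpen : m ∈ Finset.Icc 1 (m + 1) := by simp [hm]
  have h₁ : aC (m + 1) m (m + 1) = -2 := by simp [aC]
  have h₂ : aC (m + 1) (m + 1) m = -1 := by
    rw [aC, if_neg (by omega), if_neg (by omega), if_pos (by omega)]
  refine ⟨hx.pathRel id rfl ?_ ?_ ?_, hx.tor_three, ?_, hx.self hlast, hx.dep hpen hlast,
    hx.serre_three' hpen hlast h₁, ?_⟩
  · intro i hi hi'
    rw [Finset.mem_Icc]
    exact ⟨hi', hi.le⟩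
  · intro i j hi hij hj
    refine ⟨by simp only [id]; omega, ?_⟩
    simp only [id, aC]
    rw [if_neg (by omega), if_neg (by omega), if_neg (by omega)]
  · intro i hi hi'
    change aC (m + 1) i (i + 1) = -1 ∧ aC (m + 1) (i + 1) i = -1
    rw [aC, aC]
    constructor
    · rw [if_neg (by omega), if_neg (by omega), if_pos (by omega)]
    · rw [if_neg (by omega), if_neg (by omega), if_pos (by omega)]
  · intro k hk a b
    rcases Nat.eq_zero_or_pos k with rfl | h
    · rw [hx.zero 0 (by simp), zero_lie]
    · refine hx.serre_one k (by rw [Finset.mem_Icc]; omega) _ hlast (by omega) ?_ a b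
      rw [aC, if_neg (by omega), if_neg (by omega), if_neg (by omega)]
  · intro a b c
    rw [← lie_skew (x m b), lie_neg, hx.serre_two' hlast hpen h₂, neg_zero]

lemma segVec_eq_longVec {i : ℕ} (hi : i ≤ m) (s : ℕ) :
    segVec x i (m - i + 1) s = longVec m x (x (m + 1)) i s := by
  rw [segVec, longVec, tailVec, show i + (m - i) + 1 = m + 1 by omega, Nat.add_sub_cancel]

lemma TypeCRel.foldl_long (h : TypeCRel m x (x (m + 1))) {i j : ℕ} (hij : i ≤ j) (hj : j ≤ m)
    (s : ℕ) :
    (List.range' j (m + 1 - j)).reverse.foldl (fun u k => ⁅u, x k 0⁆)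
        (longVec m x (x (m + 1)) i s) = foldVec m x (x (m + 1)) i j s ∨
      (List.range' j (m + 1 - j)).reverse.foldl (fun u k => ⁅u, x k 0⁆)
        (longVec m x (x (m + 1)) i s) = -foldVec m x (x (m + 1)) i j s := by
  obtain ⟨d, rfl⟩ : ∃ d, j = m - d := ⟨m - j, by omega⟩
  clear hj
  induction d with
  | zero =>
    rw [Nat.sub_zero, Nat.add_sub_cancel_left]
    refine Or.inr ?_
    simp only [List.range'_one, List.reverse_cons, List.reverse_nil, List.nil_append,
      List.foldl_cons, List.foldl_nil]
    rw [← lie_skew, h.last_long (by omega), zero_add, h.fold_comm le_rfl (by omega)]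
  | succ d ih =>
    rcases Nat.lt_or_ge d m with hd | hd
    · obtain ⟨j, hj⟩ : ∃ j, j = m - (d + 1) := ⟨_, rfl⟩
      rw [← hj] at hij ⊢
      rw [show m - d = j + 1 by omega] at ih
      rw [show m + 1 - j = m + 1 - (j + 1) + 1 by omega, reverse_range'_succ, List.foldl_append,
        List.foldl_cons, List.foldl_nil]
      have key : ⁅foldVec m x (x (m + 1)) i (j + 1) s, x j 0⁆ =
          -foldVec m x (x (m + 1)) i j s := by
        rw [← lie_skew, h.lie_fold (by omega) (by omega) (by omega), if_neg (by omega), if_pos rfl,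
          zero_add, zero_add]
      rcases ih (by omega) with h' | h'
      · rw [h', key]
        exact Or.inr rfl
      · rw [h', neg_lie, key, neg_neg]
        exact Or.inl rfl
    · rw [show m - (d + 1) = m - d by omega]
      exact ih (by omega)

/-- The positive root with the given encoding. -/
def mkRootC {n i t : ℕ} (hi : 1 ≤ i) (hn : i = n → t = 0) (ht : t + 2 * i ≤ 2 * n) : PosRootC n :=
  ⟨toLex (⟨i, by omega⟩, ⟨t, by omega⟩), hi, hn, ht⟩

lemma treeC_leval_of_lt {β : PosRootC (m + 1)} (h : ri β + rt β < m + 1 ∨ ri β = m + 1) (s : ℕ) :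
    (treeC β).leval x s = segVec x (ri β) (rt β) s := by
  have hβ := β.2
  rw [treeC, if_neg (by unfold isINI; omega), wordC]
  simp only [if_pos h]
  exact wordTree_range' x s _ _

lemma treeC_leval_of_eq (h : TypeCRel m x (x (m + 1))) {β : PosRootC (m + 1)}
    (hβ : ri β + rt β = m + 1) (hβ' : ri β < m + 1)
    (s : ℕ) : (treeC β).leval x s = foldVec m x (x (m + 1)) (ri β) (ri β) s := by
  rw [treeC, if_pos ⟨hβ, hβ'⟩]
  simp only [BrTree.leval, BrTree.leval_chain, if_true, if_false, Bool.false_eq_true]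
  have e : segVec x (ri β) (m + 1 - ri β - 1) 0 = tailVec (m + 1) x (ri β) 0 := by
    rw [tailVec, show m + 1 - ri β - 1 = m + 1 - 1 - ri β by omega]
  rw [foldl_range', e, h.tail_lie (by omega), zero_add, foldVec]

lemma treeC_leval_of_eq_succ {β : PosRootC (m + 1)} (hβ : ri β + rt β = m + 2)
    (hβ' : ri β ≤ m) (s : ℕ) :
    (treeC β).leval x s = longVec m x (x (m + 1)) (ri β) s := by
  rw [treeC, if_neg (by unfold isINI; omega), wordC]
  rw [if_neg (by omega), if_neg (by omega), if_pos (by omega), wordTree_range',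
    ← segVec_eq_longVec hβ', show m + 1 - ri β = m - ri β + 1 by omega]

lemma treeC_leval_of_gt (h : TypeCRel m x (x (m + 1))) {β : PosRootC (m + 1)}
    (hβ : m + 2 < ri β + rt β) (hβ' : ri β ≤ m) (hj : 2 * m + 3 - ri β - rt β ≤ m)
    (hj' : ri β ≤ 2 * m + 3 - ri β - rt β) (s : ℕ) :
    (treeC β).leval x s = foldVec m x (x (m + 1)) (ri β) (2 * m + 3 - ri β - rt β) s ∨
      (treeC β).leval x s = -foldVec m x (x (m + 1)) (ri β) (2 * m + 3 - ri β - rt β) s := by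
  rw [treeC, if_neg (by unfold isINI; omega), wordC]
  rw [if_neg (by omega), if_neg (by omega), if_neg (by omega), wordTree_range'_append,
    show m + 1 - ri β = m - ri β + 1 by omega, segVec_eq_longVec hβ',
    show 2 * (m + 1) + 1 - ri β - rt β = 2 * m + 3 - ri β - rt β by omega]
  exact h.foldl_long hj' hj s

lemma bracketClosed_treeC (hm : 1 ≤ m) :
    BracketClosed (m + 1) (aC (m + 1)) (treeC : PosRootC (m + 1) → BrTree) := by
  intro L _ x hx k hk r β s
  have h := hx.typeC hm
  set S := AddSubgroup.closure {y | ∃ (β : PosRootC (m + 1)) (s : ℕ), (treeC β).leval x s = y}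
  have mem : ∀ (β : PosRootC (m + 1)) s, (treeC β).leval x s ∈ S := fun β s =>
    AddSubgroup.subset_closure ⟨β, s, rfl⟩
  have hseg : ∀ i l, 1 ≤ i → i + l ≤ m → ∀ s, segVec x i l s ∈ S := by
    intro i l hi hl s
    have := mem (mkRootC (n := m + 1) (i := i) (t := l) hi (by omega) (by omega)) s
    rwa [treeC_leval_of_lt (Or.inl (Nat.lt_succ_of_le hl))] at this
  have hlong : ∀ i, 1 ≤ i → i ≤ m → ∀ s, longVec m x (x (m + 1)) i s ∈ S := by
    intro i hi hm s
    have := mem (mkRootC (n := m + 1) (i := i) (t := m + 2 - i) hi (by omega) (by omega)) s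
    rwa [treeC_leval_of_eq_succ (β := mkRootC hi _ _)
      (show i + (m + 2 - i) = m + 2 by omega) hm] at this
  have hfold' : ∀ i j, 1 ≤ i → i ≤ j → j ≤ m → ∀ s, foldVec m x (x (m + 1)) i j s ∈ S := by
    intro i j hi hij hj s
    rcases hij.eq_or_lt with rfl | hij
    · have := mem (mkRootC (n := m + 1) (i := i) (t := m + 1 - i) hi (by omega) (by omega)) s
      rwa [treeC_leval_of_eq h (β := mkRootC hi _ _) (show i + (m + 1 - i) = m + 1 by omega)
        (show i < m + 1 by omega)] at this
    · have hj' : 2 * m + 3 - i - (2 * m + 3 - i - j) = j := by omega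
      have := mem (mkRootC (n := m + 1) (i := i) (t := 2 * m + 3 - i - j) hi (by omega)
        (by omega)) s
      have h' := treeC_leval_of_gt h (β := mkRootC (n := m + 1) (i := i) (t := 2 * m + 3 - i - j)
        hi (by omega) (by omega)) (show m + 2 < i + (2 * m + 3 - i - j) by omega)
        (show i ≤ m by omega) (show 2 * m + 3 - i - (2 * m + 3 - i - j) ≤ m by omega)
        (show i ≤ 2 * m + 3 - i - (2 * m + 3 - i - j) by omega) s
      change _ = foldVec m x (x (m + 1)) i (2 * m + 3 - i - (2 * m + 3 - i - j)) s ∨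
        _ = -foldVec m x (x (m + 1)) i (2 * m + 3 - i - (2 * m + 3 - i - j)) s at h'
      rw [hj'] at h'
      rcases h' with h' | h'
      · rwa [h'] at this
      · rw [h'] at this
        exact neg_mem_iff.1 this
  have hfold : ∀ i j, 1 ≤ i → 1 ≤ j → i ≤ m → j ≤ m → ∀ s,
      foldVec m x (x (m + 1)) i j s ∈ S := by
    intro i j hi hj hi' hj' s
    rcases le_total i j with hij | hij
    · exact hfold' i j hi hij hj' s
    · rw [h.fold_comm hi' hj']
      exact hfold' j i hj hij hi' s
  rw [Finset.mem_Icc] at hk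
  have lseg : ∀ i l, 1 ≤ i → i + l ≤ m → ∀ s, ⁅x k r, segVec x i l s⁆ ∈ S := by
    intro i l hi hl s
    rcases (show k = m + 1 ∨ k < m + 1 by omega) with rfl | hk'
    · rcases hl.eq_or_lt with hl' | hl'
      · have e : segVec x i l s = tailVec (m + 1) x i s := by
          rw [tailVec, show m + 1 - 1 - i = l by omega]
        rw [e, h.z_tail (by omega)]
        exact neg_mem (hlong i hi (by omega) _)
      · rw [h.z_segVec hl']
        exact zero_mem _
    · rcases h.path.lie_segVec_cases hk' (show i + l < m + 1 by omega) r s with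
        h0 | ⟨h1, h0⟩ | ⟨h1, h0⟩
      · rw [h0]
        exact zero_mem _
      · rw [h0]
        exact hseg _ _ (by omega) (by omega) _
      · rw [h0]
        exact neg_mem (hseg _ _ (by omega) (by omega) _)
  have llong : ∀ i, 1 ≤ i → i ≤ m → ∀ s, ⁅x k r, longVec m x (x (m + 1)) i s⁆ ∈ S := by
    intro i hi hi' s
    rcases (show k = m + 1 ∨ k = m ∨ k < m by omega) with rfl | rfl | hk'
    · rw [h.long_lie hi']
      exact zero_mem _
    · rw [h.last_long hi']
      exact hfold _ _ hm hi le_rfl hi' _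
    · rw [h.lie_long hk' hi']
      split_ifs
      · exact hlong k hk.1 hk'.le _
      · exact zero_mem _
  have lfold : ∀ i j, 1 ≤ i → 1 ≤ j → i ≤ m → j ≤ m → ∀ s,
      ⁅x k r, foldVec m x (x (m + 1)) i j s⁆ ∈ S := by
    intro i j hi hj hi' hj' s
    rcases (show k = m + 1 ∨ k = m ∨ k < m by omega) with rfl | rfl | hk'
    · rw [h.z_fold hi' hj']
      exact zero_mem _
    · rw [h.last_fold hi' hj']
      exact zero_mem _
    · rw [h.lie_fold hk' hi' hj']
      refine add_mem ?_ ?_ <;> split_ifs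
      · exact hfold _ _ hk.1 hj hk'.le hj' _
      · exact zero_mem _
      · exact hfold _ _ hi hk.1 hi' hk'.le _
      · exact zero_mem _
  obtain ⟨h1, h2, h3⟩ : 1 ≤ ri β ∧ (ri β = m + 1 → rt β = 0) ∧ rt β + 2 * ri β ≤ 2 * (m + 1) := β.2
  rcases (show ri β = m + 1 ∨ ri β + rt β ≤ m ∨ (ri β + rt β = m + 1 ∧ ri β < m + 1) ∨
    (ri β ≤ m ∧ ri β + rt β = m + 2) ∨ (ri β ≤ m ∧ m + 2 < ri β + rt β) by omega) with
    hc | hc | ⟨hc, hc'⟩ | ⟨hc', hc⟩ | ⟨hc', hc⟩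
  · rw [treeC_leval_of_lt (Or.inr hc), hc, h2 hc, segVec]
    rcases (show k = m + 1 ∨ k = m ∨ k < m by omega) with rfl | rfl | hk'
    · rw [h.self]
      exact zero_mem _
    · rw [← TypeCRel.tail_self (m := k) (y := x), h.tail_lie le_rfl]
      exact hlong k hk.1 le_rfl _
    · rw [h.far k hk']
      exact zero_mem _
  · rw [treeC_leval_of_lt (Or.inl (by omega))]
    exact lseg _ _ h1 hc s
  · rw [treeC_leval_of_eq h hc hc']
    exact lfold _ _ h1 h1 (by omega) (by omega) s
  · rw [treeC_leval_of_eq_succ hc hc']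
    exact llong _ h1 hc' s
  · rcases treeC_leval_of_gt h hc hc' (by omega) (by omega) s with h' | h'
    · rw [h']
      exact lfold _ _ h1 (by omega) hc' (by omega) s
    · rw [h', lie_neg]
      exact neg_mem (lfold _ _ h1 (by omega) hc' (by omega) s)

end ClosureC

/-! ### Closure under brackets in type `D` -/

section ClosureD
variable {L : Type} [LieRing L] {m : ℕ} {x : ℕ → ℕ → L}

lemma ClassRel.typeD (hm : 2 ≤ m) (hx : ClassRel (m + 1) (aD (m + 1)) x) :
    TypeDRel m x (x (m + 1)) := by
  have hlast : m + 1 ∈ Finset.Icc 1 (m + 1) := by simp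
  have hpen : m ∈ Finset.Icc 1 (m + 1) := by rw [Finset.mem_Icc]; omega
  have hy : Function.update x m (x (m + 1)) = fun i => x (if i = m then m + 1 else i) := by
    funext i
    rcases eq_or_ne i m with rfl | hi
    · rw [Function.update_self, if_pos rfl]
    · rw [Function.update_of_ne hi, if_neg hi]
  refine ⟨hx.pathRel id rfl ?_ ?_ ?_, ?_, ?_⟩
  · intro i hi hi'
    rw [Finset.mem_Icc]
    exact ⟨hi', hi.le⟩
  · intro i j hi hij hj
    refine ⟨by simp only [id]; omega, ?_⟩
    simp only [id, aD]
    rw [if_neg (by omega), if_neg (by omega), if_neg (by omega)]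
  · intro i hi hi'
    change aD (m + 1) i (i + 1) = -1 ∧ aD (m + 1) (i + 1) i = -1
    rw [aD, aD]
    constructor
    · rw [if_neg (by omega), if_pos (by omega)]
    · rw [if_neg (by omega), if_pos (by omega)]
  · rw [hy]
    refine hx.pathRel _ (by rw [if_neg (by omega)]) ?_ ?_ ?_
    · intro i hi hi'
      rw [Finset.mem_Icc]
      split_ifs <;> omega
    · intro i j hi hij hj
      rw [if_neg (show i ≠ m by omega)]
      refine ⟨by split_ifs <;> omega, ?_⟩
      rw [aD]
      split_ifs <;> omega
    · intro i hi hi'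
      rw [if_neg (show i ≠ m by omega), aD, aD]
      constructor <;> split_ifs <;> omega
  · refine hx.serre_one m hpen _ hlast (by omega) ?_
    rw [aD]
    split_ifs <;> omega

lemma segVec_eq_forkVec {i : ℕ} (hi : i < m) (s : ℕ) :
    ⁅segVec x i (m - i - 1) s, x (m + 1) 0⁆ = forkVec m x (x (m + 1)) i s := by
  rw [forkVec, tailVec, show m + 1 - 1 - i = m - i - 1 + 1 by omega, segVec,
    show i + (m - i - 1) + 1 = m by omega, Function.update_self, segVec_congr (y := x)]
  intro k hk
  rw [Function.update_of_ne (by omega)]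

lemma TypeDRel.foldl_fork (h : TypeDRel m x (x (m + 1))) {i j : ℕ} (hij : i < j) (hj : j ≤ m)
    (s : ℕ) :
    (List.range' j (m + 1 - j)).reverse.foldl (fun u k => ⁅u, x k 0⁆)
        (forkVec m x (x (m + 1)) i s) = wedgeVec m x (x (m + 1)) i j s ∨
      (List.range' j (m + 1 - j)).reverse.foldl (fun u k => ⁅u, x k 0⁆)
        (forkVec m x (x (m + 1)) i s) = -wedgeVec m x (x (m + 1)) i j s := by
  obtain ⟨d, rfl⟩ : ∃ d, j = m - d := ⟨m - j, by omega⟩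
  clear hj
  induction d with
  | zero =>
    rw [Nat.sub_zero, Nat.add_sub_cancel_left]
    refine Or.inl ?_
    simp only [List.range'_one, List.reverse_cons, List.reverse_nil, List.nil_append,
      List.foldl_cons, List.foldl_nil]
    rw [← lie_skew, h.last_fork (by omega), zero_add, h.wedge_anti le_rfl (by omega), neg_neg]
  | succ d ih =>
    rcases Nat.lt_or_ge d m with hd | hd
    · obtain ⟨j, hj⟩ : ∃ j, j = m - (d + 1) := ⟨_, rfl⟩
      rw [← hj] at hij ⊢
      rw [show m - d = j + 1 by omega] at ih
      rw [show m + 1 - j = m + 1 - (j + 1) + 1 by omega, reverse_range'_succ, List.foldl_append,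
        List.foldl_cons, List.foldl_nil]
      have key : ⁅wedgeVec m x (x (m + 1)) i (j + 1) s, x j 0⁆ =
          -wedgeVec m x (x (m + 1)) i j s := by
        rw [← lie_skew, h.lie_wedge (by omega) (by omega) (by omega), if_neg (by omega),
          if_pos rfl, zero_add, zero_add]
      rcases ih (by omega) with h' | h'
      · rw [h', key]
        exact Or.inr rfl
      · rw [h', neg_lie, key, neg_neg]
        exact Or.inl rfl
    · rw [show m - (d + 1) = m - d by omega]
      exact ih (by omega)

/-- The positive root with the given encoding. -/
def mkRootD {n i t : ℕ} (hi : 1 ≤ i) (hn : n - 1 ≤ i → t = 0) (ht : t = 0 ∨ t + 2 * i + 1 ≤ 2 * n)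
    (hin : i ≤ n) : PosRootD n :=
  ⟨toLex (⟨i, by omega⟩, ⟨t, by omega⟩), hi, hn, ht⟩

lemma treeD_leval_of_lt {β : PosRootD (m + 1)} (h : riD β + rtD β < m + 1 ∨ riD β = m + 1)
    (s : ℕ) : (treeD β).leval x s = segVec x (riD β) (rtD β) s := by
  rw [treeD, wordD, if_pos h]
  exact wordTree_range' x s _ _

lemma treeD_leval_of_eq {β : PosRootD (m + 1)} (h : riD β + rtD β = m + 1) (h' : riD β < m)
    (s : ℕ) : (treeD β).leval x s = forkVec m x (x (m + 1)) (riD β) s := by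
  rw [treeD, wordD, if_neg (by omega), if_pos h,
    show m + 1 - 1 - riD β = m - riD β - 1 + 1 by omega, wordTree_range'_append, List.foldl_cons,
    List.foldl_nil, segVec_eq_forkVec h']

lemma treeD_leval_of_gt (h : TypeDRel m x (x (m + 1))) {β : PosRootD (m + 1)}
    (hβ : m + 1 < riD β + rtD β) (hβ' : riD β < m) (hj : 2 * m + 2 - riD β - rtD β ≤ m)
    (hj' : riD β < 2 * m + 2 - riD β - rtD β) (s : ℕ) :
    (treeD β).leval x s = wedgeVec m x (x (m + 1)) (riD β) (2 * m + 2 - riD β - rtD β) s ∨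
      (treeD β).leval x s = -wedgeVec m x (x (m + 1)) (riD β) (2 * m + 2 - riD β - rtD β) s := by
  have hw : wordD β = List.range' (riD β) (m - riD β - 1 + 1) ++ ([m + 1] ++
      (List.range' (2 * m + 2 - riD β - rtD β)
        (m + 1 - (2 * m + 2 - riD β - rtD β))).reverse) := by
    rw [wordD, if_neg (by omega), if_neg (by omega), ← List.append_assoc,
      show m + 1 - 1 - riD β = m - riD β - 1 + 1 by omega,
      show 2 * (m + 1) - riD β - rtD β = 2 * m + 2 - riD β - rtD β by omega]
    split_ifs with h1
    · rw [show 2 * m + 2 - riD β - rtD β = m by omega, Nat.add_sub_cancel_left, List.range'_one,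
        List.append_assoc]
      rfl
    · rfl
  rw [treeD, hw, wordTree_range'_append, List.foldl_append, List.foldl_cons, List.foldl_nil,
    segVec_eq_forkVec hβ']
  exact h.foldl_fork hj' hj s

lemma bracketClosed_treeD (hm : 2 ≤ m) :
    BracketClosed (m + 1) (aD (m + 1)) (treeD : PosRootD (m + 1) → BrTree) := by
  intro L _ x hx k hk r β s
  have h := hx.typeD hm
  set S := AddSubgroup.closure {y | ∃ (β : PosRootD (m + 1)) (s : ℕ), (treeD β).leval x s = y}
  have mem : ∀ (β : PosRootD (m + 1)) s, (treeD β).leval x s ∈ S := fun β s =>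
    AddSubgroup.subset_closure ⟨β, s, rfl⟩
  have hseg : ∀ i l, 1 ≤ i → i + l ≤ m → ∀ s, segVec x i l s ∈ S := by
    intro i l hi hl s
    have := mem (mkRootD (n := m + 1) (i := i) (t := l) hi (by omega) (by omega) (by omega)) s
    rwa [treeD_leval_of_lt (Or.inl (Nat.lt_succ_of_le hl))] at this
  have hfork : ∀ i, 1 ≤ i → i ≤ m → ∀ s, forkVec m x (x (m + 1)) i s ∈ S := by
    intro i hi him s
    rcases him.eq_or_lt with rfl | him
    · have := mem (mkRootD (n := i + 1) (i := i + 1) (t := 0) (by omega) (by omega) (by omega)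
        (by omega)) s
      rwa [treeD_leval_of_lt (β := mkRootD _ _ _ _) (Or.inr rfl),
        show segVec x (riD _) (rtD _) s = x (i + 1) s from rfl,
        ← TypeDRel.fork_self (m := i) (y := x) (z := x (i + 1))] at this
    · have := mem (mkRootD (n := m + 1) (i := i) (t := m + 1 - i) hi (by omega) (by omega)
        (by omega)) s
      rwa [treeD_leval_of_eq (β := mkRootD hi _ _ _)
        (show i + (m + 1 - i) = m + 1 by omega) him] at this
  have hwedge' : ∀ i j, 1 ≤ i → i < j → j ≤ m → ∀ s, wedgeVec m x (x (m + 1)) i j s ∈ S := by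
    intro i j hi hij hj s
    have hj' : 2 * m + 2 - i - (2 * m + 2 - i - j) = j := by omega
    have := mem (mkRootD (n := m + 1) (i := i) (t := 2 * m + 2 - i - j) hi (by omega)
      (by omega) (by omega)) s
    have h' := treeD_leval_of_gt h (β := mkRootD (n := m + 1) (i := i) (t := 2 * m + 2 - i - j)
      hi (by omega) (by omega) (by omega)) (show m + 1 < i + (2 * m + 2 - i - j) by omega)
      (show i < m by omega) (show 2 * m + 2 - i - (2 * m + 2 - i - j) ≤ m by omega)
      (show i < 2 * m + 2 - i - (2 * m + 2 - i - j) by omega) s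
    change _ = wedgeVec m x (x (m + 1)) i (2 * m + 2 - i - (2 * m + 2 - i - j)) s ∨
      _ = -wedgeVec m x (x (m + 1)) i (2 * m + 2 - i - (2 * m + 2 - i - j)) s at h'
    rw [hj'] at h'
    rcases h' with h' | h'
    · rwa [h'] at this
    · rw [h'] at this
      exact neg_mem_iff.1 this
  have hwedge : ∀ i j, 1 ≤ i → 1 ≤ j → i ≤ m → j ≤ m → ∀ s,
      wedgeVec m x (x (m + 1)) i j s ∈ S := by
    intro i j hi hj hi' hj' s
    rcases lt_trichotomy i j with hij | rfl | hij
    · exact hwedge' i j hi hij hj' s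
    · rw [wedgeVec, (h.tail_fork_aux i hi').1]
      exact zero_mem _
    · rw [h.wedge_anti hi' hj']
      exact neg_mem (hwedge' j i hj hij hi' s)
  rw [Finset.mem_Icc] at hk
  have lseg : ∀ i l, 1 ≤ i → i + l ≤ m → ∀ s, ⁅x k r, segVec x i l s⁆ ∈ S := by
    intro i l hi hl s
    rcases (show k = m + 1 ∨ k < m + 1 by omega) with rfl | hk'
    · rcases (show i + l = m ∨ i + l + 1 = m ∨ i + l + 1 < m by omega) with hl' | hl' | hl'
      · have e : segVec x i l s = tailVec (m + 1) x i s := by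
          rw [tailVec, show m + 1 - 1 - i = l by omega]
        rw [e, h.z_tail (by omega)]
        exact neg_mem (hwedge i m hi (by omega) (by omega) le_rfl _)
      · rw [h.z_segVec hl']
        exact neg_mem (hfork i hi (by omega) _)
      · rw [h.z_segVec_of_lt hl']
        exact zero_mem _
    · rcases h.path.lie_segVec_cases hk' (show i + l < m + 1 by omega) r s with
        h0 | ⟨h1, h0⟩ | ⟨h1, h0⟩
      · rw [h0]
        exact zero_mem _
      · rw [h0]
        exact hseg _ _ (by omega) (by omega) _
      · rw [h0]
        exact neg_mem (hseg _ _ (by omega) (by omega) _)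
  have lfork : ∀ i, 1 ≤ i → i ≤ m → ∀ s, ⁅x k r, forkVec m x (x (m + 1)) i s⁆ ∈ S := by
    intro i hi hi' s
    rcases (show k = m + 1 ∨ k = m ∨ k < m by omega) with rfl | rfl | hk'
    · rw [h.z_fork hi']
      exact zero_mem _
    · rw [h.last_fork hi']
      exact hwedge _ _ (by omega) hi le_rfl hi' _
    · rw [h.lie_fork hk' hi']
      split_ifs
      · exact hfork k hk.1 hk'.le _
      · exact zero_mem _
  have lwedge : ∀ i j, 1 ≤ i → 1 ≤ j → i ≤ m → j ≤ m → ∀ s,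
      ⁅x k r, wedgeVec m x (x (m + 1)) i j s⁆ ∈ S := by
    intro i j hi hj hi' hj' s
    rcases (show k = m + 1 ∨ k = m ∨ k < m by omega) with rfl | rfl | hk'
    · rw [h.z_wedge hi' hj']
      exact zero_mem _
    · rw [h.last_wedge hi' hj']
      exact zero_mem _
    · rw [h.lie_wedge hk' hi' hj']
      refine add_mem ?_ ?_ <;> split_ifs
      · exact hwedge _ _ hk.1 hj hk'.le hj' _
      · exact zero_mem _
      · exact hwedge _ _ hi hk.1 hi' hk'.le _
      · exact zero_mem _
  obtain ⟨h1, h2, h3⟩ : 1 ≤ riD β ∧ (m + 1 - 1 ≤ riD β → rtD β = 0) ∧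
    (rtD β = 0 ∨ rtD β + 2 * riD β + 1 ≤ 2 * (m + 1)) := β.2
  have h4 : riD β < m + 1 + 1 := (ofLex β.1).1.2
  rcases (show riD β = m + 1 ∨ riD β + rtD β ≤ m ∨ (riD β < m ∧ riD β + rtD β = m + 1) ∨
    (riD β < m ∧ m + 1 < riD β + rtD β) by omega) with hc | hc | ⟨hc', hc⟩ | ⟨hc', hc⟩
  · rw [treeD_leval_of_lt (Or.inr hc), hc, h2 (by omega), segVec,
      ← TypeDRel.fork_self (m := m) (y := x) (z := x (m + 1))]
    exact lfork m (by omega) le_rfl s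
  · rw [treeD_leval_of_lt (Or.inl (by omega))]
    exact lseg _ _ h1 hc s
  · rw [treeD_leval_of_eq hc hc']
    exact lfork _ h1 hc'.le s
  · rcases treeD_leval_of_gt h hc hc' (by omega) (by omega) s with h' | h'
    · rw [h']
      exact lwedge _ _ h1 (by omega) hc'.le (by omega) s
    · rw [h', lie_neg]
      exact neg_mem (lwedge _ _ h1 (by omega) hc'.le (by omega) s)

end ClosureD

/-! ### Right multiplication and evaluation of commutators -/

section RightMul
variable {R P : Type} [CommRing R] [DecidableEq P] (θ : P → P → R)

/-- Right shuffle multiplication by the point mass at a finite set `Q`. -/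
def rightOp (Q : Finset P) : Module.End R (Finset P → R) where
  toFun f T := if Q ⊆ T then (∏ p ∈ T \ Q, ∏ q ∈ Q, θ p q) * f (T \ Q) else 0
  map_add' f g := by
    ext T; by_cases h : Q ⊆ T <;> simp [h, mul_add]
  map_smul' r f := by
    ext T; by_cases h : Q ⊆ T <;> simp [h, mul_left_comm]

lemma rightOp_apply (Q : Finset P) (f : Finset P → R) (T : Finset P) :
    rightOp θ Q f T = if Q ⊆ T then (∏ p ∈ T \ Q, ∏ q ∈ Q, θ p q) * f (T \ Q) else 0 := rfl

lemma rightOp_vac (Q T : Finset P) :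
    rightOp θ Q (vac R) T = if T = Q then 1 else 0 := by
  rw [rightOp_apply]
  by_cases h : Q ⊆ T
  · by_cases e : T = Q
    · subst e
      simp [vac_empty]
    · rw [if_pos h, if_neg e, vac_ne, mul_zero]
      exact fun h' => e (Finset.Subset.antisymm (Finset.sdiff_eq_empty_iff_subset.1 h') h)
  · rw [if_neg h, if_neg]
    rintro rfl
    exact h le_rfl

lemma ptOp_vac (p : P) : ptOp θ p (vac R) = rightOp θ {p} (vac R) := by
  ext T
  rw [rightOp_vac, ptOp_apply]
  by_cases hp : p ∈ T
  · by_cases e : T = {p}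
    · subst e
      simp [vac_empty]
    · rw [if_pos hp, if_neg e, vac_ne, mul_zero]
      intro h
      rcases Finset.erase_eq_empty_iff T p |>.1 h with h | h
      · exact absurd (h ▸ hp) (Finset.notMem_empty p)
      · exact e h
  · rw [if_neg hp, if_neg]
    rintro rfl
    exact hp (Finset.mem_singleton_self p)

lemma commute_ptOp_rightOp (p : P) (Q : Finset P) : Commute (ptOp θ p) (rightOp θ Q) := by
  ext f T
  rw [Module.End.mul_apply, Module.End.mul_apply, ptOp_apply, rightOp_apply, rightOp_apply,
    ptOp_apply]
  by_cases hp : p ∈ T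
  · by_cases hQ : Q ⊆ T
    · by_cases hpQ : p ∈ Q
      · rw [if_pos hp, if_neg fun h => by simpa using h hpQ, if_pos hQ,
          if_neg (by simp [hpQ]), mul_zero, mul_zero]
      · have h1 : Q ⊆ T.erase p := fun x hx =>
          Finset.mem_erase.2 ⟨fun h => hpQ (h ▸ hx), hQ hx⟩
        have h2 : T.erase p \ Q = (T \ Q).erase p := by
          ext x; simp only [Finset.mem_sdiff, Finset.mem_erase]; tauto
        have h3 : p ∈ T \ Q := by simp [hp, hpQ]
        rw [if_pos hp, if_pos h1, if_pos hQ, if_pos h3, h2, ← Finset.prod_sdiff h1, h2,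
          ← Finset.mul_prod_erase _ _ h3]
        ring
    · rw [if_neg hQ, if_pos hp, if_neg fun h => hQ (h.trans (Finset.erase_subset _ _)), mul_zero]
  · rw [if_neg hp, if_neg (c := p ∈ T \ Q) (by simp [hp])]
    simp

/-- `M` is right linear and local. -/
def RightLinear (M : Module.End R (Finset P → R)) : Prop :=
  (∀ Q, Commute M (rightOp θ Q)) ∧
    ∀ f g T, (∀ S ⊆ T, f S = g S) → M f T = M g T

variable {θ}

lemma rightLinear_ptOp (p : P) : RightLinear θ (ptOp θ p) := by
  refine ⟨commute_ptOp_rightOp θ p, fun f g T h => ?_⟩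
  rw [ptOp_apply, ptOp_apply, h _ (Finset.erase_subset _ _)]

lemma RightLinear.add {M N : Module.End R (Finset P → R)} (h : RightLinear θ M)
    (h' : RightLinear θ N) : RightLinear θ (M + N) :=
  ⟨fun Q => (h.1 Q).add_left (h'.1 Q), fun f g T e => by
    rw [LinearMap.add_apply, LinearMap.add_apply, Pi.add_apply, Pi.add_apply, h.2 f g T e,
      h'.2 f g T e]⟩

lemma RightLinear.sub {M N : Module.End R (Finset P → R)} (h : RightLinear θ M)
    (h' : RightLinear θ N) : RightLinear θ (M - N) :=
  ⟨fun Q => (h.1 Q).sub_left (h'.1 Q), fun f g T e => by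
    rw [LinearMap.sub_apply, LinearMap.sub_apply, Pi.sub_apply, Pi.sub_apply, h.2 f g T e,
      h'.2 f g T e]⟩

lemma RightLinear.mul {M N : Module.End R (Finset P → R)} (h : RightLinear θ M)
    (h' : RightLinear θ N) : RightLinear θ (M * N) :=
  ⟨fun Q => (h.1 Q).mul_left (h'.1 Q), fun f g T e => by
    rw [Module.End.mul_apply, Module.End.mul_apply]
    exact h.2 _ _ T fun S hS => h'.2 f g S fun S' hS' => e S' (hS'.trans hS)⟩

lemma RightLinear.apply {M : Module.End R (Finset P → R)} (h : RightLinear θ M)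
    (f : Finset P → R) (T : Finset P) :
    M f T = ∑ Q ∈ T.powerset, f Q * ((∏ p ∈ T \ Q, ∏ q ∈ Q, θ p q) * M (vac R) (T \ Q)) := by
  have h1 : M f T = M (∑ Q ∈ T.powerset, f Q • rightOp θ Q (vac R)) T := by
    refine h.2 _ _ T fun S hS => ?_
    simp [Finset.sum_apply, rightOp_vac, hS]
  rw [h1, map_sum, Finset.sum_apply]
  refine Finset.sum_congr rfl fun Q hQ => ?_
  rw [map_smul, ← Module.End.mul_apply, (h.1 Q).eq, Module.End.mul_apply, Pi.smul_apply,
    rightOp_apply, if_pos (Finset.mem_powerset.1 hQ), smul_eq_mul]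

lemma RightLinear.mul_ptOp_vac {M : Module.End R (Finset P → R)} (h : RightLinear θ M)
    {p : P} {T : Finset P} :
    M (ptOp θ p (vac R)) T =
      if p ∈ T then (∏ q ∈ T.erase p, θ q p) * M (vac R) (T.erase p) else 0 := by
  rw [ptOp_vac, ← Module.End.mul_apply, (h.1 _).eq, Module.End.mul_apply, rightOp_apply]
  simp [Finset.sdiff_singleton_eq_erase]

end RightMul

section OneCluster
variable (A : ℕ → ℕ → ℤ) (Dd : ℕ → ℕ) (v : Bool × ℕ → ℚ)

lemma rightLinear_oneEval (t : BrTree) : RightLinear (ratTh A Dd v) (oneEval A Dd v t) :=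
  BrTree.eval_rel (B' := ℤ) (fun _ M _ => RightLinear (ratTh A Dd v) M)
    (fun _ _ _ _ _ h h' => h.sub h') (fun _ _ _ _ _ _ h h' => h.mul h') _ (fun _ _ => 0) 0 t
    (fun i _ _ => by
      rw [oneOp, Fintype.sum_bool]
      exact (rightLinear_ptOp _).add (rightLinear_ptOp _))

/-- The contribution of adding the point `p` last, when forming a commutator. -/
def stepCoeff (T : Finset (Bool × ℕ)) (p : Bool × ℕ) : ℚ :=
  ∏ q ∈ T.erase p, ratTh A Dd v q p - ∏ q ∈ T.erase p, ratTh A Dd v p q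

lemma oneEval_node_leaf (t : BrTree) (i : ℕ) (f : Bool) (T : Finset (Bool × ℕ)) :
    oneEval A Dd v (.node t (.leaf i f)) (vac ℚ) T =
      ∑ b, if (b, i) ∈ T then
        stepCoeff A Dd v T (b, i) * oneEval A Dd v t (vac ℚ) (T.erase (b, i)) else 0 := by
  have h : oneEval A Dd v (.node t (.leaf i f)) =
      oneEval A Dd v t * oneOp A Dd v i - oneOp A Dd v i * oneEval A Dd v t := by
    simp [oneEval, BrTree.eval]
  rw [h, LinearMap.sub_apply, Module.End.mul_apply, Module.End.mul_apply, oneOp,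
    LinearMap.sum_apply, LinearMap.sum_apply, map_sum, Pi.sub_apply, Finset.sum_apply,
    Finset.sum_apply, ← Finset.sum_sub_distrib]
  refine Finset.sum_congr rfl fun b _ => ?_
  rw [(rightLinear_oneEval A Dd v t).mul_ptOp_vac, ptOp_apply, stepCoeff]
  split_ifs <;> ring

lemma oneEval_leaf (i : ℕ) (f b : Bool) : oneEval A Dd v (.leaf i f) (vac ℚ) {(b, i)} ≠ 0 := by
  have h : oneEval A Dd v (.leaf i f) = oneOp A Dd v i := by
    simp [oneEval, BrTree.eval]
  rw [h, oneOp, LinearMap.sum_apply, Finset.sum_apply]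
  cases b <;> simp [ptOp_apply, vac_empty]

variable {A Dd v}

lemma oneEval_single_ne_zero {t : BrTree} {i : ℕ} {f b : Bool} {T : Finset (Bool × ℕ)}
    (hT : (b, i) ∈ T) (hT' : (!b, i) ∉ T) (hc : stepCoeff A Dd v T (b, i) ≠ 0)
    (ht : oneEval A Dd v t (vac ℚ) (T.erase (b, i)) ≠ 0) :
    oneEval A Dd v (.node t (.leaf i f)) (vac ℚ) T ≠ 0 := by
  rw [oneEval_node_leaf, Fintype.sum_bool]
  cases b
  · rw [Bool.not_false] at hT'
    rw [if_neg hT', if_pos hT, zero_add]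
    exact mul_ne_zero hc ht
  · rw [Bool.not_true] at hT'
    rw [if_neg hT', if_pos hT, add_zero]
    exact mul_ne_zero hc ht

lemma oneEval_double_ne_zero {t : BrTree} {i : ℕ} {f : Bool} {T : Finset (Bool × ℕ)}
    (hT : (true, i) ∈ T) (hc : stepCoeff A Dd v T (true, i) ≠ 0)
    (hc' : stepCoeff A Dd v T (false, i) = 0)
    (ht : oneEval A Dd v t (vac ℚ) (T.erase (true, i)) ≠ 0) :
    oneEval A Dd v (.node t (.leaf i f)) (vac ℚ) T ≠ 0 := by
  rw [oneEval_node_leaf, Fintype.sum_bool, if_pos hT, hc', zero_mul, ite_self, add_zero]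
  exact mul_ne_zero hc ht

lemma ratTh_eq_one {p q : Bool × ℕ} (h : halfForm A Dd p.2 q.2 = 0) : ratTh A Dd v p q = 1 := by
  rw [ratTh, h, zero_div, add_zero]

lemma stepCoeff_ne_zero_of_unique {T : Finset (Bool × ℕ)} {p r : Bool × ℕ} (hr : r ∈ T)
    (hpr : r ≠ p) (hs : halfForm A Dd r.2 p.2 = halfForm A Dd p.2 r.2)
    (h0 : halfForm A Dd p.2 r.2 ≠ 0) (hv : v p ≠ v r)
    (h : ∀ q ∈ T, q ≠ p → q ≠ r → halfForm A Dd q.2 p.2 = 0 ∧ halfForm A Dd p.2 q.2 = 0) :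
    stepCoeff A Dd v T p ≠ 0 := by
  have hr' : r ∈ T.erase p := Finset.mem_erase.2 ⟨hpr, hr⟩
  rw [stepCoeff, Finset.prod_eq_single_of_mem r hr', Finset.prod_eq_single_of_mem r hr', ratTh,
    ratTh, hs]
  · have : v p - v r ≠ 0 := sub_ne_zero.2 hv
    rw [← neg_sub (v p) (v r), div_neg]
    intro e
    have e' : halfForm A Dd p.2 r.2 / (v p - v r) = 0 := by linarith
    rcases div_eq_zero_iff.1 e' with e' | e'
    · exact h0 e'
    · exact this e'
  · intro q hq hqr
    exact ratTh_eq_one (h q (Finset.mem_of_mem_erase hq) (Finset.ne_of_mem_erase hq) hqr).2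
  · intro q hq hqr
    exact ratTh_eq_one (h q (Finset.mem_of_mem_erase hq) (Finset.ne_of_mem_erase hq) hqr).1

lemma stepCoeff_eq_zero {T : Finset (Bool × ℕ)} {p q r : Bool × ℕ} (hq : q ∈ T.erase p)
    (hr : r ∈ T.erase p) (h : ratTh A Dd v q p = 0) (h' : ratTh A Dd v p r = 0) :
    stepCoeff A Dd v T p = 0 := by
  rw [stepCoeff, Finset.prod_eq_zero hq h, Finset.prod_eq_zero hr h', sub_zero]

lemma stepCoeff_ne_zero {T : Finset (Bool × ℕ)} {p r : Bool × ℕ}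
    (hr : r ∈ T.erase p) (h : ∀ q ∈ T.erase p, ratTh A Dd v q p ≠ 0)
    (h' : ratTh A Dd v p r = 0) : stepCoeff A Dd v T p ≠ 0 := by
  rw [stepCoeff, Finset.prod_eq_zero hr h', sub_zero]
  exact Finset.prod_ne_zero_iff.2 h

lemma stepCoeff_eq_of_subset {T S : Finset (Bool × ℕ)} {p : Bool × ℕ} (hS : S ⊆ T.erase p)
    (h : ∀ q ∈ T.erase p, q ∉ S → halfForm A Dd q.2 p.2 = 0 ∧ halfForm A Dd p.2 q.2 = 0) :
    stepCoeff A Dd v T p = ∏ q ∈ S, ratTh A Dd v q p - ∏ q ∈ S, ratTh A Dd v p q := by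
  rw [stepCoeff, Finset.prod_subset hS fun q hq hq' => ratTh_eq_one (h q hq hq').1,
    Finset.prod_subset hS fun q hq hq' => ratTh_eq_one (h q hq hq').2]

/-- Evaluating a left-normed bracketing along a path in the Dynkin diagram. -/
lemma oneEval_chain_range' (b f : Bool) (i l : ℕ)
    (hadj : ∀ k, i ≤ k → k < i + l → halfForm A Dd k (k + 1) = halfForm A Dd (k + 1) k ∧
      halfForm A Dd (k + 1) k ≠ 0 ∧ v (b, k + 1) ≠ v (b, k))
    (hfar : ∀ k k', i ≤ k → k + 1 < k' → k' ≤ i + l →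
      halfForm A Dd k k' = 0 ∧ halfForm A Dd k' k = 0) :
    oneEval A Dd v ((BrTree.leaf i f).chain (List.range' (i + 1) l)) (vac ℚ)
      ({b} ×ˢ Finset.Icc i (i + l)) ≠ 0 := by
  induction l with
  | zero =>
    have : ({b} ×ˢ Finset.Icc i (i + 0) : Finset (Bool × ℕ)) = {(b, i)} := by simp
    rw [this]
    exact oneEval_leaf A Dd v i f b
  | succ l ih =>
    rw [List.range'_concat, BrTree.chain_append, one_mul]
    refine oneEval_single_ne_zero (b := b) ?_ ?_ ?_ ?_
    · simp only [Finset.mem_product, Finset.mem_singleton, Finset.mem_Icc]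
      refine ⟨trivial, ?_, ?_⟩ <;> omega
    · simp
    · refine stepCoeff_ne_zero_of_unique (r := (b, i + l)) ?_ ?_ ?_ ?_ ?_ ?_
      · simp
      · simp only [ne_eq, Prod.mk.injEq, true_and]
        omega
      · have := hadj (i + l) (by omega) (by omega)
        rw [show i + 1 + l = i + l + 1 by omega]
        exact this.1
      · have := hadj (i + l) (by omega) (by omega)
        rw [show i + 1 + l = i + l + 1 by omega]
        exact this.2.1
      · have := hadj (i + l) (by omega) (by omega)
        rw [show i + 1 + l = i + l + 1 by omega]
        exact this.2.2
      · rintro ⟨b', k⟩ hk h1 h2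
        simp only [Finset.mem_product, Finset.mem_singleton, Finset.mem_Icc] at hk
        obtain ⟨rfl, hk⟩ := hk
        simp only [ne_eq, Prod.mk.injEq, true_and] at h1 h2
        exact hfar k (i + 1 + l) hk.1 (by omega) (by omega)
    · have : ({b} ×ˢ Finset.Icc i (i + (l + 1)) : Finset (Bool × ℕ)).erase (b, i + 1 + l) =
          {b} ×ˢ Finset.Icc i (i + l) := by
        ext ⟨b', k⟩
        simp only [Finset.mem_erase, Finset.mem_product, Finset.mem_singleton, Finset.mem_Icc,
          ne_eq, Prod.mk.injEq]
        constructor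
        · rintro ⟨h1, rfl, h2⟩
          simp only [true_and] at h1
          exact ⟨rfl, by omega⟩
        · rintro ⟨rfl, h2⟩
          exact ⟨fun h => by simp only [true_and] at h; omega, rfl, by omega⟩
      rw [this]
      exact ih (fun k h1 h2 => hadj k h1 (by omega)) fun k k' h1 h2 h3 =>
        hfar k k' h1 h2 (by omega)

end OneCluster

/-! ### Nonvanishing of the root vectors in type `C` -/

section CartanC
variable {n : ℕ}

lemma halfForm_C_self {k : ℕ} (h : k ≠ n) : halfForm (aC n) (dC n) k k = 1 := by
  simp [halfForm, aC, dC, h]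

lemma halfForm_C_succ {k : ℕ} (h : k + 1 ≠ n) (h' : k ≠ n) :
    halfForm (aC n) (dC n) k (k + 1) = -1 / 2 ∧ halfForm (aC n) (dC n) (k + 1) k = -1 / 2 := by
  have h₁ : aC n k (k + 1) = -1 := by
    rw [aC, if_neg (by omega), if_neg (by omega), if_pos (by omega)]
  have h₂ : aC n (k + 1) k = -1 := by
    rw [aC, if_neg (by omega), if_neg (by omega), if_pos (by omega)]
  simp [halfForm, h₁, h₂, dC, h, h']

lemma halfForm_C_succ_last {k : ℕ} (h : k + 1 = n) :
    halfForm (aC n) (dC n) k n = -1 ∧ halfForm (aC n) (dC n) n k = -1 := by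
  have h₁ : aC n k n = -2 := by
    rw [aC, if_neg (by omega), if_pos (by omega)]
  have h₂ : aC n n k = -1 := by
    rw [aC, if_neg (by omega), if_neg (by omega), if_pos (by omega)]
  have h₃ : k ≠ n := by omega
  simp [halfForm, h₁, h₂, dC, h₃]

lemma halfForm_C_far {k k' : ℕ} (h : k + 1 < k') :
    halfForm (aC n) (dC n) k k' = 0 ∧ halfForm (aC n) (dC n) k' k = 0 := by
  have h₁ : aC n k k' = 0 := by
    rw [aC, if_neg (by omega), if_neg (by omega), if_neg (by omega)]
  have h₂ : k' ≤ n → aC n k' k = 0 := fun h => by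
    rw [aC, if_neg (by omega), if_neg (by omega), if_neg (by omega)]
  have h₃ : ¬ k' ≤ n → aC n k' k = 0 := fun h => by
    rw [aC, if_neg (by omega), if_neg (by omega), if_neg (by omega)]
  have h₂ := (em (k' ≤ n)).elim h₂ h₃
  simp [halfForm, h₁, h₂]

lemma halfForm_C_succ' (k : ℕ) (h : k < n) :
    halfForm (aC n) (dC n) k (k + 1) = halfForm (aC n) (dC n) (k + 1) k ∧
      halfForm (aC n) (dC n) (k + 1) k ≠ 0 := by
  by_cases h' : k + 1 = n
  · have := halfForm_C_succ_last h'
    rw [h', this.1, this.2]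
    norm_num
  · have := halfForm_C_succ h' h.ne
    rw [this.1, this.2]
    norm_num

lemma cartanLike_C (n : ℕ) : CartanLike n (aC n) (dC n) where
  diag i := by simp [aC]
  offdiag i j h := by
    rw [aC, if_neg h]
    split_ifs <;> simp
  symm i j hi hj := by
    rw [Finset.mem_Icc] at hi hj
    have key : ∀ i j, i < j → j ≤ n → (dC n i : ℚ) * aC n i j = (dC n j : ℚ) * aC n j i := by
      intro i j hij hj
      rcases (show i + 1 < j ∨ i + 1 = j by omega) with h | rfl
      · have := halfForm_C_far (n := n) h
        simp only [halfForm] at this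
        linarith
      · have := (halfForm_C_succ' (n := n) i (by omega)).1
        simp only [halfForm] at this
        linarith
    rcases lt_trichotomy i j with h | rfl | h
    · exact key i j h hj.2
    · rfl
    · exact (key j i h hi.2).symm
  pos i := by
    rw [dC]
    split_ifs <;> simp

lemma ratTh_eq {A : ℕ → ℕ → ℤ} {Dd : ℕ → ℕ} {v : Bool × ℕ → ℚ} {p q : Bool × ℕ} {h d : ℚ}
    (hh : halfForm A Dd p.2 q.2 = h) (hd : v p - v q = d) : ratTh A Dd v p q = 1 + h / d := by
  rw [ratTh, hh, hd]

/-- Two parallel chains of parameters, at distance `2`. -/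
def shiftVal (w : ℕ → ℚ) (p : Bool × ℕ) : ℚ := (if p.1 then 2 else 0) - w p.2

/-- The parameters detecting the roots of chain type in type `C`. -/
def chainValC (n : ℕ) : Bool × ℕ → ℚ := shiftVal fun k => if k = n then ((n : ℚ) + 1) / 2 else k / 2

lemma chainValC_of_ne {k : ℕ} (h : k ≠ n) (b : Bool) :
    chainValC n (b, k) = (if b then 2 else 0) - (k : ℚ) / 2 := by
  simp [chainValC, shiftVal, h]

lemma chainValC_last (b : Bool) :
    chainValC n (b, n) = (if b then 2 else 0) - ((n : ℚ) + 1) / 2 := by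
  simp [chainValC, shiftVal]

lemma genericVal_of_path {A : ℕ → ℕ → ℤ} {Dd : ℕ → ℕ} {v : Bool × ℕ → ℚ}
    (hself : ∀ k, v (true, k) ≠ v (false, k))
    (h : ∀ k k', k < k' → k' ≤ n →
      (halfForm A Dd k k' = 0 ∧ halfForm A Dd k' k = 0) ∨ ∀ b b', v (b, k) ≠ v (b', k')) :
    GenericVal A Dd n v := by
  rintro ⟨b, k⟩ ⟨b', k'⟩ hk hk' hne h0
  rw [Finset.mem_Icc] at hk hk'
  rcases lt_trichotomy k k' with hlt | rfl | hlt
  · rcases h k k' hlt hk'.2 with h1 | h1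
    · exact absurd h1.1 h0
    · exact h1 b b'
  · have h1 : b ≠ b' := fun e => hne (by rw [e])
    cases b <;> cases b'
    · exact absurd rfl h1
    · exact (hself k).symm
    · exact hself k
    · exact absurd rfl h1
  · rcases h k' k hlt hk.2 with h1 | h1
    · exact absurd h1.2 h0
    · exact (h1 b' b).symm

lemma genericVal_chainValC (n : ℕ) : GenericVal (aC n) (dC n) n (chainValC n) := by
  refine genericVal_of_path ?_ ?_
  · intro k
    simp [chainValC, shiftVal]
  · intro k k' hlt hk'
    rcases (show k + 1 < k' ∨ k + 1 = k' by omega) with h | rfl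
    · exact Or.inl (halfForm_C_far h)
    · right
      intro b b'
      rw [chainValC_of_ne (by omega)]
      rcases hk'.eq_or_lt with rfl | hlt
      · rw [chainValC_last]
        cases b <;> cases b' <;> push_cast <;> norm_num <;>
          intro e <;> linarith
      · rw [chainValC_of_ne (by omega)]
        cases b <;> cases b' <;> push_cast <;> norm_num <;>
          intro e <;> linarith

lemma chainValC_sub_succ {k : ℕ} (h : k + 1 < n) (b b' : Bool) :
    chainValC n (b, k) - chainValC n (b', k + 1) =
      (if b then 2 else 0) - (if b' then 2 else 0) + 1 / 2 := by
  rw [chainValC_of_ne (by omega), chainValC_of_ne (by omega)]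
  push_cast
  ring

lemma chainValC_sub_last {k : ℕ} (h : k + 1 = n) (b b' : Bool) :
    chainValC n (b, k) - chainValC n (b', n) =
      (if b then 2 else 0) - (if b' then 2 else 0) + 1 := by
  rw [chainValC_of_ne (by omega), chainValC_last, ← h]
  push_cast
  ring

lemma chainValC_sub_self {k : ℕ} (b b' : Bool) :
    chainValC n (b, k) - chainValC n (b', k) =
      (if b then 2 else 0) - (if b' then 2 else 0) := by
  simp [chainValC, shiftVal]

lemma ratTh_C_self {k : ℕ} (h : k ≠ n) (b b' : Bool) :
    ratTh (aC n) (dC n) (chainValC n) (b, k) (b', k) =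
      1 + 1 / ((if b then 2 else 0) - (if b' then 2 else 0)) :=
  ratTh_eq (halfForm_C_self h) (chainValC_sub_self b b')

lemma ratTh_C_succ {k : ℕ} (h : k + 1 < n) (b b' : Bool) :
    ratTh (aC n) (dC n) (chainValC n) (b, k) (b', k + 1) =
      1 + -1 / 2 / ((if b then 2 else 0) - (if b' then 2 else 0) + 1 / 2) :=
  ratTh_eq (halfForm_C_succ (by omega) (by omega)).1 (chainValC_sub_succ h b b')

lemma ratTh_C_pred {k : ℕ} (h : k + 1 < n) (b b' : Bool) :
    ratTh (aC n) (dC n) (chainValC n) (b, k + 1) (b', k) =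
      1 + -1 / 2 / -((if b' then 2 else 0) - (if b then 2 else 0) + 1 / 2) :=
  ratTh_eq (halfForm_C_succ (by omega) (by omega)).2
    ((neg_sub _ _).symm.trans (congrArg Neg.neg (chainValC_sub_succ h b' b)))

lemma ratTh_C_last {k : ℕ} (h : k + 1 = n) (b b' : Bool) :
    ratTh (aC n) (dC n) (chainValC n) (b, k) (b', n) =
      1 + -1 / ((if b then 2 else 0) - (if b' then 2 else 0) + 1) :=
  ratTh_eq (halfForm_C_succ_last h).1 (chainValC_sub_last h b b')

lemma ratTh_C_last' {k : ℕ} (h : k + 1 = n) (b b' : Bool) :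
    ratTh (aC n) (dC n) (chainValC n) (b, n) (b', k) =
      1 + -1 / -((if b' then 2 else 0) - (if b then 2 else 0) + 1) :=
  ratTh_eq (halfForm_C_succ_last h).2
    ((neg_sub _ _).symm.trans (congrArg Neg.neg (chainValC_sub_last h b' b)))

/-- The weight space detecting `[i,n,j]` in type `C`. -/
def foldPtsC (n i j : ℕ) : Finset (Bool × ℕ) := {false} ×ˢ Finset.Icc i n ∪ {true} ×ˢ Finset.Ico j n

lemma mem_foldPtsC_false {i j k : ℕ} : (false, k) ∈ foldPtsC n i j ↔ i ≤ k ∧ k ≤ n := by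
  simp [foldPtsC]

lemma mem_foldPtsC_true {i j k : ℕ} : (true, k) ∈ foldPtsC n i j ↔ j ≤ k ∧ k < n := by
  simp [foldPtsC]

lemma foldPtsC_erase {i j : ℕ} :
    (foldPtsC n i j).erase (true, j) = foldPtsC n i (j + 1) := by
  ext ⟨b, k⟩
  rw [Finset.mem_erase]
  cases b
  · rw [mem_foldPtsC_false, mem_foldPtsC_false]
    simp
  · rw [mem_foldPtsC_true, mem_foldPtsC_true]
    simp only [ne_eq, Prod.mk.injEq, true_and]
    omega

lemma oneEval_chainC_ne_zero {i l : ℕ} (h : i + l ≤ n) :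
    oneEval (aC n) (dC n) (chainValC n) ((BrTree.leaf i true).chain (List.range' (i + 1) l)) (vac ℚ)
      ({false} ×ˢ Finset.Icc i (i + l)) ≠ 0 := by
  refine oneEval_chain_range' false true i l ?_ ?_
  · intro k h1 h2
    refine ⟨(halfForm_C_succ' k (by omega)).1, (halfForm_C_succ' k (by omega)).2, ?_⟩
    rcases (show k + 1 = n ∨ k + 1 < n by omega) with h | h
    · have := chainValC_sub_last h false false
      rw [h]
      intro e
      rw [e] at this
      norm_num at this
    · have := chainValC_sub_succ h false false
      intro e
      rw [e] at this
      norm_num at this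
  · intro k k' _ h2 _
    exact halfForm_C_far h2

lemma stepCoeff_C_false {i j : ℕ} (hij : i < j) (hj : j < n) :
    stepCoeff (aC n) (dC n) (chainValC n) (foldPtsC n i j) (false, j) = 0 := by
  obtain ⟨k, rfl⟩ : ∃ k, j = k + 1 := ⟨j - 1, by omega⟩
  refine stepCoeff_eq_zero (q := (false, k)) (r := (false, k + 2)) ?_ ?_ ?_ ?_
  · rw [Finset.mem_erase, mem_foldPtsC_false]
    simp only [ne_eq, Prod.mk.injEq, true_and]
    omega
  · rw [Finset.mem_erase, mem_foldPtsC_false]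
    simp only [ne_eq, Prod.mk.injEq, true_and]
    omega
  · rw [ratTh_C_succ hj]
    norm_num
  · rcases (show k + 2 < n ∨ k + 2 = n by omega) with h | h
    · rw [ratTh_C_succ (k := k + 1) h]
      norm_num
    · rw [h, ratTh_C_last (k := k + 1) h]
      norm_num

lemma stepCoeff_C_true {i j : ℕ} (hij : i < j) (hj : j < n) :
    stepCoeff (aC n) (dC n) (chainValC n) (foldPtsC n i j) (true, j) ≠ 0 := by
  obtain ⟨k, rfl⟩ : ∃ k, j = k + 1 := ⟨j - 1, by omega⟩
  rcases (show k + 2 < n ∨ k + 2 = n by omega) with h | h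
  · refine stepCoeff_ne_zero (r := (true, k + 2)) ?_ ?_ ?_
    · rw [Finset.mem_erase, mem_foldPtsC_true]
      simp only [ne_eq, Prod.mk.injEq, true_and]
      omega
    · rintro ⟨b, l⟩ hl
      rcases (show l + 1 < k + 1 ∨ l = k ∨ l = k + 1 ∨ l = k + 2 ∨ k + 2 < l by omega) with
        hl' | rfl | rfl | rfl | hl'
      · rw [ratTh_eq_one (halfForm_C_far hl').1]
        norm_num
      · cases b
        · rw [ratTh_C_succ hj]
          norm_num
        · rw [Finset.mem_erase, mem_foldPtsC_true] at hl
          omega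
      · cases b
        · rw [ratTh_C_self (by omega)]
          norm_num
        · simp at hl
      · rw [ratTh_C_pred (k := k + 1) h]
        cases b <;> norm_num
      · rw [ratTh_eq_one (halfForm_C_far hl').2]
        norm_num
    · rw [ratTh_C_succ (k := k + 1) h]
      norm_num
  · rw [stepCoeff_eq_of_subset (S := {(false, k), (false, k + 1), (false, n)})]
    · have e1 : ((false, k) : Bool × ℕ) ∉ ({(false, k + 1), (false, n)} : Finset (Bool × ℕ)) := by
        simp only [Finset.mem_insert, Finset.mem_singleton, Prod.mk.injEq, true_and]
        omega
      have e2 : ((false, k + 1) : Bool × ℕ) ∉ ({(false, n)} : Finset (Bool × ℕ)) := by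
        simp only [Finset.mem_singleton, Prod.mk.injEq, true_and]
        omega
      rw [Finset.prod_insert e1, Finset.prod_insert e2, Finset.prod_singleton,
        Finset.prod_insert e1, Finset.prod_insert e2, Finset.prod_singleton,
        ratTh_C_succ hj, ratTh_C_pred hj, ratTh_C_self (by omega), ratTh_C_self (by omega),
        ratTh_C_last h, ratTh_C_last' h]
      norm_num
    · intro p hp
      simp only [Finset.mem_insert, Finset.mem_singleton] at hp
      rcases hp with rfl | rfl | rfl <;> rw [Finset.mem_erase, mem_foldPtsC_false] <;>
        refine ⟨by simp, ?_⟩ <;> omega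
    · rintro ⟨b, l⟩ hl hl'
      rw [Finset.mem_erase] at hl
      cases b
      · rw [mem_foldPtsC_false] at hl
        simp only [Finset.mem_insert, Finset.mem_singleton, Prod.mk.injEq, true_and] at hl'
        exact halfForm_C_far (by omega)
      · rw [mem_foldPtsC_true] at hl
        simp only [ne_eq, Prod.mk.injEq, true_and] at hl
        omega

lemma oneEval_foldC_ne_zero {i : ℕ} (d : ℕ) (h : i + d < n) :
    oneEval (aC n) (dC n) (chainValC n)
      (((BrTree.leaf i true).chain (List.range' (i + 1) (n - i))).chain
        (List.range' (n - d) d).reverse) (vac ℚ) (foldPtsC n i (n - d)) ≠ 0 := by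
  induction d with
  | zero =>
    have := oneEval_chainC_ne_zero (n := n) (i := i) (l := n - i) (by omega)
    rw [show i + (n - i) = n by omega] at this
    simpa [foldPtsC, BrTree.chain] using this
  | succ d ih =>
    obtain ⟨j, hj⟩ : ∃ j, j = n - (d + 1) := ⟨_, rfl⟩
    have ih := ih (by omega)
    rw [show n - d = j + 1 by omega] at ih
    rw [← hj, reverse_range'_succ, BrTree.chain_append]
    refine oneEval_double_ne_zero (mem_foldPtsC_true.2 ⟨le_rfl, by omega⟩)
      (stepCoeff_C_true (by omega) (by omega)) (stepCoeff_C_false (by omega) (by omega)) ?_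
    rw [foldPtsC_erase]
    exact ih

end CartanC

/-! ### Nonvanishing of the root vectors of the roots `[i,n,i]` -/

section LongRoot
variable {n : ℕ}

/-- The parameters detecting the long roots in type `C`. -/
def longValC (p : Bool × ℕ) : ℚ := 3 * p.2 + if p.1 then 1 else 0

lemma longValC_ne {k k' : ℕ} (h : k < k') (b b' : Bool) :
    longValC (b, k) ≠ longValC (b', k') := by
  have : (k : ℚ) + 1 ≤ k' := by exact_mod_cast h
  cases b <;> cases b' <;> norm_num [longValC] <;> intro e <;> linarith

lemma genericVal_longValC (n : ℕ) : GenericVal (aC n) (dC n) n longValC :=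
  genericVal_of_path (fun k => by simp [longValC]) fun k k' h _ => Or.inr (longValC_ne h)

lemma ratTh_long_self {k : ℕ} (h : k ≠ n) :
    ratTh (aC n) (dC n) longValC (false, k) (true, k) = 0 := by
  rw [ratTh_eq (p := (false, k)) (q := (true, k)) (h := 1) (d := -1) (halfForm_C_self h) (by simp [longValC])]
  norm_num

lemma ratTh_long_ne_zero {k l : ℕ} (hk : k < n) (hl : l < n) :
    ratTh (aC n) (dC n) longValC (true, k) (false, l) ≠ 0 := by
  rcases (show l = k ∨ l + 1 = k ∨ k + 1 = l ∨ l + 1 < k ∨ k + 1 < l by omega) with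
    rfl | rfl | rfl | h | h
  · rw [ratTh_eq (p := (true, l)) (q := (false, l)) (h := 1) (d := 1) (halfForm_C_self hl.ne) (by simp [longValC])]
    norm_num
  · rw [ratTh_eq (h := -1 / 2) (d := 4) (halfForm_C_succ hk.ne hl.ne).2
      (by simp only [longValC]; push_cast; norm_num; ring)]
    norm_num
  · rw [ratTh_eq (h := -1 / 2) (d := -2) (halfForm_C_succ hl.ne hk.ne).1
      (by simp only [longValC]; push_cast; norm_num; ring)]
    norm_num
  · rw [ratTh_eq_one (halfForm_C_far h).2]
    norm_num
  · rw [ratTh_eq_one (halfForm_C_far h).1]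
    norm_num

lemma ratTh_long_last {k : ℕ} (h : k + 1 = n) (b : Bool) :
    ratTh (aC n) (dC n) longValC (b, k) (false, n) = 1 + -1 / ((if b then 1 else 0) - 3) :=
  ratTh_eq (halfForm_C_succ_last h).1 (by
    rw [← h]; simp only [longValC]; push_cast; norm_num; ring)

lemma ratTh_long_last' {k : ℕ} (h : k + 1 = n) (b : Bool) :
    ratTh (aC n) (dC n) longValC (false, n) (b, k) = 1 + -1 / (3 - (if b then 1 else 0)) :=
  ratTh_eq (halfForm_C_succ_last h).2 (by
    rw [← h]; simp only [longValC]; push_cast; norm_num; ring)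

/-- The points of color in `[i,n)` in one of the two chains. -/
def segPts (n i : ℕ) (b : Bool) : Finset (Bool × ℕ) := {b} ×ˢ Finset.Ico i n

lemma mem_segPts {i k : ℕ} {b b' : Bool} : (b, k) ∈ segPts n i b' ↔ b = b' ∧ i ≤ k ∧ k < n := by
  rw [segPts, Finset.mem_product, Finset.mem_singleton, Finset.mem_Ico]

lemma last_notMem_segPts {i : ℕ} {b : Bool} : (false, n) ∉ segPts n i b := by
  simp [mem_segPts]

/-- The weight space detecting `[i,n,i]` in type `C`. -/
def longPts (n i : ℕ) : Finset (Bool × ℕ) := insert (false, n) (Finset.univ ×ˢ Finset.Ico i n)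

lemma mem_longPts {i k : ℕ} {b : Bool} :
    (b, k) ∈ longPts n i ↔ (b = false ∧ k = n) ∨ (i ≤ k ∧ k < n) := by
  simp [longPts]

lemma longPts_sdiff_false {i : ℕ} :
    longPts n i \ segPts n i false = insert (false, n) (segPts n i true) := by
  ext ⟨b, k⟩
  rw [Finset.mem_sdiff, mem_longPts, mem_segPts, Finset.mem_insert, mem_segPts]
  cases b <;> simp <;> omega

lemma longPts_sdiff_insert {i : ℕ} :
    longPts n i \ insert (false, n) (segPts n i false) = segPts n i true := by
  ext ⟨b, k⟩
  rw [Finset.mem_sdiff, mem_longPts, Finset.mem_insert, mem_segPts, mem_segPts]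
  cases b <;> simp <;> omega

/-- The bracketing of the root `[i,n-1]`. -/
def arm (n i : ℕ) : BrTree := (BrTree.leaf i false).chain (List.range' (i + 1) (n - i - 1))

lemma leaves_arm {i : ℕ} (h : i < n) : (arm n i).leaves = (List.range' i (n - i) : Multiset ℕ) := by
  rw [arm, BrTree.leaves_chain, BrTree.leaves, show n - i = n - i - 1 + 1 by omega,
    List.range'_succ]
  simp

lemma oneEval_arm_ne_zero {i : ℕ} (h : i < n) (b : Bool) :
    oneEval (aC n) (dC n) longValC (arm n i) (vac ℚ) (segPts n i b) ≠ 0 := by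
  have e : segPts n i b = {b} ×ˢ Finset.Icc i (i + (n - i - 1)) := by
    ext ⟨b', k⟩
    rw [mem_segPts]
    simp only [Finset.mem_product, Finset.mem_singleton, Finset.mem_Icc]
    refine and_congr_right fun _ => ?_
    omega
  rw [e]
  refine oneEval_chain_range' b false i (n - i - 1) ?_ fun k k' _ h2 _ => halfForm_C_far h2
  intro k h1 h2
  exact ⟨(halfForm_C_succ' k (by omega)).1, (halfForm_C_succ' k (by omega)).2,
    (longValC_ne (Nat.lt_succ_self k) b b).symm⟩

/-- A weight of the root vector of `[i,n-1]` picks one point of each color. -/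
lemma pick_of_oneEval_arm_ne_zero {i : ℕ} (h : i < n) {S : Finset (Bool × ℕ)}
    (hS : oneEval (aC n) (dC n) longValC (arm n i) (vac ℚ) S ≠ 0) :
    (∀ b k, (b, k) ∈ S → i ≤ k ∧ k < n) ∧ (∀ k, i ≤ k → k < n → ∃ b, (b, k) ∈ S) ∧
      ∀ k, (true, k) ∈ S → (false, k) ∉ S := by
  have hc := colors_of_oneEval_ne_zero _ _ hS
  rw [leaves_arm h] at hc
  have hmem : ∀ k, (∃ b, (b, k) ∈ S) ↔ i ≤ k ∧ k < n := by
    intro k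
    have h1 : k ∈ colors S ↔ ∃ b, (b, k) ∈ S := by
      simp [colors]
    rw [← h1, hc, Multiset.mem_coe, List.mem_range'_1]
    omega
  have hnd : (colors S).Nodup := by
    rw [hc, Multiset.coe_nodup]
    exact List.nodup_range'
  refine ⟨fun b k hb => (hmem k).1 ⟨b, hb⟩, fun k h1 h2 => (hmem k).2 ⟨h1, h2⟩, fun k h1 h2 => ?_⟩
  have := Multiset.inj_on_of_nodup_map hnd _ h1 _ h2 rfl
  simp at this

lemma oneEval_armLast {i : ℕ} (h : i < n) (b : Bool) :
    oneEval (aC n) (dC n) longValC (.node (arm n i) (.leaf n true)) (vac ℚ)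
        (insert (false, n) (segPts n i b)) =
      (if b then 1 else 2 / 3) *
        oneEval (aC n) (dC n) longValC (arm n i) (vac ℚ) (segPts n i b) := by
  obtain ⟨k, rfl⟩ : ∃ k, n = k + 1 := ⟨n - 1, by omega⟩
  rw [oneEval_node_leaf, Fintype.sum_bool, if_neg (by simp [mem_segPts]),
    if_pos (Finset.mem_insert_self _ _), zero_add, Finset.erase_insert last_notMem_segPts]
  congr 1
  rw [stepCoeff_eq_of_subset (S := {(b, k)}), Finset.prod_singleton, Finset.prod_singleton,
    ratTh_long_last rfl, ratTh_long_last' rfl]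
  · cases b <;> norm_num
  · rw [Finset.erase_insert last_notMem_segPts, Finset.singleton_subset_iff, mem_segPts]
    exact ⟨rfl, by omega⟩
  · rintro ⟨b', l⟩ hl hl'
    rw [Finset.erase_insert last_notMem_segPts, mem_segPts] at hl
    obtain ⟨rfl, hl⟩ := hl
    simp only [Finset.mem_singleton, Prod.mk.injEq, true_and] at hl'
    exact halfForm_C_far (by omega)

lemma oneEval_long_ne_zero {i : ℕ} (h : i < n) :
    oneEval (aC n) (dC n) longValC (.node (arm n i) (.node (arm n i) (.leaf n true))) (vac ℚ)
      (longPts n i) ≠ 0 := by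
  set θ := ratTh (aC n) (dC n) longValC with hθ
  set F := oneEval (aC n) (dC n) longValC (arm n i) with hF
  set H := oneEval (aC n) (dC n) longValC (.node (arm n i) (.leaf n true)) with hH
  have hFr := rightLinear_oneEval (aC n) (dC n) longValC (arm n i)
  have hHr := rightLinear_oneEval (aC n) (dC n) longValC (.node (arm n i) (.leaf n true))
  rw [← hF, ← hθ] at hFr
  rw [← hH, ← hθ] at hHr
  have e0 : oneEval (aC n) (dC n) longValC (.node (arm n i) (.node (arm n i) (.leaf n true))) =
      F * H - H * F := by
    simp [hF, hH, oneEval, BrTree.eval]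
  have vanish : ∀ (S Q : Finset (Bool × ℕ)) k, k ≠ n → (false, k) ∈ S → (true, k) ∈ Q →
      ∏ p ∈ S, ∏ q ∈ Q, θ p q = 0 := fun S Q k hk h1 h2 =>
    Finset.prod_eq_zero h1 (Finset.prod_eq_zero h2 (ratTh_long_self hk))
  have e1 : F (H (vac ℚ)) (longPts n i) = H (vac ℚ) (insert (false, n) (segPts n i false)) *
      ((∏ p ∈ segPts n i true, ∏ q ∈ insert (false, n) (segPts n i false), θ p q) *
        F (vac ℚ) (segPts n i true)) := by
    rw [hFr.apply, Finset.sum_eq_single (insert (false, n) (segPts n i false)),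
      longPts_sdiff_insert]
    · intro Q hQ hne
      rw [Finset.mem_powerset] at hQ
      by_cases h0 : F (vac ℚ) (longPts n i \ Q) = 0
      · rw [h0, mul_zero, mul_zero]
      · obtain ⟨h1, h2, h3⟩ := pick_of_oneEval_arm_ne_zero h h0
        by_cases h4 : ∃ k, (false, k) ∈ longPts n i \ Q
        · obtain ⟨k, hk⟩ := h4
          have h5 := h1 _ _ hk
          have h6 : (true, k) ∈ Q := by
            by_contra h6
            exact h3 k (Finset.mem_sdiff.2 ⟨mem_longPts.2 (Or.inr h5), h6⟩) hk
          rw [vanish _ _ k h5.2.ne hk h6, zero_mul, mul_zero]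
        · refine absurd ?_ hne
          rw [← Finset.sdiff_sdiff_eq_self hQ,
            show longPts n i \ Q = segPts n i true from ?_, ← longPts_sdiff_insert,
            Finset.sdiff_sdiff_eq_self]
          · intro ⟨b, k⟩
            rw [Finset.mem_insert, mem_segPts, mem_longPts]
            simp only [Prod.mk.injEq]
            tauto
          · ext ⟨b, k⟩
            rw [mem_segPts]
            constructor
            · intro hb
              refine ⟨?_, h1 _ _ hb⟩
              cases b
              · exact absurd ⟨k, hb⟩ h4
              · rfl
            · rintro ⟨rfl, hk⟩
              obtain ⟨b, hb⟩ := h2 k hk.1 hk.2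
              cases b
              · exact absurd ⟨k, hb⟩ h4
              · exact hb
    · intro hn
      refine absurd (Finset.mem_powerset.2 ?_) hn
      intro ⟨b, k⟩
      rw [Finset.mem_insert, mem_segPts, mem_longPts]
      simp only [Prod.mk.injEq]
      tauto
  have e2 : H (F (vac ℚ)) (longPts n i) = F (vac ℚ) (segPts n i false) *
      ((∏ p ∈ insert (false, n) (segPts n i true), ∏ q ∈ segPts n i false, θ p q) *
        H (vac ℚ) (insert (false, n) (segPts n i true))) := by
    rw [hHr.apply, Finset.sum_eq_single (segPts n i false), longPts_sdiff_false]
    · intro Q hQ hne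
      rw [Finset.mem_powerset] at hQ
      by_cases h0 : F (vac ℚ) Q = 0
      · rw [h0, zero_mul]
      · obtain ⟨h1, h2, h3⟩ := pick_of_oneEval_arm_ne_zero h h0
        by_cases h4 : ∃ k, (true, k) ∈ Q
        · obtain ⟨k, hk⟩ := h4
          have h5 := h1 _ _ hk
          rw [vanish _ _ k h5.2.ne
            (Finset.mem_sdiff.2 ⟨mem_longPts.2 (Or.inr h5), h3 k hk⟩) hk, zero_mul, mul_zero]
        · refine absurd ?_ hne
          ext ⟨b, k⟩
          rw [mem_segPts]
          constructor
          · intro hb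
            refine ⟨?_, h1 _ _ hb⟩
            cases b
            · rfl
            · exact absurd ⟨k, hb⟩ h4
          · rintro ⟨rfl, hk⟩
            obtain ⟨b, hb⟩ := h2 k hk.1 hk.2
            cases b
            · exact hb
            · exact absurd ⟨k, hb⟩ h4
    · intro hn
      refine absurd (Finset.mem_powerset.2 ?_) hn
      intro ⟨b, k⟩
      rw [mem_segPts, mem_longPts]
      tauto
  obtain ⟨m, hm⟩ : ∃ m, m + 1 = n := ⟨n - 1, by omega⟩
  have hlast : ∀ b, (b, m) ∈ segPts n i b := fun b => mem_segPts.2 ⟨rfl, by omega⟩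
  have hfar : ∀ b, ∀ p ∈ segPts n i b, p ≠ (b, m) →
      halfForm (aC n) (dC n) p.2 n = 0 ∧ halfForm (aC n) (dC n) n p.2 = 0 := by
    rintro b ⟨b', k⟩ hk hne
    obtain ⟨rfl, hk⟩ := mem_segPts.1 hk
    simp only [ne_eq, Prod.mk.injEq, true_and] at hne
    exact halfForm_C_far (by omega)
  have e3 : ∏ p ∈ segPts n i true, θ p (false, n) = 3 / 2 := by
    rw [Finset.prod_eq_single_of_mem _ (hlast true) fun p hp hne => ratTh_eq_one (hfar _ p hp hne).1,
      ratTh_long_last hm]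
    norm_num
  have e4 : ∏ p ∈ segPts n i false, θ (false, n) p = 2 / 3 := by
    rw [Finset.prod_eq_single_of_mem _ (hlast false)
      fun p hp hne => ratTh_eq_one (hfar _ p hp hne).2, ratTh_long_last' hm]
    norm_num
  have h5 : ∏ p ∈ segPts n i true, ∏ q ∈ segPts n i false, θ p q ≠ 0 := by
    refine Finset.prod_ne_zero_iff.2 fun p hp => Finset.prod_ne_zero_iff.2 fun q hq => ?_
    obtain ⟨b, k⟩ := p
    obtain ⟨b', l⟩ := q
    obtain ⟨rfl, hk⟩ := mem_segPts.1 hp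
    obtain ⟨rfl, hl⟩ := mem_segPts.1 hq
    exact ratTh_long_ne_zero hk.2 hl.2
  have h6 := oneEval_arm_ne_zero h true
  have h7 := oneEval_arm_ne_zero h false
  rw [e0, LinearMap.sub_apply, Module.End.mul_apply, Module.End.mul_apply, Pi.sub_apply, e1, e2,
    hH, oneEval_armLast h, oneEval_armLast h, Finset.prod_insert last_notMem_segPts, e4]
  simp only [Finset.prod_insert last_notMem_segPts]
  rw [Finset.prod_mul_distrib, e3, ← hF]
  rw [← hF] at h6 h7
  set a := F (vac ℚ) (segPts n i true)
  set b := F (vac ℚ) (segPts n i false)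
  set c := ∏ p ∈ segPts n i true, ∏ q ∈ segPts n i false, θ p q
  have : c * (a * b) ≠ 0 := mul_ne_zero h5 (mul_ne_zero h6 h7)
  intro e
  apply this
  simp only [if_true, Bool.false_eq_true, if_false] at e
  linear_combination 3 * e

end LongRoot

/-! ### Nonvanishing of the root vectors in type `D` -/

section CartanD
variable {n : ℕ}

lemma aD_comm (n i j : ℕ) : aD n i j = aD n j i := by
  simp only [aD, eq_comm (a := i) (b := j), or_comm]

lemma halfForm_D_comm (i j : ℕ) : halfForm (aD n) (dD n) i j = halfForm (aD n) (dD n) j i := by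
  simp [halfForm, dD, aD_comm n i j]

lemma halfForm_D_self (k : ℕ) : halfForm (aD n) (dD n) k k = 1 := by
  simp [halfForm, aD, dD]

lemma halfForm_D_succ {k : ℕ} (h : k + 1 < n) :
    halfForm (aD n) (dD n) k (k + 1) = -1 / 2 := by
  have h₁ : aD n k (k + 1) = -1 := by
    rw [aD, if_neg (by omega), if_pos (by omega)]
  simp [halfForm, h₁, dD]

lemma halfForm_D_fork {k : ℕ} (h : k + 2 = n) :
    halfForm (aD n) (dD n) k n = -1 / 2 := by
  have h₁ : aD n k n = -1 := by
    rw [aD, if_neg (by omega), if_neg (by omega), if_pos (by omega)]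
  simp [halfForm, h₁, dD]

lemma halfForm_D_far {k k' : ℕ} (h : k < k') (h' : ¬ (k + 1 = k' ∧ k' < n))
    (h'' : ¬ (k + 2 = n ∧ k' = n)) :
    halfForm (aD n) (dD n) k k' = 0 ∧ halfForm (aD n) (dD n) k' k = 0 := by
  have h₁ : aD n k k' = 0 := by
    rw [aD, if_neg (by omega), if_neg (by omega), if_neg (by omega)]
  rw [halfForm_D_comm k' k]
  simp [halfForm, h₁]

lemma cartanLike_D (n : ℕ) : CartanLike n (aD n) (dD n) where
  diag i := by simp [aD]
  offdiag i j h := by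
    rw [aD, if_neg h]
    split_ifs <;> simp
  symm i j _ _ := by rw [aD_comm n i j]; rfl
  pos i := by simp [dD]

/-- The parameters detecting the roots in type `D`. -/
def chainValD (n : ℕ) : Bool × ℕ → ℚ := shiftVal fun k => if k = n then ((n : ℚ) - 1) / 2 else k / 2

lemma chainValD_of_ne {k : ℕ} (h : k ≠ n) (b : Bool) :
    chainValD n (b, k) = (if b then 2 else 0) - (k : ℚ) / 2 := by
  simp [chainValD, shiftVal, h]

lemma chainValD_last (b : Bool) :
    chainValD n (b, n) = (if b then 2 else 0) - ((n : ℚ) - 1) / 2 := by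
  simp [chainValD, shiftVal]

lemma chainValD_sub_self {k : ℕ} (b b' : Bool) :
    chainValD n (b, k) - chainValD n (b', k) =
      (if b then 2 else 0) - (if b' then 2 else 0) := by
  simp [chainValD, shiftVal]

lemma chainValD_sub_succ {k : ℕ} (h : k + 1 < n) (b b' : Bool) :
    chainValD n (b, k) - chainValD n (b', k + 1) =
      (if b then 2 else 0) - (if b' then 2 else 0) + 1 / 2 := by
  rw [chainValD_of_ne (by omega), chainValD_of_ne (by omega)]
  push_cast
  ring

lemma chainValD_sub_fork {k : ℕ} (h : k + 2 = n) (b b' : Bool) :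
    chainValD n (b, k) - chainValD n (b', n) =
      (if b then 2 else 0) - (if b' then 2 else 0) + 1 / 2 := by
  rw [chainValD_of_ne (by omega), chainValD_last, ← h]
  push_cast
  ring

lemma chainValD_ne_succ {k : ℕ} (h : k + 1 < n) (b b' : Bool) :
    chainValD n (b, k) ≠ chainValD n (b', k + 1) := by
  rw [← sub_ne_zero, chainValD_sub_succ h]
  cases b <;> cases b' <;> norm_num

lemma chainValD_ne_fork {k : ℕ} (h : k + 2 = n) (b b' : Bool) :
    chainValD n (b, k) ≠ chainValD n (b', n) := by
  rw [← sub_ne_zero, chainValD_sub_fork h]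
  cases b <;> cases b' <;> norm_num

lemma genericVal_chainValD (n : ℕ) : GenericVal (aD n) (dD n) n (chainValD n) := by
  refine genericVal_of_path (fun k => by simp [chainValD, shiftVal]) fun k k' hlt _ => ?_
  by_cases h1 : k + 1 = k' ∧ k' < n
  · obtain ⟨rfl, h1⟩ := h1
    exact Or.inr (chainValD_ne_succ h1)
  · by_cases h2 : k + 2 = n ∧ k' = n
    · obtain ⟨h2, rfl⟩ := h2
      exact Or.inr (chainValD_ne_fork h2)
    · exact Or.inl (halfForm_D_far hlt h1 h2)

lemma ratTh_D_self {k : ℕ} (b b' : Bool) :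
    ratTh (aD n) (dD n) (chainValD n) (b, k) (b', k) =
      1 + 1 / ((if b then 2 else 0) - (if b' then 2 else 0)) :=
  ratTh_eq (halfForm_D_self k) (chainValD_sub_self b b')

lemma ratTh_D_succ {k : ℕ} (h : k + 1 < n) (b b' : Bool) :
    ratTh (aD n) (dD n) (chainValD n) (b, k) (b', k + 1) =
      1 + -1 / 2 / ((if b then 2 else 0) - (if b' then 2 else 0) + 1 / 2) :=
  ratTh_eq (halfForm_D_succ h) (chainValD_sub_succ h b b')

lemma ratTh_D_pred {k : ℕ} (h : k + 1 < n) (b b' : Bool) :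
    ratTh (aD n) (dD n) (chainValD n) (b, k + 1) (b', k) =
      1 + -1 / 2 / -((if b' then 2 else 0) - (if b then 2 else 0) + 1 / 2) :=
  ratTh_eq ((halfForm_D_comm _ _).trans (halfForm_D_succ h))
    ((neg_sub _ _).symm.trans (congrArg Neg.neg (chainValD_sub_succ h b' b)))

lemma ratTh_D_fork {k : ℕ} (h : k + 2 = n) (b b' : Bool) :
    ratTh (aD n) (dD n) (chainValD n) (b, k) (b', n) =
      1 + -1 / 2 / ((if b then 2 else 0) - (if b' then 2 else 0) + 1 / 2) :=
  ratTh_eq (halfForm_D_fork h) (chainValD_sub_fork h b b')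

lemma ratTh_D_fork' {k : ℕ} (h : k + 2 = n) (b b' : Bool) :
    ratTh (aD n) (dD n) (chainValD n) (b, n) (b', k) =
      1 + -1 / 2 / -((if b' then 2 else 0) - (if b then 2 else 0) + 1 / 2) :=
  ratTh_eq ((halfForm_D_comm _ _).trans (halfForm_D_fork h))
    ((neg_sub _ _).symm.trans (congrArg Neg.neg (chainValD_sub_fork h b' b)))

/-- The weight space detecting `[i,n,j]` in type `D`. -/
def foldPtsD (n i j : ℕ) : Finset (Bool × ℕ) :=
  {false} ×ˢ Finset.Icc i n ∪ {true} ×ˢ Finset.Ico j (n - 1)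

lemma mem_foldPtsD_false {i j k : ℕ} : (false, k) ∈ foldPtsD n i j ↔ i ≤ k ∧ k ≤ n := by
  simp [foldPtsD]

lemma mem_foldPtsD_true {i j k : ℕ} : (true, k) ∈ foldPtsD n i j ↔ j ≤ k ∧ k < n - 1 := by
  simp [foldPtsD]

lemma foldPtsD_erase {i j : ℕ} :
    (foldPtsD n i j).erase (true, j) = foldPtsD n i (j + 1) := by
  ext ⟨b, k⟩
  rw [Finset.mem_erase]
  cases b
  · rw [mem_foldPtsD_false, mem_foldPtsD_false]
    simp
  · rw [mem_foldPtsD_true, mem_foldPtsD_true]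
    simp only [ne_eq, Prod.mk.injEq, true_and]
    omega

lemma oneEval_chainD_ne_zero {i l : ℕ} (h : i + l < n ∨ l = 0) :
    oneEval (aD n) (dD n) (chainValD n) ((BrTree.leaf i true).chain (List.range' (i + 1) l)) (vac ℚ)
      ({false} ×ˢ Finset.Icc i (i + l)) ≠ 0 := by
  refine oneEval_chain_range' false true i l ?_ ?_
  · intro k h1 h2
    refine ⟨halfForm_D_comm _ _, ?_, (chainValD_ne_succ (by omega) _ _).symm⟩
    rw [halfForm_D_comm, halfForm_D_succ (by omega)]
    norm_num
  · intro k k' _ h2 _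
    exact halfForm_D_far (by omega) (by omega) (by omega)

lemma oneEval_forkD_ne_zero {i : ℕ} (h : i + 2 ≤ n) :
    oneEval (aD n) (dD n) (chainValD n)
      (.node ((BrTree.leaf i true).chain (List.range' (i + 1) (n - 2 - i))) (.leaf n false)) (vac ℚ)
      (insert (false, n) ({false} ×ˢ Finset.Icc i (n - 2))) ≠ 0 := by
  have hn : ((false, n) : Bool × ℕ) ∉ ({false} ×ˢ Finset.Icc i (n - 2) : Finset (Bool × ℕ)) := by
    simp only [Finset.mem_product, Finset.mem_Icc, not_and]
    omega
  refine oneEval_single_ne_zero (b := false) (Finset.mem_insert_self _ _) (by simp) ?_ ?_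
  · refine stepCoeff_ne_zero_of_unique (r := (false, n - 2)) ?_ ?_ (halfForm_D_comm _ _) ?_
      (chainValD_ne_fork (by omega) _ _).symm ?_
    · refine Finset.mem_insert_of_mem ?_
      simp only [Finset.mem_product, Finset.mem_Icc, Finset.mem_singleton, true_and]
      omega
    · simp only [ne_eq, Prod.mk.injEq, true_and]
      omega
    · rw [halfForm_D_comm, halfForm_D_fork (by simp only; omega)]
      norm_num
    · rintro ⟨b, k⟩ hk h1 h2
      rcases Finset.mem_insert.1 hk with hk | hk
      · exact absurd hk h1
      · simp only [Finset.mem_product, Finset.mem_Icc, Finset.mem_singleton] at hk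
        obtain ⟨rfl, hk⟩ := hk
        simp only [ne_eq, Prod.mk.injEq, true_and] at h2
        exact halfForm_D_far (by simp only; omega) (by simp only; omega) (by simp only; omega)
  · rw [Finset.erase_insert hn]
    have := oneEval_chainD_ne_zero (n := n) (i := i) (l := n - 2 - i) (by omega)
    rwa [show i + (n - 2 - i) = n - 2 by omega] at this

lemma oneEval_wedgeD_ne_zero {i : ℕ} (h : i + 2 ≤ n) :
    oneEval (aD n) (dD n) (chainValD n)
      (.node (.node ((BrTree.leaf i true).chain (List.range' (i + 1) (n - 2 - i))) (.leaf n false))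
        (.leaf (n - 1) false)) (vac ℚ) ({false} ×ˢ Finset.Icc i n) ≠ 0 := by
  refine oneEval_single_ne_zero (b := false) ?_ (by simp) ?_ ?_
  · simp only [Finset.mem_product, Finset.mem_Icc, Finset.mem_singleton, true_and]
    omega
  · refine stepCoeff_ne_zero_of_unique (r := (false, n - 2)) ?_ ?_ (halfForm_D_comm _ _) ?_ ?_ ?_
    · simp only [Finset.mem_product, Finset.mem_Icc, Finset.mem_singleton, true_and]
      omega
    · simp only [ne_eq, Prod.mk.injEq, true_and]
      omega
    · have := halfForm_D_succ (n := n) (k := n - 2) (by omega)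
      rw [show n - 2 + 1 = n - 1 by omega, halfForm_D_comm] at this
      rw [this]
      norm_num
    · have := chainValD_ne_succ (n := n) (k := n - 2) (by omega) false false
      rw [show n - 2 + 1 = n - 1 by omega] at this
      exact this.symm
    · rintro ⟨b, k⟩ hk h1 h2
      simp only [Finset.mem_product, Finset.mem_Icc, Finset.mem_singleton] at hk
      obtain ⟨rfl, hk⟩ := hk
      simp only [ne_eq, Prod.mk.injEq, true_and] at h1 h2
      rcases (show k < n - 1 ∨ k = n by omega) with h3 | rfl
      · exact halfForm_D_far h3 (by omega) (by omega)
      · exact (halfForm_D_far (by omega) (by omega) (by omega)).symm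
  · have e : ({false} ×ˢ Finset.Icc i n : Finset (Bool × ℕ)).erase (false, n - 1) =
        insert (false, n) ({false} ×ˢ Finset.Icc i (n - 2)) := by
      ext ⟨b, k⟩
      rw [Finset.mem_erase, Finset.mem_insert]
      simp only [Finset.mem_product, Finset.mem_Icc, Finset.mem_singleton, ne_eq, Prod.mk.injEq]
      cases b <;> simp <;> omega
    rw [e]
    exact oneEval_forkD_ne_zero h

lemma stepCoeff_D_false {i j : ℕ} (hij : i < j) (hj : j + 1 < n) :
    stepCoeff (aD n) (dD n) (chainValD n) (foldPtsD n i j) (false, j) = 0 := by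
  obtain ⟨k, rfl⟩ : ∃ k, j = k + 1 := ⟨j - 1, by omega⟩
  refine stepCoeff_eq_zero (q := (false, k)) (r := (false, k + 2)) ?_ ?_ ?_ ?_
  · rw [Finset.mem_erase, mem_foldPtsD_false]
    simp only [ne_eq, Prod.mk.injEq, true_and]
    omega
  · rw [Finset.mem_erase, mem_foldPtsD_false]
    simp only [ne_eq, Prod.mk.injEq, true_and]
    omega
  · rw [ratTh_D_succ (by omega)]
    norm_num
  · rw [ratTh_D_succ (k := k + 1) hj]
    norm_num

lemma stepCoeff_D_true {i j : ℕ} (hij : i < j) (hj : j + 1 < n) :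
    stepCoeff (aD n) (dD n) (chainValD n) (foldPtsD n i j) (true, j) ≠ 0 := by
  obtain ⟨k, rfl⟩ : ∃ k, j = k + 1 := ⟨j - 1, by omega⟩
  rcases (show k + 3 < n ∨ k + 3 = n by omega) with h | h
  · refine stepCoeff_ne_zero (r := (true, k + 2)) ?_ ?_ ?_
    · rw [Finset.mem_erase, mem_foldPtsD_true]
      simp only [ne_eq, Prod.mk.injEq, true_and]
      omega
    · rintro ⟨b, l⟩ hl
      rcases (show l + 1 < k + 1 ∨ l = k ∨ l = k + 1 ∨ l = k + 2 ∨ k + 2 < l by omega) with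
        hl' | rfl | rfl | rfl | hl'
      · rw [ratTh_eq_one (halfForm_D_far (k := l) (k' := k + 1) (by omega) (by omega) (by omega)).1]
        norm_num
      · cases b
        · rw [ratTh_D_succ (by omega)]
          norm_num
        · rw [Finset.mem_erase, mem_foldPtsD_true] at hl
          omega
      · cases b
        · rw [ratTh_D_self]
          norm_num
        · simp at hl
      · rw [ratTh_D_pred (k := k + 1) hj]
        cases b <;> norm_num
      · rw [ratTh_eq_one (halfForm_D_far (k := k + 1) (k' := l) (by omega) (by omega) (by omega)).2]
        norm_num
    · rw [ratTh_D_succ (k := k + 1) hj]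
      norm_num
  · rw [stepCoeff_eq_of_subset (S := {(false, k), (false, k + 1), (false, k + 2), (false, n)})]
    · have e1 : ((false, k) : Bool × ℕ) ∉
          ({(false, k + 1), (false, k + 2), (false, n)} : Finset (Bool × ℕ)) := by
        simp only [Finset.mem_insert, Finset.mem_singleton, Prod.mk.injEq, true_and]
        omega
      have e2 : ((false, k + 1) : Bool × ℕ) ∉
          ({(false, k + 2), (false, n)} : Finset (Bool × ℕ)) := by
        simp only [Finset.mem_insert, Finset.mem_singleton, Prod.mk.injEq, true_and]
        omega
      have e3 : ((false, k + 2) : Bool × ℕ) ∉ ({(false, n)} : Finset (Bool × ℕ)) := by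
        simp only [Finset.mem_singleton, Prod.mk.injEq, true_and]
        omega
      rw [Finset.prod_insert e1, Finset.prod_insert e2, Finset.prod_insert e3,
        Finset.prod_singleton, Finset.prod_insert e1, Finset.prod_insert e2,
        Finset.prod_insert e3, Finset.prod_singleton,
        ratTh_D_succ (k := k) (by omega), ratTh_D_pred (k := k) (by omega),
        ratTh_D_self, ratTh_D_self,
        ratTh_D_succ (k := k + 1) hj, ratTh_D_pred (k := k + 1) hj,
        ratTh_D_fork h, ratTh_D_fork' h]
      norm_num
    · intro p hp
      simp only [Finset.mem_insert, Finset.mem_singleton] at hp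
      rcases hp with rfl | rfl | rfl | rfl <;> rw [Finset.mem_erase, mem_foldPtsD_false] <;>
        refine ⟨by simp, ?_⟩ <;> omega
    · rintro ⟨b, l⟩ hl hl'
      rw [Finset.mem_erase] at hl
      cases b
      · rw [mem_foldPtsD_false] at hl
        simp only [Finset.mem_insert, Finset.mem_singleton, Prod.mk.injEq, true_and] at hl'
        exact halfForm_D_far (by simp only; omega) (by simp only; omega) (by simp only; omega)
      · rw [mem_foldPtsD_true] at hl
        simp only [ne_eq, Prod.mk.injEq, true_and] at hl
        omega

lemma oneEval_foldD_ne_zero {i : ℕ} (d : ℕ) (h : i + d + 2 ≤ n) :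
    oneEval (aD n) (dD n) (chainValD n)
      ((BrTree.node ((BrTree.leaf i true).chain (List.range' (i + 1) (n - 2 - i)))
        (.leaf n false)).chain (List.range' (n - 1 - d) (d + 1)).reverse) (vac ℚ)
      (foldPtsD n i (n - 1 - d)) ≠ 0 := by
  induction d with
  | zero =>
    have := oneEval_wedgeD_ne_zero (n := n) (i := i) (by omega)
    simpa [foldPtsD, BrTree.chain] using this
  | succ d ih =>
    obtain ⟨j, hj⟩ : ∃ j, j = n - 1 - (d + 1) := ⟨_, rfl⟩
    have ih := ih (by omega)
    rw [show n - 1 - d = j + 1 by omega] at ih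
    rw [← hj, reverse_range'_succ, BrTree.chain_append]
    refine oneEval_double_ne_zero (mem_foldPtsD_true.2 ⟨le_rfl, by omega⟩)
      (stepCoeff_D_true (by omega) (by omega)) (stepCoeff_D_false (by omega) (by omega)) ?_
    rw [foldPtsD_erase]
    exact ih

end CartanD

/-! ### The bracketings of the specific root vectors detect the positive roots -/

section WordTree

lemma wordTree_flags (w : List ℕ) : (wordTree w).flags = 1 := by
  cases w with
  | nil => rfl
  | cons i w => exact BrTree.flags_chain _ _

lemma wordTree_leaves {w : List ℕ} (hw : w ≠ []) : (wordTree w).leaves = w := by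
  cases w with
  | nil => exact absurd rfl hw
  | cons i w => exact BrTree.leaves_chain _ _

lemma chainY_eq_wordTree {B : Type} [Ring B] (g : ℕ → ℕ → B) {w : List ℕ} (hw : w ≠ []) (s : ℕ) :
    chainY g w (s :: List.replicate (w.length - 1) 0) = (wordTree w).eval g s := by
  cases w with
  | nil => exact absurd rfl hw
  | cons i w => exact BrTree.chainY_cons g i s w

end WordTree

section DetectsC
variable {n : ℕ}

lemma length_wordC (β : PosRootC n) : (wordC β).length =
    if ri β + rt β < n ∨ ri β = n then rt β + 1
    else if ri β + rt β = n then 2 * (n - ri β) + 1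
    else if ri β + rt β = n + 1 then n - ri β + 1 else rt β := by
  obtain ⟨h1, h2, h3⟩ : 1 ≤ ri β ∧ (ri β = n → rt β = 0) ∧ rt β + 2 * ri β ≤ 2 * n := β.2
  rw [wordC]
  split_ifs <;> simp only [List.length_append, List.length_range', List.length_reverse,
    List.length_singleton] <;> omega

lemma wordC_ne_nil (β : PosRootC n) : wordC β ≠ [] := by
  obtain ⟨h1, h2, h3⟩ : 1 ≤ ri β ∧ (ri β = n → rt β = 0) ∧ rt β + 2 * ri β ≤ 2 * n := β.2
  rw [← List.length_pos_iff, length_wordC]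
  split_ifs <;> omega

lemma ri_mem_wordC (β : PosRootC n) : ri β ∈ wordC β := by
  obtain ⟨h1, h2, h3⟩ : 1 ≤ ri β ∧ (ri β = n → rt β = 0) ∧ rt β + 2 * ri β ≤ 2 * n := β.2
  rw [wordC]
  split_ifs <;> simp only [List.mem_append, List.mem_range'_1] <;> omega

lemma mem_wordC {β : PosRootC n} {k : ℕ} (hk : k ∈ wordC β) : ri β ≤ k ∧ k ≤ n := by
  obtain ⟨h1, h2, h3⟩ : 1 ≤ ri β ∧ (ri β = n → rt β = 0) ∧ rt β + 2 * ri β ≤ 2 * n := β.2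
  rw [wordC] at hk
  split_ifs at hk <;> simp only [List.mem_append, List.mem_range'_1, List.mem_reverse,
    List.mem_singleton] at hk <;> omega

lemma posRootC_ext {β γ : PosRootC n} (h : ri β = ri γ) (h' : rt β = rt γ) : β = γ :=
  Subtype.ext (Prod.ext (Fin.ext h) (Fin.ext h'))

lemma treeC_of_isINI {β : PosRootC n} (h : isINI β) :
    treeC β = .node (arm n (ri β)) (.node (arm n (ri β)) (.leaf n true)) := by
  rw [treeC, if_pos h]
  rfl

lemma treeC_of_not_isINI {β : PosRootC n} (h : ¬ isINI β) : treeC β = wordTree (wordC β) := by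
  rw [treeC, if_neg h]

lemma treeC_leaves (β : PosRootC n) : (treeC β).leaves = wordC β := by
  by_cases h : isINI β
  · obtain ⟨h1, h2⟩ := id h
    rw [treeC_of_isINI h, wordC, if_neg (by omega), if_pos h1, BrTree.leaves, BrTree.leaves,
      BrTree.leaves, leaves_arm h2, ← add_assoc]
    rfl
  · rw [treeC_of_not_isINI h, wordTree_leaves (wordC_ne_nil β)]

lemma treeC_flags (β : PosRootC n) : (treeC β).flags = 1 := by
  by_cases h : isINI β
  · rw [treeC_of_isINI h, BrTree.flags, BrTree.flags, arm, BrTree.flags_chain]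
    rfl
  · rw [treeC_of_not_isINI h, wordTree_flags]

lemma treeC_leaves_injective :
    Function.Injective fun β : PosRootC n => (treeC β).leaves := by
  intro β γ h
  obtain ⟨h1, h2, h3⟩ : 1 ≤ ri β ∧ (ri β = n → rt β = 0) ∧ rt β + 2 * ri β ≤ 2 * n := β.2
  obtain ⟨h1', h2', h3'⟩ : 1 ≤ ri γ ∧ (ri γ = n → rt γ = 0) ∧ rt γ + 2 * ri γ ≤ 2 * n := γ.2
  simp only [treeC_leaves, Multiset.coe_eq_coe] at h
  have hi : ri β = ri γ := le_antisymm (mem_wordC (h.mem_iff.2 (ri_mem_wordC γ))).1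
    (mem_wordC (h.mem_iff.1 (ri_mem_wordC β))).1
  refine posRootC_ext hi ?_
  have hl := h.length_eq
  rw [length_wordC, length_wordC] at hl
  split_ifs at hl <;> omega

lemma treeC_exists_ne (β : PosRootC n) : ∃ v T, GenericVal (aC n) (dC n) n v ∧
    oneEval (aC n) (dC n) v (treeC β) (vac ℚ) T ≠ 0 := by
  obtain ⟨h1, h2, h3⟩ : 1 ≤ ri β ∧ (ri β = n → rt β = 0) ∧ rt β + 2 * ri β ≤ 2 * n := β.2
  by_cases h : isINI β
  · rw [treeC_of_isINI h]
    exact ⟨_, _, genericVal_longValC n, oneEval_long_ne_zero h.2⟩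
  · rw [treeC_of_not_isINI h, wordC]
    unfold isINI at h
    by_cases c1 : ri β + rt β < n ∨ ri β = n
    · rw [if_pos c1, List.range'_succ]
      exact ⟨_, _, genericVal_chainValC n, oneEval_chainC_ne_zero (by omega)⟩
    rw [if_neg c1, if_neg (by omega)]
    by_cases c2 : ri β + rt β = n + 1
    · rw [if_pos c2, List.range'_succ]
      exact ⟨_, _, genericVal_chainValC n, oneEval_chainC_ne_zero (by omega)⟩
    · rw [if_neg c2, List.range'_succ, List.cons_append, wordTree, BrTree.chain_append]
      obtain ⟨d, hd, hd'⟩ : ∃ d, 2 * n + 1 - ri β - rt β = n - d ∧ ri β + d < n :=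
        ⟨ri β + rt β - n - 1, by omega, by omega⟩
      rw [hd, show n - (n - d) = d by omega]
      exact ⟨_, _, genericVal_chainValC n, oneEval_foldC_ne_zero d hd'⟩

lemma detects_treeC (n : ℕ) : Detects n (aC n) (dC n) (treeC : PosRootC n → BrTree) where
  flags := treeC_flags
  injective := treeC_leaves_injective
  mem_Icc β i hi := by
    have h1 : 1 ≤ ri β := β.2.1
    rw [treeC_leaves, Multiset.mem_coe] at hi
    exact Finset.mem_Icc.2 ⟨h1.trans (mem_wordC hi).1, (mem_wordC hi).2⟩
  exists_ne := treeC_exists_ne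

lemma exists_treeC_eq_leaf {k : ℕ} (hk : k ∈ Finset.Icc 1 n) :
    ∃ β : PosRootC n, treeC β = .leaf k true := by
  rw [Finset.mem_Icc] at hk
  have hw : wordC (mkRootC (n := n) (i := k) (t := 0) hk.1 (fun _ => rfl) (by omega)) = [k] := by
    rw [wordC, if_pos (by change k + 0 < n ∨ k = n; omega)]
    rfl
  refine ⟨mkRootC (n := n) (i := k) (t := 0) hk.1 (fun _ => rfl) (by omega), ?_⟩
  rw [treeC_of_not_isINI (by rintro ⟨h, h'⟩; change k + 0 = n at h; change k < n at h'; omega), hw]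
  rfl

lemma xTildeC_eq_eval (β : PosRootC n) (s : ℕ) :
    xTildeC β s = (treeC β).eval (gy1 n (aC n) (dC n)) s := by
  by_cases h : isINI β
  · have e : chainY (genYC n) (List.range' (ri β) (n - ri β)) (List.replicate (n - ri β) 0) =
        (arm n (ri β)).eval (gy1 n (aC n) (dC n)) s := by
      obtain ⟨l, hl⟩ : ∃ l, n - ri β = l + 1 := ⟨n - ri β - 1, by have := h.2; omega⟩
      rw [arm, hl, List.range'_succ, Nat.add_sub_cancel, BrTree.eval_chain, List.length_range']
      rfl
    rw [xTildeC, if_pos h, treeC_of_isINI h, e]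
    rfl
  · rw [xTildeC, if_neg h, treeC_of_not_isINI h, chainY_eq_wordTree _ (wordC_ne_nil β)]
    rfl

end DetectsC

section DetectsD
variable {n : ℕ}

lemma posRootD_bounds (β : PosRootD n) : 1 ≤ riD β ∧ (n - 1 ≤ riD β → rtD β = 0) ∧
    (rtD β = 0 ∨ rtD β + 2 * riD β + 1 ≤ 2 * n) ∧ riD β ≤ n :=
  ⟨β.2.1, β.2.2.1, β.2.2.2, Nat.lt_succ_iff.1 (ofLex β.1).1.2⟩

lemma length_wordD (β : PosRootD n) : (wordD β).length =
    if riD β + rtD β < n ∨ riD β = n then rtD β + 1 else rtD β := by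
  obtain ⟨h1, h2, h3, h4⟩ := posRootD_bounds β
  rw [wordD]
  split_ifs <;> simp only [List.length_append, List.length_range', List.length_reverse,
    List.length_cons, List.length_nil] <;> omega

lemma wordD_ne_nil (β : PosRootD n) : wordD β ≠ [] := by
  obtain ⟨h1, h2, h3, h4⟩ := posRootD_bounds β
  rw [← List.length_pos_iff, length_wordD]
  split_ifs <;> omega

lemma riD_mem_wordD (β : PosRootD n) : riD β ∈ wordD β := by
  obtain ⟨h1, h2, h3, h4⟩ := posRootD_bounds β
  rw [wordD]
  split_ifs <;> simp only [List.mem_append, List.mem_range'_1] <;> omega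

lemma mem_wordD {β : PosRootD n} {k : ℕ} (hk : k ∈ wordD β) : riD β ≤ k ∧ k ≤ n := by
  obtain ⟨h1, h2, h3, h4⟩ := posRootD_bounds β
  rw [wordD] at hk
  split_ifs at hk <;> simp only [List.mem_append, List.mem_range'_1, List.mem_reverse,
    List.mem_cons, List.not_mem_nil, or_false] at hk <;> omega

lemma last_mem_wordD_iff {β : PosRootD n} :
    n ∈ wordD β ↔ ¬ (riD β + rtD β < n ∨ riD β = n) ∨ riD β = n := by
  obtain ⟨h1, h2, h3, h4⟩ := posRootD_bounds β
  rw [wordD]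
  split_ifs <;> simp only [List.mem_append, List.mem_range'_1, List.mem_reverse,
    List.mem_cons, List.not_mem_nil, or_false, or_true, true_or, true_iff] <;> omega

lemma posRootD_ext {β γ : PosRootD n} (h : riD β = riD γ) (h' : rtD β = rtD γ) : β = γ :=
  Subtype.ext (Prod.ext (Fin.ext h) (Fin.ext h'))

lemma treeD_leaves (β : PosRootD n) : (treeD β).leaves = wordD β :=
  wordTree_leaves (wordD_ne_nil β)

lemma treeD_leaves_injective :
    Function.Injective fun β : PosRootD n => (treeD β).leaves := by
  intro β γ h
  obtain ⟨h1, h2, h3, h4⟩ := posRootD_bounds β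
  obtain ⟨h1', h2', h3', h4'⟩ := posRootD_bounds γ
  simp only [treeD_leaves, Multiset.coe_eq_coe] at h
  have hi : riD β = riD γ := le_antisymm (mem_wordD (h.mem_iff.2 (riD_mem_wordD γ))).1
    (mem_wordD (h.mem_iff.1 (riD_mem_wordD β))).1
  refine posRootD_ext hi ?_
  have hl := h.length_eq
  have hn := h.mem_iff (a := n)
  rw [last_mem_wordD_iff, last_mem_wordD_iff] at hn
  rw [length_wordD, length_wordD] at hl
  split_ifs at hl <;> omega

lemma treeD_exists_ne (β : PosRootD n) : ∃ v T, GenericVal (aD n) (dD n) n v ∧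
    oneEval (aD n) (dD n) v (treeD β) (vac ℚ) T ≠ 0 := by
  obtain ⟨h1, h2, h3, h4⟩ := posRootD_bounds β
  rw [treeD, wordD]
  by_cases c1 : riD β + rtD β < n ∨ riD β = n
  · rw [if_pos c1, List.range'_succ]
    exact ⟨_, _, genericVal_chainValD n, oneEval_chainD_ne_zero (by omega)⟩
  rw [if_neg c1, show n - 1 - riD β = n - 2 - riD β + 1 by omega, List.range'_succ]
  by_cases c2 : riD β + rtD β = n
  · rw [if_pos c2, List.cons_append, wordTree, BrTree.chain_append]
    exact ⟨_, _, genericVal_chainValD n, oneEval_forkD_ne_zero (by omega)⟩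
  obtain ⟨d, hd, hd'⟩ : ∃ d, 2 * n - riD β - rtD β = n - 1 - d ∧ riD β + d + 2 ≤ n :=
    ⟨riD β + rtD β - n - 1, by omega, by omega⟩
  have key := oneEval_foldD_ne_zero d hd'
  rw [if_neg c2]
  by_cases c3 : riD β + rtD β = n + 1
  · obtain rfl : d = 0 := by omega
    rw [if_pos c3, List.cons_append, wordTree, BrTree.chain_append]
    exact ⟨_, _, genericVal_chainValD n, key⟩
  · rw [if_neg c3, List.cons_append, List.cons_append, wordTree, BrTree.chain_append,
      BrTree.chain_append, hd, show n - (n - 1 - d) = d + 1 by omega]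
    exact ⟨_, _, genericVal_chainValD n, key⟩

lemma detects_treeD (n : ℕ) : Detects n (aD n) (dD n) (treeD : PosRootD n → BrTree) where
  flags β := wordTree_flags _
  injective := treeD_leaves_injective
  mem_Icc β i hi := by
    rw [treeD_leaves, Multiset.mem_coe] at hi
    exact Finset.mem_Icc.2 ⟨(posRootD_bounds β).1.trans (mem_wordD hi).1, (mem_wordD hi).2⟩
  exists_ne := treeD_exists_ne

lemma exists_treeD_eq_leaf {k : ℕ} (hk : k ∈ Finset.Icc 1 n) :
    ∃ β : PosRootD n, treeD β = .leaf k true := by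
  rw [Finset.mem_Icc] at hk
  refine ⟨mkRootD (n := n) (i := k) (t := 0) hk.1 (fun _ => rfl) (Or.inl rfl) hk.2, ?_⟩
  rw [treeD, wordD, if_pos (by change k + 0 < n ∨ k = n; omega)]
  rfl

lemma xTildeD_eq_eval (β : PosRootD n) (s : ℕ) :
    xTildeD β s = (treeD β).eval (gy1 n (aD n) (dD n)) s :=
  chainY_eq_wordTree _ (wordD_ne_nil β) s

end DetectsD

/-! ### The basis theorem -/

lemma pbw_of_detects {Root : Type} [LinearOrder Root] {n : ℕ} {A : ℕ → ℕ → ℤ} {Dd : ℕ → ℕ}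
    {tr : Root → BrTree} {E : Root → ℕ → YA n A Dd} (hA : CartanLike n A Dd)
    (htr : Detects n A Dd tr) (hsimple : ∀ k ∈ Finset.Icc 1 n, ∃ β, tr β = .leaf k true)
    (hcl : BracketClosed n A tr) (hE : ∀ β s, E β s = (tr β).eval (gy1 n A Dd) s) :
    LinearIndependent RH (fun h : Lex (Root × ℕ) →₀ ℕ =>
      ordMon (fun p => E (ofLex p).1 (ofLex p).2) h) ∧
    Submodule.span RH (Set.range (fun h : Lex (Root × ℕ) →₀ ℕ =>
      ordMon (fun p => E (ofLex p).1 (ofLex p).2) h)) = ⊤ ∧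
    Module.Free RH (YA n A Dd) := by
  obtain rfl : E = fun β s => (tr β).eval (gy1 n A Dd) s := funext₂ hE
  have hli := linearIndependent_ordMon hA htr
  have hsp := span_ordMon_eq_top hA hsimple hcl
  exact ⟨hli, hsp, Module.Free.of_basis (Module.Basis.mk hli hsp.ge)⟩

/-- **PBW basis of `Y_ħ^>(g)` for the specific root vectors `X̃_{β,s}`** (`g` of type `C_n`
with `n ≥ 2`, or of type `D_n` with `n ≥ 4`): the ordered monomials `{X̃_h}_{h∈𝓗}` form a
basis of the free `ℚ[ħ]`-module `Y_ħ^>(g)`. -/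
theorem yangian_pbw_specific (n : ℕ) :
    (2 ≤ n →
      LinearIndependent RH (fun h : Lex (PosRootC n × ℕ) →₀ ℕ =>
        ordMon (fun p => xTildeC (ofLex p).1 (ofLex p).2) h) ∧
      Submodule.span RH (Set.range (fun h : Lex (PosRootC n × ℕ) →₀ ℕ =>
        ordMon (fun p => xTildeC (ofLex p).1 (ofLex p).2) h)) = ⊤ ∧
      Module.Free RH (YC n)) ∧
    (4 ≤ n →
      LinearIndependent RH (fun h : Lex (PosRootD n × ℕ) →₀ ℕ =>
        ordMon (fun p => xTildeD (ofLex p).1 (ofLex p).2) h) ∧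
      Submodule.span RH (Set.range (fun h : Lex (PosRootD n × ℕ) →₀ ℕ =>
        ordMon (fun p => xTildeD (ofLex p).1 (ofLex p).2) h)) = ⊤ ∧
      Module.Free RH (YD n)) := by
  refine ⟨fun hn => ?_, fun hn => ?_⟩
  · obtain ⟨m, rfl⟩ : ∃ m, n = m + 1 := ⟨n - 1, by omega⟩
    exact pbw_of_detects (cartanLike_C _) (detects_treeC _) (fun _ => exists_treeC_eq_leaf)
      (bracketClosed_treeC (by omega)) xTildeC_eq_eval
  · obtain ⟨m, rfl⟩ : ∃ m, n = m + 1 := ⟨n - 1, by omega⟩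
    exact pbw_of_detects (cartanLike_D _) (detects_treeD _) (fun _ => exists_treeD_eq_leaf)
      (bracketClosed_treeD (by omega)) xTildeD_eq_eval
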